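/- arXiv:1107.2493 — 2 statements merged into one kernel-verified Lean document; each statement's English description precedes it below -/
import Mathlib

section
/- For every countable unital subring R of ℝ there exists a uniquely ergodic Cantor minimal ℤ-system R_{ℤ,φ} (arising from a free minimal homeomorphism φ of a Cantor set X) such that F(R_{ℤ,φ}) = R₊^×, the group of positive invertible elements of R. -/
open MeasureTheory
open scoped ENNReal

/-- The group of self-homeomorphisms of a space, under composition. -/
instance homeomorphGroup {X : Type*} [TopologicalSpace X] : Group (X ≃ₜ X) where
  mul f g := g.trans f
  one := Homeomorph.refl X
  inv := Homeomorph.symm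
  mul_assoc f g h := rfl
  one_mul f := Homeomorph.ext fun x => rfl
  mul_one f := Homeomorph.ext fun x => rfl
  inv_mul_cancel f := Homeomorph.ext fun x => f.symm_apply_apply x

section Defs

variable {X Y : Type*} [TopologicalSpace X] [TopologicalSpace Y]

/-- The orbit equivalence relation `R_{G,φ}` of an action of `G` on `X` by homeomorphisms. -/
def orbitRelOf {G : Type*} [Group G] (φ : G →* (X ≃ₜ X)) : Set (X × X) :=
  {p | ∃ g : G, φ g p.1 = p.2}

/-- Freeness of an action by homeomorphisms. -/
def IsFreeAction {G : Type*} [Group G] (φ : G →* (X ≃ₜ X)) : Prop :=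
  ∀ g : G, g ≠ 1 → ∀ x : X, φ g x ≠ x

/-- The orbit relation of a single homeomorphism, i.e. of the generated `ℤ`-action. -/
def orbitRelZ (φ : X ≃ₜ X) : Set (X × X) :=
  {p | ∃ n : ℤ, (φ ^ n) p.1 = p.2}

/-- Freeness of the `ℤ`-action generated by a homeomorphism. -/
def IsFreeZ (φ : X ≃ₜ X) : Prop :=
  ∀ n : ℤ, n ≠ 0 → ∀ x : X, (φ ^ n) x ≠ x

/-- Minimality of an orbit equivalence relation: every class `R[x]` is dense. -/
def IsMinimalRel (R : Set (X × X)) : Prop :=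
  ∀ x : X, Dense {y : X | (x, y) ∈ R}

/-- A Borel measure is `R`-invariant if it is invariant under every homeomorphism `h`
with `(x, h x) ∈ R` for all `x`. -/
def IsInvariantMeasure [MeasurableSpace X] (R : Set (X × X)) (μ : Measure X) : Prop :=
  ∀ h : X ≃ₜ X, (∀ x : X, (x, h x) ∈ R) → Measure.map h μ = μ

/-- Restriction `R|_U = R ∩ (U × U)` of a relation, as a relation on the subtype `U`. -/
def restrictRel (R : Set (X × X)) (U : Set X) : Set (↥U × ↥U) :=
  {p | ((p.1 : X), (p.2 : X)) ∈ R}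

/-- `R^n` on `X × {1,…,n}`: `((x,i),(y,j)) ∈ R^n ↔ (x,y) ∈ R`. -/
def finProdRel (R : Set (X × X)) (n : ℕ) : Set ((X × Fin n) × (X × Fin n)) :=
  {p | (p.1.1, p.2.1) ∈ R}

/-- `R^∞` on `X × ℕ`: `((x,i),(y,j)) ∈ R^∞ ↔ (x,y) ∈ R`. -/
def natProdRel (R : Set (X × X)) : Set ((X × ℕ) × (X × ℕ)) :=
  {p | (p.1.1, p.2.1) ∈ R}

/-- Topological orbit equivalence of two equivalence relations: a homeomorphism `F` of the
underlying spaces with `(F × F)(R₁) = R₂`. -/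
def OrbitEquiv (R₁ : Set (X × X)) (R₂ : Set (Y × Y)) : Prop :=
  ∃ F : X ≃ₜ Y, ∀ x y : X, (x, y) ∈ R₁ ↔ (F x, F y) ∈ R₂

/-- The fundamental group `F(R)` of a uniquely ergodic Cantor minimal system, where `μ` is
the unique invariant probability measure: the set of values `(μ × δ)(U)` (with `δ` counting
measure) over clopen sets `U ⊆ X × {1,…,n}`, `n ∈ ℕ`, such that `R^n|_U` is orbit
equivalent to `R`. -/
noncomputable def fundGroup [MeasurableSpace X] (R : Set (X × X)) (μ : Measure X) : Set ℝ :=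
  {l : ℝ | ∃ (n : ℕ) (U : Set (X × Fin n)), IsClopen U ∧
    OrbitEquiv R (restrictRel (finProdRel R n) U) ∧
    l = ((μ.prod Measure.count) U).toReal}

/-- `E_μ`: the additive subgroup of `ℝ` generated by the measures of clopen sets. -/
noncomputable def clopenValueGroup [MeasurableSpace X] (μ : Measure X) : AddSubgroup ℝ :=
  AddSubgroup.closure {r : ℝ | ∃ V : Set X, IsClopen V ∧ r = (μ V).toReal}

/-- The positive inner multiplier group `IM₊(E)` of an additive subgroup of `ℝ`. -/
def IMplus (E : AddSubgroup ℝ) : Set ℝ :=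
  {t : ℝ | 0 < t ∧ t ∈ E ∧ t⁻¹ ∈ E ∧ (fun x => t * x) '' (E : Set ℝ) = (E : Set ℝ)}

end Defs

namespace CantorOE

open Topology

/-- `T` refines `S`: every element of `S` is an `ℕ`-combination of elements of `T`, and every
element of `T` is used in some element of `S`. -/
def Refines (S T : Set ℝ) : Prop :=
  (∀ s ∈ S, s ∈ AddSubmonoid.closure T) ∧
    ∀ t ∈ T, ∃ s ∈ S, ∃ y ∈ AddSubmonoid.closure T, s = t + y

lemma Refines.refl (S : Set ℝ) : Refines S S :=
  ⟨fun _ hs => AddSubmonoid.subset_closure hs,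
    fun t ht => ⟨t, ht, 0, zero_mem _, by simp⟩⟩

lemma Refines.closure_le {S T : Set ℝ} (h : Refines S T) :
    AddSubmonoid.closure S ≤ AddSubmonoid.closure T :=
  (AddSubmonoid.closure_le).2 h.1

lemma Refines.trans {S T U : Set ℝ} (h : Refines S T) (h' : Refines T U) : Refines S U := by
  refine ⟨fun s hs => h'.closure_le (h.1 s hs), fun u hu => ?_⟩
  obtain ⟨t, ht, y, hy, rfl⟩ := h'.2 u hu
  obtain ⟨s, hs, z, hz, rfl⟩ := h.2 _ ht
  exact ⟨_, hs, y + z, add_mem hy (h'.closure_le hz), by ring⟩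

/-- A family that can be refined by a strictly smaller set of positive elements of `E`. -/
def Shrinkable (E : AddSubgroup ℝ) {n : ℕ} (a : Fin n → ℝ) : Prop :=
  ∃ T : Finset ℝ, (∀ t ∈ T, 0 < t ∧ t ∈ E) ∧ T.card < n ∧ Refines (Set.range a) T

lemma shrinkable_of_eq (E : AddSubgroup ℝ) {n : ℕ} {a : Fin n → ℝ} (ha : ∀ i, 0 < a i ∧ a i ∈ E)
    {i j : Fin n} (hij : i ≠ j) (h : a i = a j) : Shrinkable E a := by
  classical
  refine ⟨Finset.univ.image a, ?_, ?_, ?_⟩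
  · simpa using ha
  · have : (Finset.univ.image a).card ≠ (Finset.univ : Finset (Fin n)).card := by
      rw [Ne, Finset.card_image_iff]
      intro hinj
      exact hij (hinj (by simp) (by simp) h)
    have h2 := Finset.card_image_le (s := Finset.univ) (f := a)
    simp only [Finset.card_univ, Fintype.card_fin] at this h2 ⊢
    omega
  · simpa using Refines.refl (Set.range a)

/-- One step of the multidimensional Euclidean algorithm. -/
lemma shrinkable_step (E : AddSubgroup ℝ) {n : ℕ} {a : Fin n → ℝ} {c : Fin n → ℤ}
    (ha : ∀ i, 0 < a i ∧ a i ∈ E) (hs : ∑ i, (c i : ℝ) * a i = 0) {i j : Fin n} (hij : i ≠ j)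
    (h : a i < a j)
    (hrec : ∀ a' : Fin n → ℝ, (∀ k, 0 < a' k ∧ a' k ∈ E) →
      ∑ k, ((if k = i then c i + c j else c k : ℤ) : ℝ) * a' k = 0 → Shrinkable E a') :
    Shrinkable E a := by
  classical
  set a' : Fin n → ℝ := fun k => if k = j then a j - a i else a k with ha'
  have hi : a' i = a i := by simp [ha', hij]
  have hj : a' j = a j - a i := by simp [ha']
  have hk : ∀ k, k ≠ j → a' k = a k := fun k hk => by simp [ha', hk]
  have key : Shrinkable E a' := by
    refine hrec a' (fun k => ?_) ?_
    · by_cases hkj : k = j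
      · subst hkj; rw [hj]; exact ⟨by linarith, E.sub_mem (ha _).2 (ha _).2⟩
      · rw [hk k hkj]; exact ha k
    · have : ∀ k, ((if k = i then c i + c j else c k : ℤ) : ℝ) * a' k
          = (c k : ℝ) * a k + ((if k = i then (c j : ℝ) * a i else 0)
            - (if k = j then (c j : ℝ) * a i else 0)) := by
        intro k
        by_cases h1 : k = i
        · subst h1; simp [hi, hij]; ring
        · by_cases h2 : k = j
          · subst h2; simp [hj, h1]; ring
          · simp [h1, h2, hk]
      simp only [this, Finset.sum_add_distrib, hs, Finset.sum_sub_distrib]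
      simp
  obtain ⟨T, hT, hcard, href⟩ := key
  refine ⟨T, hT, hcard, Refines.trans ⟨?_, ?_⟩ href⟩
  · rintro _ ⟨k, rfl⟩
    by_cases hkj : k = j
    · subst hkj
      have : a k = a' k + a' i := by rw [hj, hi]; ring
      rw [this]
      exact add_mem (AddSubmonoid.subset_closure ⟨_, rfl⟩) (AddSubmonoid.subset_closure ⟨_, rfl⟩)
    · rw [← hk k hkj]; exact AddSubmonoid.subset_closure ⟨_, rfl⟩
  · rintro _ ⟨k, rfl⟩
    by_cases hkj : k = j
    · subst hkj
      exact ⟨a k, ⟨k, rfl⟩, a' i, AddSubmonoid.subset_closure ⟨_, rfl⟩, by rw [hj, hi]; ring⟩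
    · exact ⟨a k, ⟨k, rfl⟩, 0, zero_mem _, by rw [hk k hkj]; ring⟩

lemma shrinkable_of_max_lt (E : AddSubgroup ℝ) {n : ℕ} {M L : ℤ} (hM : 0 < M)
    (hLM : -M ≤ L)
    (hend : ∀ (a : Fin n → ℝ) (c : Fin n → ℤ), (∀ i, 0 < a i ∧ a i ∈ E) →
      (∀ i, L ≤ c i ∧ c i < M) → c ≠ 0 → ∑ i, (c i : ℝ) * a i = 0 → Shrinkable E a) :
    ∀ (N : ℕ) (a : Fin n → ℝ) (c : Fin n → ℤ), (∀ i, 0 < a i ∧ a i ∈ E) →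
      (∀ i, L ≤ c i ∧ c i ≤ M) → c ≠ 0 → ∑ i, (c i : ℝ) * a i = 0 →
      (Finset.univ.filter fun k => c k = M ∨ c k < 0).card ≤ N → Shrinkable E a := by
  classical
  intro N
  induction N with
  | zero =>
    intro a c ha hc h0 hs hcard
    refine hend a c ha (fun i => ⟨(hc i).1, lt_of_le_of_ne (hc i).2 fun h => ?_⟩) h0 hs
    have : i ∈ Finset.univ.filter fun k => c k = M ∨ c k < 0 := by simp [h]
    rw [Finset.card_eq_zero.1 (Nat.le_zero.1 hcard)] at this
    simp at this
  | succ N ih =>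
    intro a c ha hc h0 hs hcard
    by_cases hmax : ∃ i, c i = M
    swap
    · push Not at hmax
      exact hend a c ha (fun i => ⟨(hc i).1, lt_of_le_of_ne (hc i).2 (hmax i)⟩) h0 hs
    obtain ⟨i, hi⟩ := hmax
    have hneg : ∃ j, c j < 0 := by
      by_contra! hnn
      have : 0 < ∑ i, (c i : ℝ) * a i := by
        refine Finset.sum_pos' (fun k _ => mul_nonneg (by exact_mod_cast hnn k) (ha k).1.le)
          ⟨i, by simp, mul_pos (by rw [hi]; exact_mod_cast hM) (ha i).1⟩
      linarith
    obtain ⟨j, hj⟩ := hneg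
    have hij : i ≠ j := by rintro rfl; omega
    have hgen : ∀ x y : Fin n, x ≠ y → (c x = M ∨ c x < 0) → c y ≠ 0 →
        c x + c y = M + c j → ∀ a' : Fin n → ℝ, (∀ k, 0 < a' k ∧ a' k ∈ E) →
        ∑ k, ((if k = x then c x + c y else c k : ℤ) : ℝ) * a' k = 0 → Shrinkable E a' := by
      intro x y hxy hx hy hsum a' ha' hs'
      have hcj := (hc j).1
      refine ih a' (fun k => if k = x then c x + c y else c k) ha' (fun k => ?_) ?_ hs' ?_
      · split_ifs
        · rw [hsum]; omega
        · exact hc k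
      · intro h
        apply hy
        have := congrFun h y
        simpa [hxy.symm] using this
      · have hsub : (Finset.univ.filter fun k => (if k = x then c x + c y else c k) = M ∨
            (if k = x then c x + c y else c k) < 0) ⊆
            (Finset.univ.filter fun k => c k = M ∨ c k < 0).erase x := by
          intro k hk
          simp only [Finset.mem_filter, Finset.mem_univ, true_and, Finset.mem_erase] at hk ⊢
          by_cases hkx : k = x
          · simp only [hkx, if_true, hsum] at hk; omega
          · simpa [hkx] using hk
        have h1 := Finset.card_le_card hsub
        rw [Finset.card_erase_of_mem (by simpa using hx)] at h1
        omega
    rcases lt_trichotomy (a i) (a j) with h | h | h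
    · exact shrinkable_step E ha hs hij h (hgen i j hij (Or.inl hi) (by omega) (by omega))
    · exact shrinkable_of_eq E ha hij h
    · exact shrinkable_step E ha hs hij.symm h (hgen j i hij.symm (Or.inr hj) (by omega) (by omega))

lemma shrinkable_of_relation (E : AddSubgroup ℝ) {n : ℕ} : ∀ (M : ℕ) (a : Fin n → ℝ)
    (c : Fin n → ℤ), (∀ i, 0 < a i ∧ a i ∈ E) → (∀ i, |c i| ≤ M) → c ≠ 0 →
    ∑ i, (c i : ℝ) * a i = 0 → Shrinkable E a := by
  intro M
  induction M with
  | zero =>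
    intro a c _ hc h0
    exact absurd (funext fun i => by simpa using hc i) h0
  | succ M ih =>
    intro a c ha hc h0 hs
    refine shrinkable_of_max_lt E (M := M + 1) (L := -(M + 1)) (by omega) le_rfl ?_ _
      a c ha (fun i => by have := abs_le.1 (hc i); push_cast at this; exact this) h0 hs le_rfl
    intro a c ha hc h0 hs
    refine shrinkable_of_max_lt E (M := M + 1) (L := -M) (by omega) (by omega) ?_ _
      a (-c) ha (fun i => by have := hc i; simp only [Pi.neg_apply]; omega) (neg_ne_zero.2 h0)
        (by simp [hs]) le_rfl
    intro a c ha hc h0 hs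
    exact ih a c ha (fun i => abs_le.2 ⟨(hc i).1, by have := (hc i).2; omega⟩) h0 hs

/-- Totally ordered archimedean groups are dimension groups: finitely many positive elements are
`ℕ`-combinations of finitely many independent positive elements. -/
lemma exists_independent_refinement (E : AddSubgroup ℝ) : ∀ (N : ℕ) (S : Finset ℝ), S.card ≤ N →
    (∀ s ∈ S, 0 < s ∧ s ∈ E) → ∃ T : Finset ℝ, (∀ t ∈ T, 0 < t ∧ t ∈ E) ∧
      LinearIndependent ℚ (fun t : T => (t : ℝ)) ∧ Refines (S : Set ℝ) T := by
  intro N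
  induction N with
  | zero =>
    intro S hS hpos
    have : S = ∅ := by simpa using hS
    subst this
    refine ⟨∅, by simp, ?_, Refines.refl _⟩
    exact linearIndependent_empty_type
  | succ N ih =>
    intro S hS hpos
    by_cases hli : LinearIndependent ℚ (fun t : S => (t : ℝ))
    · exact ⟨S, hpos, hli, Refines.refl _⟩
    rw [← LinearIndependent.iff_fractionRing ℤ ℚ, Fintype.not_linearIndependent_iff] at hli
    obtain ⟨g, hg, x, hx⟩ := hli
    let e := S.equivFin.symm
    have hsh : Shrinkable E (fun i => (e i : ℝ)) := by
      refine shrinkable_of_relation E (∑ i, (|g (e i)|).toNat) _ (fun i => g (e i))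
        (fun i => hpos _ (e i).2) (fun i => ?_) ?_ ?_
      · have h1 := Finset.single_le_sum (f := fun i => (|g (e i)|).toNat) (fun _ _ => Nat.zero_le _)
          (Finset.mem_univ i)
        have h2 : |g (e i)| = ((|g (e i)|).toNat : ℤ) := by simp
        rw [h2]; exact_mod_cast h1
      · intro h
        apply hx
        simpa using congrFun h (e.symm x)
      · rw [← hg]
        rw [← Equiv.sum_comp e]
        simp
    obtain ⟨T, hT, hcard, href⟩ := hsh
    obtain ⟨U, hU, hUi, hUr⟩ := ih T (by omega) hT
    refine ⟨U, hU, hUi, Refines.trans ?_ hUr⟩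
    have : Set.range (fun i => (e i : ℝ)) = (S : Set ℝ) := by
      ext y
      constructor
      · rintro ⟨i, rfl⟩; exact (e i).2
      · intro hy; exact ⟨e.symm ⟨y, hy⟩, by simp⟩
    rwa [this] at href

/-- `e` is at least twice every element of `T`, in the cone generated by `T`. -/
def Dom (e : ℝ) (T : Finset ℝ) : Prop :=
  ∀ t ∈ T, ∃ y ∈ AddSubmonoid.closure (T : Set ℝ), e = 2 * t + y

lemma exists_nat_mul_add {ε x : ℝ} (hε : 0 < ε) (hx : 0 < x) :
    ∃ (k : ℕ) (ρ : ℝ), 0 < ρ ∧ ρ ≤ ε ∧ x = k * ε + ρ := by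
  obtain ⟨m, ⟨h1, h2⟩, -⟩ := existsUnique_sub_zsmul_mem_Ioc hε x 0
  simp only [zsmul_eq_mul, zero_add] at h1 h2
  have hm : 0 ≤ m := by
    by_contra! h
    have : (m : ℝ) ≤ -1 := by exact_mod_cast (by omega : m ≤ -1)
    nlinarith
  lift m to ℕ using hm
  exact ⟨m, _, h1, h2, by push_cast; ring⟩

lemma exists_dominated_refinement (E : AddSubgroup ℝ) (hE : ∀ ε > 0, ∃ e ∈ E, 0 < e ∧ e < ε)
    (B Q : Finset ℝ) (hB : ∀ b ∈ B, 0 < b ∧ b ∈ E) (hQ : ∀ b ∈ Q, 0 < b ∧ b ∈ E) :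
    ∃ D : Finset ℝ, (∀ t ∈ D, 0 < t ∧ t ∈ E) ∧ LinearIndependent ℚ (fun t : D => (t : ℝ)) ∧
      D.Nonempty ∧ (∀ q ∈ Q, q ∈ AddSubmonoid.closure (D : Set ℝ)) ∧ ∀ b ∈ B, Dom b D := by
  classical
  obtain ⟨δ, hδ, hδB⟩ : ∃ δ > 0, ∀ b ∈ B, δ ≤ b := by
    rcases B.eq_empty_or_nonempty with rfl | hne
    · exact ⟨1, one_pos, by simp⟩
    · exact ⟨B.min' hne, (hB _ (B.min'_mem hne)).1, fun b hb => B.min'_le b hb⟩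
  obtain ⟨ε, hεE, hε, hεδ⟩ := hE (δ / 3) (by positivity)
  have hdec : ∀ x : ℝ, ∃ (k : ℕ) (ρ : ℝ), 0 < x → 0 < ρ ∧ ρ ≤ ε ∧ x = k * ε + ρ := by
    intro x
    by_cases hx : 0 < x
    · obtain ⟨k, ρ, h⟩ := exists_nat_mul_add hε hx
      exact ⟨k, ρ, fun _ => h⟩
    · exact ⟨0, 0, fun h => absurd h hx⟩
  choose k ρ hρ using hdec
  have hkE : ∀ (k : ℕ), (k : ℝ) * ε ∈ E := fun k => by
    rw [← nsmul_eq_mul]; exact E.nsmul_mem hεE k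
  set S₁ : Finset ℝ := insert ε ((B ∪ Q).image ρ) with hS₁
  have h₁ : ∀ s ∈ S₁, 0 < s ∧ s ≤ ε ∧ s ∈ E := by
    intro s hs
    rw [hS₁, Finset.mem_insert] at hs
    rcases hs with rfl | hs
    · exact ⟨hε, le_rfl, hεE⟩
    · obtain ⟨x, hx, rfl⟩ := Finset.mem_image.1 hs
      have hx' : 0 < x ∧ x ∈ E := by
        rcases Finset.mem_union.1 hx with h | h
        · exact hB x h
        · exact hQ x h
      obtain ⟨ha, hb, hc⟩ := hρ x hx'.1
      refine ⟨ha, hb, ?_⟩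
      have : ρ x = x - k x * ε := by linarith
      rw [this]
      exact E.sub_mem hx'.2 (hkE _)
  set S₂ : Finset ℝ := S₁ ∪ (S₁.filter (· < ε)).image (fun s => ε - s) with hS₂
  have h₂ : ∀ s ∈ S₂, 0 < s ∧ s ∈ E := by
    intro s hs
    rcases Finset.mem_union.1 hs with hs | hs
    · exact ⟨(h₁ s hs).1, (h₁ s hs).2.2⟩
    · obtain ⟨x, hx, rfl⟩ := Finset.mem_image.1 hs
      rw [Finset.mem_filter] at hx
      exact ⟨by linarith [hx.2], E.sub_mem hεE (h₁ x hx.1).2.2⟩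
  have hsub : (S₁ : Set ℝ) ⊆ S₂ := by
    intro s hs; exact Finset.mem_coe.2 (Finset.mem_union_left _ hs)
  have h₃ : ∀ s ∈ S₂, ε - s ∈ AddSubmonoid.closure (S₂ : Set ℝ) := by
    intro s hs
    rcases Finset.mem_union.1 hs with hs | hs
    · rcases (h₁ s hs).2.1.lt_or_eq with h | h
      · apply AddSubmonoid.subset_closure
        refine Finset.mem_coe.2 (Finset.mem_union_right _ (Finset.mem_image.2 ⟨s, ?_, rfl⟩))
        exact Finset.mem_filter.2 ⟨hs, h⟩
      · rw [h, sub_self]; exact zero_mem _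
    · obtain ⟨x, hx, rfl⟩ := Finset.mem_image.1 hs
      rw [Finset.mem_filter] at hx
      rw [sub_sub_cancel]
      exact AddSubmonoid.subset_closure (hsub hx.1)
  obtain ⟨D, hD, hDi, hDr⟩ := exists_independent_refinement E _ S₂ le_rfl h₂
  have hεD : ε ∈ AddSubmonoid.closure (D : Set ℝ) :=
    hDr.1 _ (hsub (Finset.mem_coe.2 (Finset.mem_insert_self _ _)))
  have hρD : ∀ x ∈ B ∪ Q, ρ x ∈ AddSubmonoid.closure (D : Set ℝ) := fun x hx =>
    hDr.1 _ (hsub (Finset.mem_coe.2 (Finset.mem_insert_of_mem (Finset.mem_image_of_mem _ hx))))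
  refine ⟨D, hD, hDi, ?_, ?_, ?_⟩
  · by_contra hne
    rw [Finset.not_nonempty_iff_eq_empty] at hne
    rw [hne] at hεD
    simp at hεD
    exact hε.ne' hεD
  · intro q hq
    rw [(hρ q (hQ q hq).1).2.2, ← nsmul_eq_mul]
    exact add_mem (nsmul_mem hεD _) (hρD q (Finset.mem_union_right _ hq))
  · intro b hb d hd
    obtain ⟨s, hs, y, hy, hsy⟩ := hDr.2 d hd
    obtain ⟨hρ1, hρ2, hρ3⟩ := hρ b (hB b hb).1
    have hk : 2 ≤ k b := by
      by_contra! h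
      have : (k b : ℝ) ≤ 1 := by exact_mod_cast (by omega : k b ≤ 1)
      nlinarith [hδB b hb]
    have hz : ε - d ∈ AddSubmonoid.closure (D : Set ℝ) := by
      have : ε - d = (ε - s) + y := by rw [hsy]; ring
      rw [this]
      exact add_mem (hDr.closure_le (h₃ s hs)) hy
    refine ⟨2 • (ε - d) + ((k b - 2) • ε + ρ b), ?_, ?_⟩
    · exact add_mem (nsmul_mem hz _)
        (add_mem (nsmul_mem hεD _) (hρD b (Finset.mem_union_left _ hb)))
    · rw [nsmul_eq_mul, nsmul_eq_mul]
      push_cast [hk]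
      linarith

lemma exists_functional {T : Finset ℝ} (hT : LinearIndependent ℚ (fun t : T => (t : ℝ)))
    (g : ℝ → ℝ) : ∃ f : ℝ →ₗ[ℚ] ℝ, ∀ t ∈ T, f t = g t := by
  obtain ⟨f, hf⟩ := LinearMap.exists_extend ((Module.Basis.span hT).constr ℚ (fun t : T => g t))
  refine ⟨f, fun t ht => ?_⟩
  have h := congrArg (fun l => l (Module.Basis.span hT ⟨t, ht⟩)) hf
  simp only [LinearMap.comp_apply, Module.Basis.constr_basis] at h
  rw [← h]
  congr 1
  simp [Module.Basis.span_apply]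

lemma map_nat_mul (f : ℝ →ₗ[ℚ] ℝ) (k : ℕ) (x : ℝ) : f (k * x) = k * f x := by
  rw [← nsmul_eq_mul, map_nsmul, nsmul_eq_mul]

lemma coeff_unique {T : Finset ℝ} (hT : LinearIndependent ℚ (fun t : T => (t : ℝ)))
    {k l : ℝ → ℕ} (h : ∑ t ∈ T, (k t : ℝ) * t = ∑ t ∈ T, (l t : ℝ) * t) {t : ℝ} (ht : t ∈ T) :
    k t = l t := by
  classical
  obtain ⟨f, hf⟩ := exists_functional hT (fun s => if s = t then 1 else 0)
  have h2 : ∀ k : ℝ → ℕ, f (∑ t ∈ T, (k t : ℝ) * t) = k t := by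
    intro k
    rw [map_sum]
    rw [Finset.sum_congr rfl (fun s hs => by rw [map_nat_mul, hf s hs])]
    simp [ht]
  have h3 := congrArg f h
  rw [h2, h2] at h3
  exact_mod_cast h3

lemma exists_coeff {T : Finset ℝ} {x : ℝ} (hx : x ∈ AddSubmonoid.closure (T : Set ℝ)) :
    ∃ k : ℝ → ℕ, ∑ t ∈ T, (k t : ℝ) * t = x := by
  obtain ⟨k, -, hk⟩ := AddSubmonoid.mem_closure_finset.1 hx
  exact ⟨k, by simpa using hk⟩

lemma Dom.exists_coeff {T : Finset ℝ} (hT : LinearIndependent ℚ (fun t : T => (t : ℝ)))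
    (hne : T.Nonempty) {e : ℝ} (h : Dom e T) :
    ∃ k : ℝ → ℕ, (∀ t ∈ T, 2 ≤ k t) ∧ ∑ t ∈ T, (k t : ℝ) * t = e := by
  classical
  have key : ∀ t ∈ T, ∃ k : ℝ → ℕ, 2 ≤ k t ∧ ∑ t ∈ T, (k t : ℝ) * t = e := by
    intro t ht
    obtain ⟨y, hy, rfl⟩ := h t ht
    obtain ⟨k, rfl⟩ := CantorOE.exists_coeff hy
    refine ⟨fun s => (if s = t then 2 else 0) + k s, by simp, ?_⟩
    simp [add_mul, Finset.sum_add_distrib, ht]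
  obtain ⟨t₀, ht₀⟩ := hne
  obtain ⟨k, -, hk⟩ := key t₀ ht₀
  refine ⟨k, fun t ht => ?_, hk⟩
  obtain ⟨l, hl, hl'⟩ := key t ht
  rwa [coeff_unique hT (hk.trans hl'.symm) ht]

/-- A sequence of finite independent sets of positive reals, each refining the previous one: the
vertices and incidence matrices of a simple Bratteli diagram, a vertex being its own weight. -/
structure Chain where
  /-- the vertices at each level -/
  B : ℕ → Finset ℝ
  /-- the numbers of edges -/
  m : ℕ → ℝ → ℝ → ℕ
  /-- a distinguished vertex at each level -/
  p : ℕ → ℝ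
  /-- the vertex at level zero -/
  root : ℝ
  zero : B 0 = {root}
  pos : ∀ n, ∀ b ∈ B n, 0 < b
  p_mem : ∀ n, p n ∈ B n
  indep : ∀ n, LinearIndependent ℚ (fun t : B n => (t : ℝ))
  two_le : ∀ n, ∀ b ∈ B n, ∀ d ∈ B (n + 1), 2 ≤ m n b d
  sum : ∀ n, ∀ b ∈ B n, ∑ d ∈ B (n + 1), (m n b d : ℝ) * d = b

lemma exists_chain (B : ℕ → Finset ℝ) (p : ℕ → ℝ) (root : ℝ) (zero : B 0 = {root})
    (pos : ∀ n, ∀ b ∈ B n, 0 < b) (p_mem : ∀ n, p n ∈ B n)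
    (indep : ∀ n, LinearIndependent ℚ (fun t : B n => (t : ℝ)))
    (dom : ∀ n, ∀ b ∈ B n, Dom b (B (n + 1))) :
    ∃ C : Chain, C.B = B ∧ C.p = p ∧ C.root = root := by
  have : ∀ n b, ∃ k : ℝ → ℕ, b ∈ B n → (∀ t ∈ B (n + 1), 2 ≤ k t) ∧
      ∑ t ∈ B (n + 1), (k t : ℝ) * t = b := by
    intro n b
    by_cases hb : b ∈ B n
    · obtain ⟨k, hk⟩ := (dom n b hb).exists_coeff (indep _) ⟨_, p_mem _⟩
      exact ⟨k, fun _ => hk⟩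
    · exact ⟨fun _ => 0, fun h => absurd h hb⟩
  choose m hm using this
  exact ⟨⟨B, m, p, root, zero, pos, p_mem, indep, fun n b hb => (hm n b hb).1,
    fun n b hb => (hm n b hb).2⟩, rfl, rfl, rfl⟩

/-- The chain consists of elements of `E` and exhausts the positive cone of `E`. -/
def Exhausts (C : Chain) (E : AddSubgroup ℝ) : Prop :=
  (∀ n, ∀ b ∈ C.B n, b ∈ E) ∧ ∀ e ∈ E, 0 < e → ∃ N, ∀ n ≥ N, Dom e (C.B n)

lemma Dom.mem_closure {e : ℝ} {T : Finset ℝ} (hT : T.Nonempty) (h : Dom e T) :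
    e ∈ AddSubmonoid.closure (T : Set ℝ) := by
  obtain ⟨t, ht⟩ := hT
  obtain ⟨y, hy, rfl⟩ := h t ht
  have := AddSubmonoid.subset_closure (Finset.mem_coe.2 ht)
  rw [two_mul]
  exact add_mem (add_mem this this) hy

lemma dom_of_mem_closure {S T : Finset ℝ} (hT : T.Nonempty) (h : ∀ s ∈ S, Dom s T) {e : ℝ}
    (he : e ∈ AddSubmonoid.closure (S : Set ℝ)) (he0 : e ≠ 0) : Dom e T := by
  have : e = 0 ∨ Dom e T := by
    clear he0
    induction he using AddSubmonoid.closure_induction with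
    | mem x hx => exact Or.inr (h x hx)
    | zero => exact Or.inl rfl
    | add x y _ _ hx hy =>
      rcases hx with rfl | hx
      · simpa using hy
      · rcases hy with rfl | hy
        · simpa using Or.inr hx
        · refine Or.inr fun t ht => ?_
          obtain ⟨z, hz, rfl⟩ := hx t ht
          exact ⟨z + y, add_mem hz (hy.mem_closure hT), by ring⟩
  exact this.resolve_left he0

lemma exists_exhausting_chain (E : AddSubgroup ℝ) (hE : ∀ ε > 0, ∃ e ∈ E, 0 < e ∧ e < ε)
    (hc : (E : Set ℝ).Countable) (h1 : (1 : ℝ) ∈ E) :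
    ∃ C : Chain, C.root = 1 ∧ Exhausts C E := by
  classical
  obtain ⟨q, hq⟩ : ∃ q : ℕ → ℝ, {x : ℝ | x ∈ E ∧ 0 < x} = Set.range q :=
    Set.Countable.exists_eq_range (hc.mono fun x hx => hx.1) ⟨1, h1, one_pos⟩
  have hqE : ∀ n, 0 < q n ∧ q n ∈ E := fun n => by
    have : q n ∈ {x : ℝ | x ∈ E ∧ 0 < x} := hq ▸ ⟨n, rfl⟩
    exact ⟨this.2, this.1⟩
  let P : Finset ℝ → Prop := fun D => (∀ t ∈ D, 0 < t ∧ t ∈ E) ∧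
    LinearIndependent ℚ (fun t : D => (t : ℝ)) ∧ D.Nonempty
  have step : ∀ (n : ℕ) (S : {D // P D}), ∃ T : {D // P D},
      q n ∈ AddSubmonoid.closure (T.1 : Set ℝ) ∧ ∀ b ∈ S.1, Dom b T.1 := by
    intro n S
    obtain ⟨D, hD1, hD2, hD3, hD4, hD5⟩ := exists_dominated_refinement E hE S.1 {q n} S.2.1
      (by simpa using hqE n)
    exact ⟨⟨D, hD1, hD2, hD3⟩, hD4 _ (by simp), hD5⟩
  choose next hn1 hn2 using step
  have hP1 : P {1} := ⟨by simpa using h1, by simp, by simp⟩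
  let B : ℕ → {D // P D} := fun n => Nat.rec ⟨{1}, hP1⟩ (fun n S => next n S) n
  have hB : ∀ n, B (n + 1) = next n (B n) := fun n => rfl
  have hdom : ∀ n, ∀ b ∈ (B n).1, Dom b (B (n + 1)).1 := fun n b hb => hn2 n (B n) b hb
  choose p hp using fun n => (B n).2.2.2
  obtain ⟨C, hCB, -, hCr⟩ := exists_chain (fun n => (B n).1) p 1 rfl
    (fun n b hb => ((B n).2.1 b hb).1) hp (fun n => (B n).2.2.1) hdom
  refine ⟨C, hCr, ?_, ?_⟩
  · rw [hCB]
    exact fun n b hb => ((B n).2.1 b hb).2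
  · intro e he he0
    rw [hCB]
    have : e ∈ Set.range q := hq ▸ ⟨he, he0⟩
    obtain ⟨n, rfl⟩ := this
    have hmem : ∀ k, q n ∈ AddSubmonoid.closure ((B (n + 1 + k)).1 : Set ℝ) := by
      intro k
      induction k with
      | zero => exact hn1 n (B n)
      | succ k ih =>
        exact (dom_of_mem_closure ⟨_, hp (n + 1 + k + 1)⟩ (hdom _) ih he0.ne').mem_closure
          ⟨_, hp (n + 1 + k + 1)⟩
    refine ⟨n + 2, fun m hm => ?_⟩
    obtain ⟨k, rfl⟩ := Nat.exists_eq_add_of_le hm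
    have := dom_of_mem_closure ⟨_, hp (n + 1 + k + 1)⟩ (hdom _) (hmem k) he0.ne'
    have h2 : n + 1 + k + 1 = n + 2 + k := by ring
    rwa [h2] at this

lemma continuous_ite_of_isClopen {X Y : Type*} [TopologicalSpace X] [TopologicalSpace Y]
    {P : X → Prop} [DecidablePred P] {f g : X → Y} (hP : IsClopen {x | P x}) (hf : Continuous f)
    (hg : Continuous g) : Continuous fun x => if P x then f x else g x := by
  refine continuous_if (fun a ha => ?_) hf.continuousOn hg.continuousOn
  rw [hP.frontier_eq] at ha
  exact ha.elim

/-- A labelled edge between two vertices. -/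
@[ext]
structure Edge where
  /-- the source vertex -/
  src : ℝ
  /-- the target vertex -/
  tgt : ℝ
  /-- the label, distinguishing parallel edges -/
  lab : ℕ

instance : TopologicalSpace Edge := ⊥

instance : DiscreteTopology Edge := ⟨rfl⟩

instance : TopologicalSpace.MetrizableSpace Edge := inferInstance

namespace Chain

variable (C : Chain)

/-- The edges between levels `n` and `n + 1`. -/
def edges (n : ℕ) : Set Edge :=
  {e | e.src ∈ C.B n ∧ e.tgt ∈ C.B (n + 1) ∧ e.lab < C.m n e.src e.tgt}

lemma finite_edges (n : ℕ) : (C.edges n).Finite := by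
  have : C.edges n ⊆ (fun q : ℝ × ℝ × ℕ => (⟨q.1, q.2.1, q.2.2⟩ : Edge)) ''
      (⋃ b ∈ C.B n, ⋃ d ∈ C.B (n + 1), (fun k => (b, d, k)) '' Set.Iio (C.m n b d)) := by
    rintro e ⟨h1, h2, h3⟩
    refine ⟨(e.src, e.tgt, e.lab), ?_, rfl⟩
    simp only [Set.mem_iUnion]
    exact ⟨e.src, h1, e.tgt, h2, e.lab, h3, rfl⟩
  refine (Set.Finite.image _ ?_).subset this
  exact (C.B n).finite_toSet.biUnion fun b _ =>
    (C.B (n + 1)).finite_toSet.biUnion fun d _ => (Set.finite_Iio _).image _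

/-- The infinite paths of the Bratteli diagram. -/
def Path : Type :=
  {x : ℕ → Edge // ∀ n, x n ∈ C.edges n ∧ (x n).tgt = (x (n + 1)).src}

variable {C}

instance : CoeFun C.Path (fun _ => ℕ → Edge) := ⟨Subtype.val⟩

instance : TopologicalSpace C.Path := inferInstanceAs (TopologicalSpace {_x : ℕ → Edge // _})

instance : MeasurableSpace C.Path := borel _

instance : BorelSpace C.Path := ⟨rfl⟩

instance : TopologicalSpace.MetrizableSpace C.Path :=
  (Topology.IsEmbedding.subtypeVal (p := fun x : ℕ → Edge =>
    ∀ n, x n ∈ C.edges n ∧ (x n).tgt = (x (n + 1)).src)).metrizableSpace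

instance : TotallyDisconnectedSpace C.Path :=
  inferInstanceAs (TotallyDisconnectedSpace {_x : ℕ → Edge // _})

instance : CompactSpace C.Path := by
  refine isCompact_iff_compactSpace.1 (IsCompact.of_isClosed_subset (s := Set.univ.pi C.edges)
    (isCompact_univ_pi fun n => (C.finite_edges n).isCompact) ?_ ?_)
  · change IsClosed {x : ℕ → Edge | ∀ n, x n ∈ C.edges n ∧ (x n).tgt = (x (n + 1)).src}
    simp only [Set.ofPred_forall, Set.ofPred_and]
    refine isClosed_iInter fun n => IsClosed.inter ?_ ?_
    · exact (isClosed_discrete (C.edges n)).preimage (continuous_apply n)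
    · have h : IsClosed {q : Edge × Edge | q.1.tgt = q.2.src} := isClosed_discrete _
      exact h.preimage (f := fun x : ℕ → Edge => (x n, x (n + 1)))
        ((continuous_apply n).prodMk (continuous_apply (n + 1)))
  · exact fun x hx n _ => (hx n).1

namespace Path

@[ext]
lemma ext {x y : C.Path} (h : ∀ n, x n = y n) : x = y := Subtype.ext (funext h)

lemma mem_edges (x : C.Path) (n : ℕ) : x n ∈ C.edges n := (x.2 n).1

lemma tgt_eq (x : C.Path) (n : ℕ) : (x n).tgt = (x (n + 1)).src := (x.2 n).2

lemma src_mem (x : C.Path) (n : ℕ) : (x n).src ∈ C.B n := (x.mem_edges n).1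

lemma continuous_coord (n : ℕ) : Continuous fun x : C.Path => x n :=
  (continuous_apply n).comp continuous_subtype_val

lemma continuous_mk {Y : Type*} [TopologicalSpace Y] {f : Y → C.Path}
    (h : ∀ n, Continuous fun y => f y n) : Continuous f :=
  Continuous.subtype_mk (continuous_pi h) fun y => (f y).2

/-- The cylinder of all paths sharing the first `n` edges of `a`. -/
def cyl (a : C.Path) (n : ℕ) : Set C.Path := {z | ∀ i < n, z i = a i}

lemma mem_cyl_self (a : C.Path) (n : ℕ) : a ∈ a.cyl n := fun _ _ => rfl

lemma cyl_eq {a z : C.Path} {n : ℕ} (h : z ∈ a.cyl n) : z.cyl n = a.cyl n := by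
  ext w
  exact forall₂_congr fun i hi => by rw [h i hi]

lemma isClopen_cyl (a : C.Path) (n : ℕ) : IsClopen (a.cyl n) := by
  have : a.cyl n = ⋂ i ∈ Set.Iio n, (fun z : C.Path => z i) ⁻¹' {a i} := by
    ext z; simp [cyl]
  rw [this]
  exact (Set.finite_Iio n).isClopen_biInter
    fun i _ => (isClopen_discrete {a i}).preimage (continuous_coord i)

lemma exists_cyl_subset {U : Set C.Path} (hU : IsOpen U) {x : C.Path} (hx : x ∈ U) :
    ∃ n, x.cyl n ⊆ U := by
  obtain ⟨V, hV, rfl⟩ := isOpen_induced_iff.1 hU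
  obtain ⟨_, ⟨y, n, rfl⟩, hxy, hs⟩ :=
    (PiNat.isTopologicalBasis_cylinders (fun _ => Edge)).exists_subset_of_mem_open hx hV
  refine ⟨n, fun z hz => hs ?_⟩
  rw [PiNat.mem_cylinder_iff] at hxy ⊢
  exact fun i hi => (hz i hi).trans (hxy i hi)

lemma src_eq_of_mem_cyl {a z : C.Path} {n : ℕ} (h : z ∈ a.cyl n) : (z n).src = (a n).src := by
  cases n with
  | zero =>
    have h1 := z.src_mem 0
    have h2 := a.src_mem 0
    rw [C.zero, Finset.mem_singleton] at h1 h2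
    rw [h1, h2]
  | succ n => rw [← z.tgt_eq, ← a.tgt_eq, h n n.lt_succ_self]

lemma src_zero (a : C.Path) : (a 0).src = C.root := by
  have h1 := a.src_mem 0
  rwa [C.zero, Finset.mem_singleton] at h1

/-- Follow `x` up to level `n`, then `y`. -/
def glue (x y : C.Path) (n : ℕ) (h : (x n).src = (y n).src) : C.Path :=
  ⟨fun i => if i < n then x i else y i, fun i => by
    rcases lt_trichotomy (i + 1) n with h1 | h1 | h1
    · simpa [h1, (Nat.lt_succ_self i).trans h1] using x.2 i
    · subst h1
      simpa [x.tgt_eq, h] using x.mem_edges i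
    · have h2 : ¬ i < n := by omega
      have h3 : ¬ i + 1 < n := by omega
      simpa only [h2, h3, if_false] using y.2 i⟩

lemma glue_lt {x y : C.Path} {n : ℕ} (h : (x n).src = (y n).src) {i : ℕ} (hi : i < n) :
    glue x y n h i = x i := if_pos hi

lemma glue_ge {x y : C.Path} {n : ℕ} (h : (x n).src = (y n).src) {i : ℕ} (hi : n ≤ i) :
    glue x y n h i = y i := if_neg hi.not_gt

/-- The path through the given vertices with the given labels `0` or `1`. -/
def ofVerts (v : ℕ → ℝ) (hv : ∀ i, v i ∈ C.B i) (l : ℕ → Bool) : C.Path :=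
  ⟨fun i => ⟨v i, v (i + 1), (l i).toNat⟩, fun i =>
    ⟨⟨hv i, hv (i + 1),
      lt_of_le_of_lt (Bool.toNat_le _) (C.two_le i _ (hv i) _ (hv (i + 1)))⟩, rfl⟩⟩

lemma exists_src_eq (n : ℕ) {c : ℝ} (hc : c ∈ C.B n) : ∃ x : C.Path, (x n).src = c := by
  refine ⟨ofVerts (Function.update C.p n c) (fun i => ?_) (fun _ => false), ?_⟩
  · rcases eq_or_ne i n with rfl | h
    · simpa using hc
    · simpa [h] using C.p_mem i
  · simp [ofVerts]

/-- The two marked paths. -/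
def mark (C : Chain) (l : Bool) : C.Path := ofVerts C.p C.p_mem fun _ => l

lemma mark_apply (l : Bool) (n : ℕ) : mark C l n = ⟨C.p n, C.p (n + 1), l.toNat⟩ := rfl

/-- Change the label of the edge at level `n`. -/
def flip (x : C.Path) (n : ℕ) : C.Path :=
  ⟨Function.update x n ⟨(x n).src, (x n).tgt, if (x n).lab = 0 then 1 else 0⟩, fun i => by
    have key : ∀ i, (Function.update x n ⟨(x n).src, (x n).tgt,
        if (x n).lab = 0 then 1 else 0⟩ : ℕ → Edge) i = ⟨(x i).src, (x i).tgt,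
        if i = n then (if (x i).lab = 0 then 1 else 0) else (x i).lab⟩ := by
      intro i
      rcases eq_or_ne i n with rfl | h <;> simp [*]
    rw [key, key]
    refine ⟨⟨x.src_mem i, (x.mem_edges i).2.1, ?_⟩, x.tgt_eq i⟩
    have := C.two_le i _ (x.src_mem i) _ (x.mem_edges i).2.1
    have h2 := (x.mem_edges i).2.2
    dsimp only
    split_ifs <;> omega⟩

lemma flip_of_ne (x : C.Path) {n i : ℕ} (h : i ≠ n) : x.flip n i = x i :=
  Function.update_of_ne h _ _

lemma flip_self_ne (x : C.Path) (n : ℕ) : x.flip n n ≠ x n := by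
  intro h
  have h2 : (x.flip n n).lab = (x n).lab := by rw [h]
  simp only [flip, Function.update_self] at h2
  split_ifs at h2 <;> omega

/-- Follow `a` up to level `n`, then jump to `x`. -/
def bridge (a x : C.Path) (n : ℕ) : C.Path :=
  ⟨fun i => if i < n then a i
    else if i = n then ⟨(a n).src, (x (n + 1)).src, 0⟩ else x i, fun i => by
    rcases lt_trichotomy i n with h1 | rfl | h1
    · rcases (Nat.succ_le_of_lt h1).lt_or_eq with h2 | h2
      · simpa [h1, h2] using a.2 i
      · subst h2
        simpa using a.2 i
    · simp only [lt_irrefl, if_false, if_true]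
      have h2 : ¬ i + 1 < i := by omega
      simp only [h2, if_false, Nat.succ_ne_self]
      exact ⟨⟨a.src_mem i, x.src_mem (i + 1), lt_of_lt_of_le two_pos
        (C.two_le i _ (a.src_mem i) _ (x.src_mem (i + 1)))⟩, trivial⟩
    · have h2 : ¬ i < n := by omega
      have h3 : ¬ i + 1 < n := by omega
      have h4 : i ≠ n := by omega
      have h5 : i + 1 ≠ n := by omega
      simpa only [h2, h3, h4, h5, if_false] using x.2 i⟩

lemma bridge_lt (a x : C.Path) {n i : ℕ} (h : i < n) : bridge a x n i = a i := if_pos h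

lemma bridge_gt (a x : C.Path) {n i : ℕ} (h : n < i) : bridge a x n i = x i := by
  simp [bridge, h.ne', h.not_gt]

/-- Tail equivalence. -/
def Tail (x y : C.Path) : Prop := ∃ N, ∀ i ≥ N, x i = y i

lemma Tail.refl (x : C.Path) : Tail x x := ⟨0, fun _ _ => rfl⟩

lemma Tail.symm {x y : C.Path} (h : Tail x y) : Tail y x :=
  let ⟨N, hN⟩ := h; ⟨N, fun i hi => (hN i hi).symm⟩

lemma Tail.trans {x y z : C.Path} (h : Tail x y) (h' : Tail y z) : Tail x z := by
  obtain ⟨N, hN⟩ := h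
  obtain ⟨M, hM⟩ := h'
  exact ⟨max N M, fun i hi => (hN i (le_trans (le_max_left _ _) hi)).trans
    (hM i (le_trans (le_max_right _ _) hi))⟩

lemma tail_mark_iff {l l' : Bool} : Tail (mark C l) (mark C l') ↔ l = l' := by
  refine ⟨fun ⟨N, h⟩ => ?_, fun h => h ▸ Tail.refl _⟩
  have := congrArg Edge.lab (h N le_rfl)
  revert this
  cases l <;> cases l' <;> simp [mark_apply]

/-- Tail equivalence, with the tail classes of the two marked paths united. -/
def Rel (x y : C.Path) : Prop := Tail x y ∨ ∃ l, Tail x (mark C l) ∧ Tail y (mark C !l)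

lemma Rel.symm {x y : C.Path} (h : Rel x y) : Rel y x := by
  rcases h with h | ⟨l, h1, h2⟩
  · exact Or.inl h.symm
  · exact Or.inr ⟨!l, h2, by simpa using h1⟩

lemma Rel.trans {x y z : C.Path} (h : Rel x y) (h' : Rel y z) : Rel x z := by
  rcases h with h | ⟨l, h1, h2⟩
  · rcases h' with h' | ⟨l, h1, h2⟩
    · exact Or.inl (h.trans h')
    · exact Or.inr ⟨l, h.trans h1, h2⟩
  · rcases h' with h' | ⟨l', h3, h4⟩
    · exact Or.inr ⟨l, h1, h'.symm.trans h2⟩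
    · have := tail_mark_iff.1 (h2.symm.trans h3)
      subst this
      exact Or.inl (h1.trans (by simpa using h4.symm))

lemma infinite_tail_class (x : C.Path) : {y | Tail x y}.Infinite := by
  refine Set.infinite_of_injective_forall_mem (f := fun n => x.flip n) ?_ fun n =>
    ⟨n + 1, fun i hi => (x.flip_of_ne (by omega)).symm⟩
  intro n m h
  by_contra hnm
  have := x.flip_self_ne n
  dsimp only at h
  rw [h, x.flip_of_ne hnm] at this
  exact this rfl

lemma dense_tail_class (x : C.Path) : Dense {y | Tail x y} := by
  rw [dense_iff_inter_open]
  rintro U hU ⟨a, ha⟩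
  obtain ⟨n, hn⟩ := exists_cyl_subset hU ha
  exact ⟨bridge a x n, hn fun i hi => bridge_lt a x hi,
    n + 1, fun i hi => (bridge_gt a x hi).symm⟩

end Path

open CantorOE.Chain.Path

instance : Nonempty C.Path := ⟨mark C true⟩

lemma perfect_path : Perfect (Set.univ : Set C.Path) := by
  refine ⟨isClosed_univ, fun x _ => accPt_iff_nhds.2 fun U hU => ?_⟩
  obtain ⟨V, hVU, hV, hxV⟩ := mem_nhds_iff.1 hU
  obtain ⟨n, hn⟩ := exists_cyl_subset hV hxV
  refine ⟨x.flip n, ⟨hVU (hn fun i hi => x.flip_of_ne hi.ne), trivial⟩, fun h => ?_⟩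
  exact x.flip_self_ne n (by rw [h])

end Chain

lemma exists_cycle_apply_eq {α : Type*} [DecidableEq α] (s : Finset α) {x y : α} (hx : x ∈ s)
    (hy : y ∈ s) (hxy : x ≠ y) :
    ∃ f : Equiv.Perm α, f.IsCycleOn s ∧ (∀ a ∉ s, f a = a) ∧ f x = y := by
  obtain ⟨f, hf, hfs⟩ := s.countable_toSet.exists_cycleOn
  have hfx : f x ∈ s := hf.1.mapsTo hx
  have hne : f x ≠ x := by
    intro h
    exact hxy ((hf.2 hx hy).eq_of_left h)
  have hsw : ∀ a, Equiv.swap y (f x) a ∈ s ↔ a ∈ s := by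
    intro a
    rcases eq_or_ne a y with rfl | h1
    · simp [hfx, hy]
    rcases eq_or_ne a (f x) with rfl | h2
    · simp [hfx, hy]
    rw [Equiv.swap_apply_of_ne_of_ne h1 h2]
  have h1 : Equiv.swap y (f x) '' (s : Set α) = s := by
    ext a
    rw [Equiv.image_eq_preimage_symm, Equiv.symm_swap]
    exact hsw a
  refine ⟨Equiv.swap y (f x) * f * (Equiv.swap y (f x))⁻¹, ?_, ?_, ?_⟩
  · have := hf.conj (g := Equiv.swap y (f x))
    rwa [h1] at this
  · intro a ha
    have h2 : Equiv.swap y (f x) a = a := Equiv.swap_apply_of_ne_of_ne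
      (fun h => ha (h ▸ hy)) (fun h => ha (h ▸ hfx))
    have h3 : f a = a := by
      by_contra h
      exact ha (hfs h)
    simp [h2, h3]
  · simp [Equiv.swap_apply_of_ne_of_ne hxy hne.symm]

namespace Chain

open CantorOE.Chain.Path

variable {C : Chain}

/-- Level-wise successor permutations of the edges, wrapping the label `l` of the marked edges to
the opposite label. -/
structure Succ (C : Chain) (l : Bool) where
  /-- the permutations -/
  σ : ℕ → Equiv.Perm Edge
  tgt : ∀ n e, (σ n e).tgt = e.tgt
  mem : ∀ n e, e ∈ C.edges n → σ n e ∈ C.edges n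
  mem_symm : ∀ n e, e ∈ C.edges n → (σ n).symm e ∈ C.edges n
  wrap : ∀ n, ∀ c ∈ C.B (n + 1), σ n ⟨C.p n, c, l.toNat⟩ = ⟨C.p n, c, (!l).toNat⟩

lemma mark_mem_edges (n : ℕ) {c : ℝ} (hc : c ∈ C.B (n + 1)) (l : Bool) :
    (⟨C.p n, c, l.toNat⟩ : Edge) ∈ C.edges n :=
  ⟨C.p_mem n, hc, lt_of_le_of_lt (Bool.toNat_le _) (C.two_le n _ (C.p_mem n) _ hc)⟩

/-- The edges at level `n` with target `c`. -/
noncomputable def incoming (C : Chain) (n : ℕ) (c : ℝ) : Finset Edge :=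
  ((C.finite_edges n).subset (Set.inter_subset_left : _ ∩ {e : Edge | e.tgt = c} ⊆ _)).toFinset

lemma mem_incoming {n : ℕ} {c : ℝ} {e : Edge} :
    e ∈ C.incoming n c ↔ e ∈ C.edges n ∧ e.tgt = c := by
  simp [incoming]

lemma exists_succ (C : Chain) : ∃ S : Succ C true, ∀ n, ∀ e ∈ C.edges n, ∀ f ∈ C.edges n,
    e.tgt = f.tgt → ∃ k : ℕ, ((S.σ n : Edge → Edge)^[k]) e = f := by
  classical
  have h0 : ∀ n c, ∃ f : Equiv.Perm Edge, f.IsCycleOn (C.incoming n c) ∧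
      (∀ a ∉ C.incoming n c, f a = a) ∧
      (c ∈ C.B (n + 1) → f ⟨C.p n, c, 1⟩ = ⟨C.p n, c, 0⟩) := by
    intro n c
    by_cases hc : c ∈ C.B (n + 1)
    · obtain ⟨f, h1, h2, h3⟩ := exists_cycle_apply_eq (C.incoming n c)
        (mem_incoming.2 ⟨mark_mem_edges n hc true, rfl⟩)
        (mem_incoming.2 ⟨mark_mem_edges n hc false, rfl⟩) (by simp)
      exact ⟨f, h1, h2, fun _ => h3⟩
    · obtain ⟨f, hf, hfs⟩ := (C.incoming n c).countable_toSet.exists_cycleOn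
      refine ⟨f, hf, fun a ha => ?_, fun h => absurd h hc⟩
      by_contra h
      exact ha (hfs h)
  choose g hg1 hg2 hg3 using h0
  have hmap : ∀ n c e, g n c e ∈ C.incoming n c ↔ e ∈ C.incoming n c := fun n c e =>
    (hg1 n c).apply_mem_iff
  have htgt : ∀ n c e, (g n c e).tgt = e.tgt := by
    intro n c e
    by_cases he : e ∈ C.incoming n c
    · rw [(mem_incoming.1 he).2, (mem_incoming.1 ((hmap n c e).2 he)).2]
    · rw [hg2 n c e he]
  have htgt' : ∀ n c e, ((g n c).symm e).tgt = e.tgt := by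
    intro n c e
    rw [← htgt n c, Equiv.apply_symm_apply]
  let σ : ℕ → Equiv.Perm Edge := fun n =>
    ⟨fun e => g n e.tgt e, fun e => (g n e.tgt).symm e, fun e => by simp [htgt],
      fun e => by simp [htgt']⟩
  have hσ : ∀ n e, σ n e = g n e.tgt e := fun _ _ => rfl
  refine ⟨⟨σ, fun n e => htgt _ _ _, fun n e he => ?_, fun n e he => ?_, fun n c hc => ?_⟩, ?_⟩
  · exact (mem_incoming.1 ((hmap n e.tgt e).2 (mem_incoming.2 ⟨he, rfl⟩))).1
  · refine (mem_incoming.1 ((hmap n e.tgt ((g n e.tgt).symm e)).1 ?_)).1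
    rw [Equiv.apply_symm_apply]
    exact mem_incoming.2 ⟨he, rfl⟩
  · exact hg3 n c hc
  · intro n e he f hf hef
    obtain ⟨k, -, hk⟩ := (hg1 n e.tgt).exists_pow_eq (mem_incoming.2 ⟨he, rfl⟩)
      (mem_incoming.2 ⟨hf, hef.symm⟩)
    refine ⟨k, ?_⟩
    rw [← hk, ← Equiv.Perm.iterate_eq_pow]
    change (fun e => g n e.tgt e)^[k] e = _
    have : ∀ k, (fun e => g n e.tgt e)^[k] e = (g n e.tgt)^[k] e ∧
        ((g n e.tgt)^[k] e).tgt = e.tgt := by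
      intro k
      induction k with
      | zero => exact ⟨rfl, rfl⟩
      | succ k ih =>
        rw [Function.iterate_succ_apply', Function.iterate_succ_apply', ih.1]
        exact ⟨by rw [ih.2], by rw [htgt, ih.2]⟩
    exact (this k).1

namespace Succ

variable {l : Bool} (S : Succ C l)

/-- The predecessor permutations. -/
def inv : Succ C (!l) where
  σ n := (S.σ n).symm
  tgt n e := by rw [← S.tgt n, Equiv.apply_symm_apply]
  mem := S.mem_symm
  mem_symm := S.mem
  wrap n c hc := by rw [Equiv.symm_apply_eq, Bool.not_not, S.wrap n c hc]

/-- Being a marked edge with label `l`. -/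
def IsMax (C : Chain) (l : Bool) (n : ℕ) (e : Edge) : Prop := e.src = C.p n ∧ e.lab = l.toNat

lemma IsMax.eq {n : ℕ} {e : Edge} (h : IsMax C l n e) : e = ⟨C.p n, e.tgt, l.toNat⟩ := by
  cases e; obtain ⟨rfl, rfl⟩ := h; rfl

lemma σ_isMax {n : ℕ} {e : Edge} (he : e ∈ C.edges n) (h : IsMax C l n e) :
    S.σ n e = ⟨C.p n, e.tgt, (!l).toNat⟩ := by
  rw [h.eq]; exact S.wrap n _ he.2.1

lemma isMax_σ_iff {n : ℕ} {e : Edge} (he : e ∈ C.edges n) :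
    IsMax C (!l) n (S.σ n e) ↔ IsMax C l n e := by
  constructor
  · intro h
    have h2 := S.inv.σ_isMax (S.mem n e he) h
    have h3 : S.inv.σ n (S.σ n e) = e := (S.σ n).symm_apply_apply e
    rw [h3] at h2
    rw [h2]
    exact ⟨rfl, by simp⟩
  · intro h
    rw [S.σ_isMax he h]
    exact ⟨rfl, rfl⟩

open Classical in
/-- The coordinates of the successor of a path. -/
noncomputable def stepFun (z : ℕ → Edge) (i : ℕ) : Edge :=
  if ∀ j < i, IsMax C l j (z j) then
    if IsMax C l i (z i) then ⟨C.p i, (S.σ (i + 1) (z (i + 1))).src, (!l).toNat⟩ else S.σ i (z i)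
  else z i

variable {S} in
lemma stepFun_of_not {z : ℕ → Edge} {i : ℕ} (h : ¬ ∀ j < i, IsMax C l j (z j)) :
    S.stepFun z i = z i := if_neg h

variable {S} in
lemma stepFun_max {z : ℕ → Edge} {i : ℕ} (h : ∀ j < i, IsMax C l j (z j))
    (h' : IsMax C l i (z i)) :
    S.stepFun z i = ⟨C.p i, (S.σ (i + 1) (z (i + 1))).src, (!l).toNat⟩ := by
  rw [stepFun, if_pos h, if_pos h']

variable {S} in
lemma stepFun_not_max {z : ℕ → Edge} {i : ℕ} (h : ∀ j < i, IsMax C l j (z j))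
    (h' : ¬ IsMax C l i (z i)) : S.stepFun z i = S.σ i (z i) := by
  rw [stepFun, if_pos h, if_neg h']

lemma forall_lt_succ_of {z : ℕ → Edge} {i : ℕ} (h : ∀ j < i, IsMax C l j (z j))
    (hi : IsMax C l i (z i)) : ∀ j < i + 1, IsMax C l j (z j) := by
  intro j hj
  rcases (Nat.lt_succ_iff_lt_or_eq.1 hj) with hj | rfl
  · exact h j hj
  · exact hi

/-- Under a maximal prefix the source of the image edge is that of the successor edge. -/
lemma src_stepFun (z : C.Path) {i : ℕ} (h : ∀ j < i, IsMax C l j (z j)) :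
    (S.stepFun z i).src = (S.σ i (z i)).src := by
  by_cases hi : IsMax C l i (z i)
  · rw [stepFun_max h hi, S.σ_isMax (z.mem_edges i) hi]
  · rw [stepFun_not_max h hi]

/-- The successor of a path in the Vershik order. -/
noncomputable def step (z : C.Path) : C.Path :=
  ⟨S.stepFun z, fun i => by
    by_cases h : ∀ j < i, IsMax C l j (z j)
    · by_cases h' : IsMax C l i (z i)
      · rw [stepFun_max h h']
        refine ⟨mark_mem_edges i (S.mem _ _ (z.mem_edges (i + 1))).1 (!l), ?_⟩
        rw [S.src_stepFun z (forall_lt_succ_of h h')]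
      · rw [stepFun_not_max h h', stepFun_of_not (fun h2 => h' (h2 i i.lt_succ_self))]
        exact ⟨S.mem _ _ (z.mem_edges i), by rw [S.tgt, z.tgt_eq]⟩
    · rw [stepFun_of_not h, stepFun_of_not (fun h2 => h fun j hj => h2 j (by omega))]
      exact z.2 i⟩

lemma step_apply (z : C.Path) (i : ℕ) : S.step z i = S.stepFun z i := rfl

lemma isMax_step_iff (z : C.Path) {i : ℕ} (h : ∀ j < i, IsMax C l j (z j)) :
    IsMax C (!l) i (S.step z i) ↔ IsMax C l i (z i) := by
  by_cases h' : IsMax C l i (z i)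
  · rw [step_apply, stepFun_max h h']
    exact ⟨fun _ => h', fun _ => ⟨rfl, rfl⟩⟩
  · rw [step_apply, stepFun_not_max h h', S.isMax_σ_iff (z.mem_edges i)]

lemma forall_isMax_step_iff (z : C.Path) (i : ℕ) :
    (∀ j < i, IsMax C (!l) j (S.step z j)) ↔ ∀ j < i, IsMax C l j (z j) := by
  induction i with
  | zero => simp
  | succ i ih =>
    rw [Nat.forall_lt_succ_right, Nat.forall_lt_succ_right, ih]
    exact and_congr_right fun h => S.isMax_step_iff z h

lemma inv_step (z : C.Path) : ∀ i, S.inv.stepFun (S.step z) i = z i := by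
  intro i
  by_cases h : ∀ j < i, IsMax C l j (z j)
  · have h2 := (S.forall_isMax_step_iff z i).2 h
    by_cases h' : IsMax C l i (z i)
    · have h3 := (S.isMax_step_iff z h).2 h'
      rw [stepFun_max h2 h3, h'.eq, Bool.not_not]
      congr 1
      rw [z.tgt_eq]
      change ((S.σ (i + 1)).symm _).src = _
      by_cases h4 : IsMax C l (i + 1) (z (i + 1))
      · have h5 := S.inv.σ_isMax ((S.step z).mem_edges (i + 1))
          ((S.isMax_step_iff z (forall_lt_succ_of h h')).2 h4)
        have h6 : S.inv.σ (i + 1) = (S.σ (i + 1)).symm := rfl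
        rw [h6] at h5
        rw [h5, h4.1]
      · rw [step_apply, stepFun_not_max (forall_lt_succ_of h h') h4, Equiv.symm_apply_apply]
    · rw [stepFun_not_max h2 (mt (S.isMax_step_iff z h).1 h'), step_apply, stepFun_not_max h h']
      exact (S.σ i).symm_apply_apply _
  · rw [stepFun_of_not (mt (S.forall_isMax_step_iff z i).1 h), step_apply, stepFun_of_not h]

lemma continuous_step : Continuous S.step := by
  classical
  refine continuous_mk fun i => ?_
  have h1 : ∀ j, IsClopen {z : C.Path | IsMax C l j (z j)} := fun j =>
    (isClopen_discrete {e | IsMax C l j e}).preimage (continuous_coord j)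
  have h2 : IsClopen {z : C.Path | ∀ j < i, IsMax C l j (z j)} := by
    have : {z : C.Path | ∀ j < i, IsMax C l j (z j)} =
        ⋂ j ∈ Set.Iio i, {z : C.Path | IsMax C l j (z j)} := by
      ext z; simp
    rw [this]
    exact (Set.finite_Iio i).isClopen_biInter fun j _ => h1 j
  simp only [step_apply, stepFun]
  refine continuous_ite_of_isClopen h2 (continuous_ite_of_isClopen (h1 i) ?_ ?_)
    (continuous_coord i)
  · exact (continuous_of_discreteTopology (f := fun e => (⟨C.p i, (S.σ (i + 1) e).src, (!l).toNat⟩ :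
      Edge))).comp (continuous_coord (i + 1))
  · exact (continuous_of_discreteTopology (f := S.σ i)).comp (continuous_coord i)

end Succ

/-- The Vershik homeomorphism. -/
noncomputable def vershik (S : Succ C true) : C.Path ≃ₜ C.Path where
  toFun := S.step
  invFun := S.inv.step
  left_inv z := Path.ext fun i => S.inv_step z i
  right_inv z := Path.ext fun i => S.inv.inv_step z i
  continuous_toFun := S.continuous_step
  continuous_invFun := S.inv.continuous_step

end Chain

section Orbits

variable {X : Type*} [TopologicalSpace X] (φ : X ≃ₜ X)

lemma orbitRelZ_refl (x : X) : (x, x) ∈ orbitRelZ φ := ⟨0, rfl⟩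

lemma orbitRelZ_apply (x : X) : (x, φ x) ∈ orbitRelZ φ := ⟨1, by rw [zpow_one]⟩

variable {φ}

lemma orbitRelZ_symm {x y : X} (h : (x, y) ∈ orbitRelZ φ) : (y, x) ∈ orbitRelZ φ := by
  obtain ⟨n, h⟩ := h
  refine ⟨-n, ?_⟩
  dsimp only at h ⊢
  rw [← h, zpow_neg]
  exact (φ ^ n).symm_apply_apply x

lemma orbitRelZ_trans {x y z : X} (h : (x, y) ∈ orbitRelZ φ) (h' : (y, z) ∈ orbitRelZ φ) :
    (x, z) ∈ orbitRelZ φ := by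
  obtain ⟨n, h⟩ := h
  obtain ⟨m, h'⟩ := h'
  refine ⟨m + n, ?_⟩
  dsimp only at h h' ⊢
  rw [zpow_add, ← h', ← h]
  rfl

lemma zpow_apply_of_equivalence {r : X → X → Prop} (hr : Equivalence r) (h : ∀ x, r x (φ x)) (n : ℤ)
    (x : X) : r x ((φ ^ n) x) := by
  induction n with
  | zero => exact hr.refl x
  | succ n ih =>
    refine hr.trans ih ?_
    rw [add_comm, zpow_add, zpow_one]
    exact h _
  | pred n ih =>
    refine hr.trans ih (hr.symm ?_)
    have h2 := h ((φ ^ (-(n : ℤ) - 1)) x)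
    have h3 : φ ((φ ^ (-(n : ℤ) - 1)) x) = (φ ^ (-(n : ℤ))) x := by
      conv_rhs => rw [show (-(n : ℤ)) = 1 + (-(n : ℤ) - 1) by ring, zpow_add, zpow_one]
      rfl
    rwa [h3] at h2

lemma finite_orbit_of_periodic {n : ℤ} (hn : n ≠ 0) {x : X} (h : (φ ^ n) x = x) :
    {y | (x, y) ∈ orbitRelZ φ}.Finite := by
  have hk : ∀ k : ℤ, ((φ ^ n) ^ k) x = x := by
    intro k
    refine (zpow_apply_of_equivalence (φ := φ ^ n) (r := fun a b => a = x ↔ b = x)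
      ⟨fun _ => Iff.rfl, Iff.symm, Iff.trans⟩ (fun a => ?_) k x).1 rfl
    conv_rhs => rw [← h, (φ ^ n).injective.eq_iff]
  refine ((Set.finite_Ico 0 |n|).image fun k => (φ ^ k) x).subset ?_
  rintro y ⟨k, hy⟩
  dsimp only at hy
  rw [← hy]
  refine ⟨k % n, ⟨Int.emod_nonneg k hn, Int.emod_lt_abs k hn⟩, ?_⟩
  dsimp only
  conv_rhs => rw [← Int.emod_add_mul_ediv k n, zpow_add, zpow_mul]
  change _ = (φ ^ (k % n)) (((φ ^ n) ^ (k / n)) x)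
  rw [hk]

end Orbits

namespace Chain

open CantorOE.Chain.Path CantorOE.Chain.Succ

variable {C : Chain} (S : Succ C true)

lemma vershik_eq_of_ge {x : C.Path} {k : ℕ} (hk : ¬ IsMax C true k (x k)) {i : ℕ} (hi : k < i) :
    vershik S x i = x i :=
  stepFun_of_not fun h => hk (h k hi)

lemma vershik_mark : vershik S (mark C true) = mark C false := by
  ext1 i
  change S.stepFun _ _ = _
  have h : ∀ i, IsMax C true i (mark C true i) := fun i => ⟨rfl, rfl⟩
  rw [stepFun_max (fun j _ => h j) (h i), S.σ_isMax ((mark C true).mem_edges _) (h _)]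
  rfl

lemma rel_vershik (x : C.Path) : Rel x (vershik S x) := by
  by_cases h : ∀ i, IsMax C true i (x i)
  · have : x = mark C true := by
      ext1 i
      rw [(h i).eq, x.tgt_eq, (h (i + 1)).1]
      rfl
    rw [this, vershik_mark]
    exact Or.inr ⟨true, Tail.refl _, Tail.refl _⟩
  · push Not at h
    obtain ⟨k, hk⟩ := h
    exact Or.inl ⟨k + 1, fun i hi => (vershik_eq_of_ge S hk hi).symm⟩

lemma rel_of_mem_orbitRelZ {x y : C.Path} (h : (x, y) ∈ orbitRelZ (vershik S)) : Rel x y := by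
  obtain ⟨n, h⟩ := h
  dsimp only at h
  rw [← h]
  exact zpow_apply_of_equivalence (r := Rel)
    ⟨fun x => Or.inl (Path.Tail.refl x), Rel.symm, Rel.trans⟩ (rel_vershik S) n x

/-- A path with a maximal prefix up to level `n`, then the edge `e`, then the tail of `x`. -/
lemma exists_maximal_upto (x : C.Path) (n : ℕ) {e : Edge} (he : e ∈ C.edges n)
    (hx : e.tgt = (x n).tgt) :
    ∃ z : C.Path, (∀ j < n, IsMax C true j (z j)) ∧ z n = e ∧ ∀ i > n, z i = x i := by
  have hv : ∀ i, (if i = n then e.src else C.p i) ∈ C.B i := by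
    intro i
    split_ifs with h
    · rw [h]; exact he.1
    · exact C.p_mem i
  obtain ⟨y, hy⟩ : ∃ y : C.Path, y = ofVerts _ hv fun _ => true := ⟨_, rfl⟩
  have hyn : (y n).src = e.src := by rw [hy]; simp [ofVerts]
  let w : C.Path := ⟨fun i => if i < n then y i else if i = n then e else x i, fun i => by
    rcases lt_trichotomy (i + 1) n with h | h | h
    · simpa [h, (Nat.lt_succ_self i).trans h] using y.2 i
    · subst h
      simpa [y.tgt_eq, hyn] using y.mem_edges i
    · rcases (Nat.lt_succ_iff.1 h).eq_or_lt with rfl | h1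
      · simpa [hx, x.tgt_eq] using he
      · have h2 : ¬ i < n := by omega
        have h3 : ¬ i + 1 < n := by omega
        have h4 : i ≠ n := by omega
        have h5 : i + 1 ≠ n := by omega
        simpa only [h2, h3, h4, h5, if_false] using x.2 i⟩
  refine ⟨w, fun j hj => ?_, by simp [w], fun i hi => ?_⟩
  · have : w j = y j := if_pos hj
    rw [this, hy]
    exact ⟨by simp [ofVerts, hj.ne], rfl⟩
  · simp [w, hi.ne', (not_lt_of_gt hi)]

lemma mem_orbitRelZ_of_tail
    (hS : ∀ n, ∀ e ∈ C.edges n, ∀ f ∈ C.edges n, e.tgt = f.tgt →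
      ∃ k : ℕ, ((S.σ n : Edge → Edge)^[k]) e = f) (n : ℕ) {x y : C.Path}
    (h : ∀ i ≥ n, x i = y i) : (x, y) ∈ orbitRelZ (vershik S) := by
  induction n generalizing x y with
  | zero =>
    have : x = y := Path.ext fun i => h i (Nat.zero_le _)
    exact this ▸ orbitRelZ_refl _ _
  | succ n ih =>
    have hxy : (x n).tgt = (y n).tgt := by rw [x.tgt_eq, y.tgt_eq, h (n + 1) le_rfl]
    have hc := (x.mem_edges n).2.1
    set c := (x n).tgt with hcdef
    set e₀ : Edge := ⟨C.p n, c, 0⟩ with he₀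
    have he₀m : e₀ ∈ C.edges n := mark_mem_edges n hc false
    obtain ⟨z₀, -, hz₀, hz₀'⟩ := exists_maximal_upto x n he₀m rfl
    have key : ∀ k : ℕ, ∀ z : C.Path, z n = (S.σ n)^[k] e₀ → (∀ i > n, z i = x i) →
        (z₀, z) ∈ orbitRelZ (vershik S) := by
      intro k
      induction k with
      | zero =>
        intro z hz hz'
        refine ih fun i hi => ?_
        rcases hi.eq_or_lt with rfl | hi
        · rw [hz, hz₀]; rfl
        · rw [hz' i hi, hz₀' i hi]
      | succ k ihk =>
        intro z hz hz'
        rw [Function.iterate_succ_apply'] at hz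
        have hem : (S.σ n)^[k] e₀ ∈ C.edges n ∧ ((S.σ n)^[k] e₀).tgt = c := by
          clear hz ihk
          induction k with
          | zero => exact ⟨he₀m, rfl⟩
          | succ k ih' =>
            rw [Function.iterate_succ_apply']
            exact ⟨S.mem _ _ ih'.1, by rw [S.tgt, ih'.2]⟩
        set e := (S.σ n)^[k] e₀ with he
        obtain ⟨w, hw1, hw2, hw3⟩ := exists_maximal_upto x n hem.1 hem.2
        by_cases hmax : IsMax C true n e
        · refine ih fun i hi => ?_
          rcases hi.eq_or_lt with rfl | hi
          · rw [hz, hz₀, S.σ_isMax hem.1 hmax, hem.2]; rfl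
          · rw [hz' i hi, hz₀' i hi]
        · refine orbitRelZ_trans (ihk w hw2 hw3) (orbitRelZ_trans (orbitRelZ_apply _ w) ?_)
          refine ih fun i hi => ?_
          have hmax' : ¬ IsMax C true n (w n) := by rwa [hw2]
          rcases hi.eq_or_lt with rfl | hi
          · change S.stepFun w n = _
            rw [stepFun_not_max hw1 hmax', hw2, hz]
          · rw [vershik_eq_of_ge S hmax' hi, hz' i hi, hw3 i hi]
    have key' : ∀ z : C.Path, (z n).tgt = c → (∀ i > n, z i = x i) →
        (z₀, z) ∈ orbitRelZ (vershik S) := by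
      intro z hz hz'
      obtain ⟨k, hk⟩ := hS n e₀ he₀m (z n) (z.mem_edges n) hz.symm
      exact key k z hk.symm hz'
    exact orbitRelZ_trans (orbitRelZ_symm (key' x rfl fun _ _ => rfl))
      (key' y hxy.symm fun i hi => (h i hi).symm)

/-- Every chain carries a free minimal homeomorphism whose orbit relation is `Rel`. -/
lemma exists_vershik (C : Chain) : ∃ φ : C.Path ≃ₜ C.Path, IsFreeZ φ ∧ IsMinimalRel (orbitRelZ φ) ∧
    orbitRelZ φ = {q | Rel q.1 q.2} := by
  obtain ⟨S, hS⟩ := exists_succ C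
  have htail : ∀ {x y : C.Path}, Tail x y → (x, y) ∈ orbitRelZ (vershik S) :=
    fun ⟨n, h⟩ => mem_orbitRelZ_of_tail S hS n h
  refine ⟨vershik S, fun n hn x h => ?_, fun x => ?_, ?_⟩
  · exact infinite_tail_class x ((finite_orbit_of_periodic hn h).subset fun y hy => htail hy)
  · exact (dense_tail_class x).mono fun y hy => htail hy
  · ext ⟨x, y⟩
    refine ⟨rel_of_mem_orbitRelZ S, ?_⟩
    have hm : (mark C true, mark C false) ∈ orbitRelZ (vershik S) := by
      have := orbitRelZ_apply (vershik S) (mark C true)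
      rwa [vershik_mark] at this
    rintro (h | ⟨l, h1, h2⟩)
    · exact htail h
    · have : (mark C l, mark C !l) ∈ orbitRelZ (vershik S) := by
        cases l
        · exact orbitRelZ_symm hm
        · exact hm
      exact orbitRelZ_trans (htail h1) (orbitRelZ_trans this (htail h2.symm))

end Chain

lemma exists_offsets (s : Finset Edge) (hs : ∀ e ∈ s, 0 < e.tgt) : ∃ off : Edge → ℝ,
    (∀ t, 0 ≤ t → t < ∑ e ∈ s, e.tgt → ∃ e ∈ s, off e ≤ t ∧ t < off e + e.tgt) ∧
    (∀ e ∈ s, 0 ≤ off e ∧ off e + e.tgt ≤ ∑ e ∈ s, e.tgt) ∧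
    ∀ e ∈ s, ∀ f ∈ s, ∀ t, off e ≤ t → t < off e + e.tgt → off f ≤ t → t < off f + f.tgt →
      e = f := by
  classical
  induction s using Finset.induction_on with
  | empty => exact ⟨fun _ => 0, fun t h1 h2 => absurd h1 (by simpa using h2), by simp, by simp⟩
  | insert a s ha ih =>
    obtain ⟨off, h1, h2, h3⟩ := ih fun e he => hs e (Finset.mem_insert_of_mem he)
    have ha0 := hs a (Finset.mem_insert_self _ _)
    set σ := ∑ e ∈ s, e.tgt with hσ
    have hσ0 : 0 ≤ σ := Finset.sum_nonneg fun e he => (hs e (Finset.mem_insert_of_mem he)).le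
    have hoff : ∀ e ∈ s, (Function.update off a σ) e = off e := fun e he =>
      Function.update_of_ne (by rintro rfl; exact ha he) _ _
    rw [Finset.sum_insert ha, ← hσ]
    refine ⟨Function.update off a σ, fun t ht0 ht => ?_, fun e he => ?_, fun e he f hf t => ?_⟩
    · rcases lt_or_ge t σ with h | h
      · obtain ⟨e, he, h4⟩ := h1 t ht0 h
        exact ⟨e, Finset.mem_insert_of_mem he, by rwa [hoff e he]⟩
      · exact ⟨a, Finset.mem_insert_self _ _, by simpa using h, by simpa [add_comm] using ht⟩
    · rcases Finset.mem_insert.1 he with rfl | he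
      · simp [hσ0, add_comm]
      · rw [hoff e he]
        exact ⟨(h2 e he).1, by linarith [(h2 e he).2]⟩
    · rcases Finset.mem_insert.1 he with he | he <;> rcases Finset.mem_insert.1 hf with hf | hf
      · intros; rw [he, hf]
      · rw [hoff f hf, he, Function.update_self]
        intro h4 _ _ h5
        linarith [(h2 f hf).2]
      · rw [hoff e he, hf, Function.update_self]
        intro _ h4 h5 _
        linarith [(h2 e he).2]
      · rw [hoff e he, hoff f hf]
        exact h3 e he f hf t

namespace Chain

open CantorOE.Chain.Path

variable {C : Chain}

/-- The edges at level `n` with source `v`. -/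
def out (C : Chain) (n : ℕ) (v : ℝ) : Finset Edge :=
  ((C.B (n + 1)).sigma fun d => Finset.range (C.m n v d)).map
    ⟨fun q => ⟨v, q.1, q.2⟩, by
      rintro ⟨d, k⟩ ⟨d', k'⟩ h
      simp only [Edge.mk.injEq, true_and] at h
      obtain ⟨rfl, rfl⟩ := h
      rfl⟩

lemma mem_out {n : ℕ} {v : ℝ} (hv : v ∈ C.B n) {e : Edge} :
    e ∈ C.out n v ↔ e ∈ C.edges n ∧ e.src = v := by
  simp only [out, Finset.mem_map, Finset.mem_sigma, Finset.mem_range,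
    Sigma.exists]
  constructor
  · rintro ⟨d, k, ⟨h1, h2⟩, rfl⟩
    exact ⟨⟨hv, h1, h2⟩, rfl⟩
  · rintro ⟨⟨-, h1, h2⟩, rfl⟩
    exact ⟨_, _, ⟨h1, h2⟩, rfl⟩

lemma sum_out {M : Type*} [Semiring M] (n : ℕ) (v : ℝ) (f : ℝ → M) :
    ∑ e ∈ C.out n v, f e.tgt = ∑ d ∈ C.B (n + 1), (C.m n v d : M) * f d := by
  simp only [out, Finset.sum_map, Finset.sum_sigma]
  refine Finset.sum_congr rfl fun d _ => ?_
  change ∑ _k ∈ Finset.range (C.m n v d), f d = _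
  rw [Finset.sum_const, Finset.card_range, nsmul_eq_mul]

lemma sum_out_tgt {n : ℕ} {v : ℝ} (hv : v ∈ C.B n) : ∑ e ∈ C.out n v, e.tgt = v := by
  rw [sum_out n v fun x => x]
  exact C.sum n v hv

/-- Points of the half-open interval attached to a vertex at level `n`. -/
def State (C : Chain) (n : ℕ) : Type := {q : ℝ × ℝ // q.1 ∈ C.B n ∧ 0 ≤ q.2 ∧ q.2 < q.1}

lemma exists_coding (C : Chain) : ∃ (off : ℕ → Edge → ℝ) (x : Set.Ico 0 C.root → C.Path),
    (∀ n, ∀ e ∈ C.edges n, 0 ≤ off n e ∧ off n e + e.tgt ≤ e.src) ∧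
    ∀ t (a : C.Path) n, x t ∈ a.cyl n ↔
      0 ≤ t.1 - ∑ i ∈ Finset.range n, off i (a i) ∧
        t.1 - ∑ i ∈ Finset.range n, off i (a i) < (a n).src := by
  have hpos : ∀ n v, ∀ e ∈ C.out n v, 0 < e.tgt := by
    intro n v e he
    simp only [out, Finset.mem_map, Finset.mem_sigma, Finset.mem_range,
      Sigma.exists] at he
    obtain ⟨d, k, ⟨h1, h2⟩, rfl⟩ := he
    exact C.pos _ _ h1
  choose off ho1 ho2 ho3 using fun n v => exists_offsets (C.out n v) (hpos n v)
  have hnext : ∀ n (q : C.State n), ∃ e : Edge, (e ∈ C.edges n ∧ e.src = q.1.1) ∧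
      off n e.src e ≤ q.1.2 ∧ q.1.2 < off n e.src e + e.tgt := by
    rintro n ⟨⟨v, t⟩, hv, ht0, ht⟩
    obtain ⟨e, he, h⟩ := ho1 n v t ht0 (by rw [sum_out_tgt hv]; exact ht)
    have h2 := (mem_out hv).1 he
    exact ⟨e, h2, by rwa [h2.2]⟩
  choose nx hnx1 hnx2 using hnext
  let st : Set.Ico 0 C.root → (n : ℕ) → C.State n := fun t n => Nat.rec
    (⟨(C.root, t.1), by simp [C.zero], t.2⟩ : C.State 0)
    (fun n q => (⟨((nx n q).tgt, q.1.2 - off n (nx n q).src (nx n q)), (hnx1 n q).1.2.1,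
      by linarith [(hnx2 n q).1], by linarith [(hnx2 n q).2]⟩ : C.State (n + 1))) n
  have hst0 : ∀ t, (st t 0).1 = (C.root, t.1) := fun _ => rfl
  have hst1 : ∀ t n, (st t (n + 1)).1 = ((nx n (st t n)).tgt,
    (st t n).1.2 - off n (nx n (st t n)).src (nx n (st t n))) := fun _ _ => rfl
  let x : Set.Ico 0 C.root → C.Path := fun t => ⟨fun n => nx n (st t n), fun n =>
    ⟨(hnx1 n _).1, by rw [(hnx1 (n + 1) _).2, hst1]⟩⟩
  have hx : ∀ t n, x t n = nx n (st t n) := fun _ _ => rfl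
  have hoff : ∀ n, ∀ e ∈ C.edges n, 0 ≤ off n e.src e ∧ off n e.src e + e.tgt ≤ e.src := by
    intro n e he
    have := ho2 n e.src e ((mem_out he.1).2 ⟨he, rfl⟩)
    rwa [sum_out_tgt he.1] at this
  have hstt : ∀ t n, (st t n).1.2 = t.1 - ∑ i ∈ Finset.range n, off i (x t i).src (x t i) := by
    intro t n
    induction n with
    | zero => simp [hst0]
    | succ n ih => rw [hst1, ih, Finset.sum_range_succ, hx]; ring
  refine ⟨fun n e => off n e.src e, x, hoff, fun t a n => ?_⟩
  induction n with
  | zero =>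
    simp only [cyl, Finset.range_zero, Finset.sum_empty, sub_zero, src_zero]
    exact iff_of_true (by simp) t.2
  | succ n ih =>
    have hcyl : x t ∈ a.cyl (n + 1) ↔ x t ∈ a.cyl n ∧ x t n = a n := Nat.forall_lt_succ_right
    have ha := hoff n _ (a.mem_edges n)
    have hcond : (0 ≤ t.1 - ∑ i ∈ Finset.range (n + 1), off i (a i).src (a i) ∧
        t.1 - ∑ i ∈ Finset.range (n + 1), off i (a i).src (a i) < (a (n + 1)).src) ↔
        off n (a n).src (a n) ≤ t.1 - ∑ i ∈ Finset.range n, off i (a i).src (a i) ∧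
        t.1 - ∑ i ∈ Finset.range n, off i (a i).src (a i) < off n (a n).src (a n) + (a n).tgt := by
      rw [Finset.sum_range_succ, ← a.tgt_eq]
      constructor <;> rintro ⟨h1, h2⟩ <;> constructor <;> linarith
    rw [hcyl, hcond]
    have hin : x t ∈ a.cyl n →
        (st t n).1.2 = t.1 - ∑ i ∈ Finset.range n, off i (a i).src (a i) := by
      intro h
      rw [hstt]
      congr 1
      exact Finset.sum_congr rfl fun i hi => by rw [h i (Finset.mem_range.1 hi)]
    constructor
    · rintro ⟨h1, h2⟩
      rw [← hin h1, ← h2]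
      exact hnx2 n (st t n)
    · rintro ⟨h1, h2⟩
      have h3 : x t ∈ a.cyl n := ih.2 ⟨ha.1.trans h1, lt_of_lt_of_le h2 ha.2⟩
      refine ⟨h3, ?_⟩
      have hsrc := src_eq_of_mem_cyl h3
      rw [← hin h3] at h1 h2
      have h4 := hnx2 n (st t n)
      rw [← hx] at h4
      refine ho3 n (a n).src _ ((mem_out (a.src_mem n)).2 ⟨(x t).mem_edges n, hsrc⟩) _
        ((mem_out (a.src_mem n)).2 ⟨a.mem_edges n, rfl⟩) (st t n).1.2 ?_ ?_ h1 h2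
      · rw [← hsrc]; exact h4.1
      · rw [← hsrc]; exact h4.2

/-- The cylinders of length at least `n`. -/
def cylsFrom (C : Chain) (n : ℕ) : Set (Set C.Path) :=
  {s | ∃ (a : C.Path) (k : ℕ), n ≤ k ∧ s = a.cyl k}

lemma isPiSystem_cylsFrom (n : ℕ) : IsPiSystem (C.cylsFrom n) := by
  rintro _ ⟨a, k, hk, rfl⟩ _ ⟨b, l, hl, rfl⟩ ⟨z, hz1, hz2⟩
  refine ⟨z, max k l, hk.trans (le_max_left _ _), ?_⟩
  rw [← cyl_eq hz1, ← cyl_eq hz2]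
  ext w
  simp only [cyl, Set.mem_inter_iff, Set.mem_ofPred_eq, lt_max_iff]
  exact ⟨fun h i hi => hi.elim (h.1 i) (h.2 i), fun h => ⟨fun i hi => h i (Or.inl hi),
    fun i hi => h i (Or.inr hi)⟩⟩

lemma isTopologicalBasis_cylsFrom (n : ℕ) :
    TopologicalSpace.IsTopologicalBasis (C.cylsFrom n) := by
  refine TopologicalSpace.isTopologicalBasis_of_isOpen_of_nhds ?_ ?_
  · rintro _ ⟨a, k, -, rfl⟩
    exact (isClopen_cyl a k).isOpen
  · intro x U hx hU
    obtain ⟨k, hk⟩ := exists_cyl_subset hU hx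
    exact ⟨x.cyl (max n k), ⟨x, _, le_max_left _ _, rfl⟩, mem_cyl_self _ _,
      fun z hz => hk fun i hi => hz i (lt_of_lt_of_le hi (le_max_right _ _))⟩

instance : SecondCountableTopology C.Path := by
  let := TopologicalSpace.metrizableSpaceMetric C.Path
  infer_instance

lemma measurableSet_cyl (a : C.Path) (n : ℕ) : MeasurableSet (a.cyl n) :=
  (isClopen_cyl a n).isOpen.measurableSet

lemma measurableSpace_eq (n : ℕ) :
    borel C.Path = MeasurableSpace.generateFrom (C.cylsFrom n) :=
  (isTopologicalBasis_cylsFrom n).borel_eq_generateFrom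

lemma measure_ext {μ ν : Measure C.Path} [IsFiniteMeasure μ] (n : ℕ)
    (h : ∀ a : C.Path, ∀ k ≥ n, μ (a.cyl k) = ν (a.cyl k)) (hu : μ Set.univ = ν Set.univ) :
    μ = ν := by
  refine ext_of_generate_finite _ (measurableSpace_eq n) (isPiSystem_cylsFrom n) ?_ hu
  rintro _ ⟨a, k, hk, rfl⟩
  exact h a k hk

lemma cyl_zero (a : C.Path) : a.cyl 0 = Set.univ := by
  ext; simp [cyl]

lemma exists_measure (C : Chain) : ∃ μ : Measure C.Path,
    ∀ (a : C.Path) n, μ (a.cyl n) = ENNReal.ofReal (a n).src := by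
  obtain ⟨off, x, hoff, hx⟩ := exists_coding C
  have hpre : ∀ (a : C.Path) n, x ⁻¹' a.cyl n = Subtype.val ⁻¹' (Set.Ico
      (∑ i ∈ Finset.range n, off i (a i)) (∑ i ∈ Finset.range n, off i (a i) + (a n).src)) := by
    intro a n
    ext t
    rw [Set.mem_preimage, hx, Set.mem_preimage, Set.mem_Ico, sub_nonneg, sub_lt_iff_lt_add']
  have hm : Measurable x := by
    refine Measurable.mono (measurable_generateFrom (s := C.cylsFrom 0) ?_) le_rfl
      (measurableSpace_eq 0).le
    rintro _ ⟨a, k, -, rfl⟩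
    rw [hpre]
    exact measurable_subtype_coe measurableSet_Ico
  refine ⟨(volume.comap Subtype.val).map x, fun a n => ?_⟩
  have hsub : Set.Ico (∑ i ∈ Finset.range n, off i (a i))
      (∑ i ∈ Finset.range n, off i (a i) + (a n).src) ⊆ Set.Ico 0 C.root := by
    rw [← src_zero a]
    induction n with
    | zero => simp
    | succ n ih =>
      refine subset_trans (Set.Ico_subset_Ico ?_ ?_) ih
      · rw [Finset.sum_range_succ]; linarith [(hoff n _ (a.mem_edges n)).1]
      · rw [Finset.sum_range_succ, ← a.tgt_eq]; linarith [(hoff n _ (a.mem_edges n)).2]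
  rw [Measure.map_apply hm (measurableSet_cyl a n), hpre,
    Measure.comap_apply _ Subtype.val_injective (fun s hs => measurableSet_Ico.subtype_image hs) _
      (measurable_subtype_coe measurableSet_Ico), Subtype.image_preimage_coe,
    Set.inter_eq_right.2 hsub, Real.volume_Ico, add_sub_cancel_left]

end Chain

namespace Chain

open CantorOE.Chain.Path

variable {C : Chain}

namespace Path

open Classical in
/-- Exchange the initial segments of length `n` of `a` and `b`. -/
noncomputable def swapFun (a b : C.Path) (n : ℕ) (h : (a n).src = (b n).src) (z : C.Path) :
    C.Path :=
  if ha : z ∈ a.cyl n then glue b z n (h.symm.trans (src_eq_of_mem_cyl ha).symm)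
  else if hb : z ∈ b.cyl n then glue a z n (h.trans (src_eq_of_mem_cyl hb).symm) else z

section swap

variable (a b : C.Path) (n : ℕ) (h : (a n).src = (b n).src)

lemma glue_mem_cyl {x y : C.Path} {n : ℕ} (h : (x n).src = (y n).src) : glue x y n h ∈ x.cyl n :=
  fun _ hi => glue_lt h hi

open Classical in
lemma swapFun_apply (z : C.Path) (i : ℕ) : swapFun a b n h z i =
    if z ∈ a.cyl n then (if i < n then b i else z i) else
      if z ∈ b.cyl n then (if i < n then a i else z i) else z i := by
  unfold swapFun
  split_ifs <;> simp_all [glue]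

lemma swapFun_ge (z : C.Path) {i : ℕ} (hi : n ≤ i) : swapFun a b n h z i = z i := by
  rw [swapFun_apply]
  simp [hi.not_gt]

lemma swapFun_of_mem {z : C.Path} (hz : z ∈ a.cyl n) : swapFun a b n h z ∈ b.cyl n := by
  rw [swapFun, dif_pos hz]
  exact glue_mem_cyl _

lemma swapFun_of_mem' {z : C.Path} (hz : z ∈ b.cyl n) : swapFun a b n h z ∈ a.cyl n := by
  rw [swapFun]
  split_ifs with h1
  · intro i hi
    rw [glue_lt _ hi, ← hz i hi, h1 i hi]
  · exact glue_mem_cyl _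

lemma swapFun_of_not_mem {z : C.Path} (ha : z ∉ a.cyl n) (hb : z ∉ b.cyl n) :
    swapFun a b n h z = z := by
  rw [swapFun, dif_neg ha, dif_neg hb]

lemma swapFun_involutive : Function.Involutive (swapFun a b n h) := by
  intro z
  ext1 i
  rcases lt_or_ge i n with hi | hi
  · by_cases ha : z ∈ a.cyl n
    · rw [swapFun_of_mem' a b n h (swapFun_of_mem a b n h ha) i hi, ha i hi]
    · by_cases hb : z ∈ b.cyl n
      · rw [swapFun_of_mem a b n h (swapFun_of_mem' a b n h hb) i hi, hb i hi]
      · rw [swapFun_of_not_mem a b n h ha hb, swapFun_of_not_mem a b n h ha hb]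
  · rw [swapFun_ge _ _ _ _ _ hi, swapFun_ge _ _ _ _ _ hi]

lemma continuous_swapFun : Continuous (swapFun a b n h) := by
  classical
  refine continuous_mk fun i => ?_
  simp only [swapFun_apply]
  refine continuous_ite_of_isClopen (isClopen_cyl a n) ?_
    (continuous_ite_of_isClopen (isClopen_cyl b n) ?_ (continuous_coord i))
  all_goals
    split_ifs
    · exact continuous_const
    · exact continuous_coord i

/-- Exchanging two initial segments, as a homeomorphism. -/
noncomputable def swap : C.Path ≃ₜ C.Path where
  toEquiv := (swapFun_involutive a b n h).toPerm
  continuous_toFun := continuous_swapFun a b n h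
  continuous_invFun := continuous_swapFun a b n h

lemma swap_apply (z : C.Path) : swap a b n h z = swapFun a b n h z := rfl

lemma preimage_swap_cyl {c : C.Path} {k : ℕ} (hk : n ≤ k) :
    swap a b n h ⁻¹' c.cyl k = (swap a b n h c).cyl k := by
  have key : ∀ c z : C.Path, z ∈ c.cyl k → swapFun a b n h z ∈ (swapFun a b n h c).cyl k := by
    intro c z hz i hi
    have hz' : ∀ d : C.Path, z ∈ d.cyl n ↔ c ∈ d.cyl n := fun d =>
      forall₂_congr fun j hj => by rw [hz j (by omega)]
    classical
    rw [swapFun_apply, swapFun_apply, hz' a, hz' b, hz i hi]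
  ext z
  refine ⟨fun hz => ?_, fun hz => ?_⟩
  · have := key _ _ hz
    rwa [swap_apply, swapFun_involutive a b n h z] at this
  · have := key _ _ hz
    rwa [swap_apply, swapFun_involutive a b n h c] at this

lemma tail_swap (z : C.Path) : Tail z (swap a b n h z) :=
  ⟨n, fun _ hi => (swapFun_ge a b n h z hi).symm⟩

lemma preimage_swap_self : swap a b n h ⁻¹' a.cyl n = b.cyl n := by
  rw [preimage_swap_cyl a b n h le_rfl]
  exact cyl_eq (swapFun_of_mem a b n h (mem_cyl_self a n))

end swap

/-- A countable family of homeomorphisms generating tail equivalence. -/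
noncomputable def tailMap (C : Chain) (q : ℕ × ℕ × ℕ) : C.Path ≃ₜ C.Path :=
  open Classical in
  if h : (TopologicalSpace.denseSeq C.Path q.1 q.2.2).src =
      (TopologicalSpace.denseSeq C.Path q.2.1 q.2.2).src then swap _ _ _ h else Homeomorph.refl _

lemma Tail.exists_tailMap {x y : C.Path} (h : Tail x y) : ∃ q, tailMap C q x = y := by
  obtain ⟨n, h⟩ := h
  have hd : ∀ x : C.Path, ∃ i, TopologicalSpace.denseSeq C.Path i ∈ x.cyl n := fun x =>
    (TopologicalSpace.denseRange_denseSeq C.Path).exists_mem_open (isClopen_cyl x n).isOpen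
      ⟨x, mem_cyl_self x n⟩
  obtain ⟨i, hi⟩ := hd x
  obtain ⟨j, hj⟩ := hd y
  refine ⟨(i, j, n), ?_⟩
  have hs : (TopologicalSpace.denseSeq C.Path i n).src =
      (TopologicalSpace.denseSeq C.Path j n).src := by
    rw [src_eq_of_mem_cyl hi, src_eq_of_mem_cyl hj, h n le_rfl]
  rw [tailMap, dif_pos hs]
  ext1 k
  rcases lt_or_ge k n with hk | hk
  · rw [swap_apply, swapFun_of_mem _ _ _ hs (fun l hl => (hi l hl).symm) k hk, hj k hk]
  · rw [swap_apply, swapFun_ge _ _ _ hs x hk, h k hk]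

lemma countable_tail_class (x : C.Path) : {y | Tail y x}.Countable := by
  refine (Set.countable_range fun q => tailMap C q x).mono fun y hy => ?_
  exact hy.symm.exists_tailMap

end Path

/-- The measures on path space assigning to a cylinder the weight of its end vertex. -/
def IsWeight (μ : Measure C.Path) : Prop :=
  ∀ (a : C.Path) n, μ (a.cyl n) = ENNReal.ofReal (a n).src

lemma src_le (x : C.Path) (n : ℕ) : (x n).src ≤ C.root / 2 ^ n := by
  induction n with
  | zero => simp [src_zero]
  | succ n ih =>
    have h1 := C.sum n _ (x.src_mem n)
    have h2 := Finset.single_le_sum (f := fun d => (C.m n (x n).src d : ℝ) * d)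
      (fun d hd => mul_nonneg (Nat.cast_nonneg _) (C.pos _ d hd).le) (x.src_mem (n + 1))
    have h3 : (2 : ℝ) ≤ C.m n (x n).src (x (n + 1)).src := by
      exact_mod_cast C.two_le n _ (x.src_mem n) _ (x.src_mem (n + 1))
    have h4 := C.pos _ _ (x.src_mem (n + 1))
    rw [pow_succ, ← div_div, le_div_iff₀ two_pos]
    have h5 : (C.m n (x n).src (x (n + 1)).src : ℝ) * (x (n + 1)).src ≤ (x n).src := h2.trans h1.le
    nlinarith

variable {μ : Measure C.Path}

lemma IsWeight.univ (hμ : IsWeight μ) : μ Set.univ = ENNReal.ofReal C.root := by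
  rw [← cyl_zero (mark C true), hμ, src_zero]

lemma IsWeight.isFiniteMeasure (hμ : IsWeight μ) : IsFiniteMeasure μ :=
  ⟨by rw [hμ.univ]; exact ENNReal.ofReal_lt_top⟩

lemma IsWeight.singleton (hμ : IsWeight μ) (x : C.Path) : μ {x} = 0 := by
  have h1 : Filter.Tendsto (fun n : ℕ => ENNReal.ofReal (C.root / 2 ^ n)) Filter.atTop (𝓝 0) := by
    rw [← ENNReal.ofReal_zero]
    refine ENNReal.tendsto_ofReal ?_
    have := (tendsto_pow_atTop_nhds_zero_of_lt_one (r := (1 / 2 : ℝ)) (by norm_num)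
      (by norm_num)).const_mul C.root
    simpa [div_eq_mul_inv] using this
  refine le_antisymm (ge_of_tendsto' h1 fun n => ?_) bot_le
  refine (measure_mono (t := x.cyl n) (by simpa using mem_cyl_self x n)).trans ?_
  rw [hμ]
  exact ENNReal.ofReal_le_ofReal (src_le x n)

lemma IsWeight.measurePreserving_swap (hμ : IsWeight μ) (a b : C.Path) (n : ℕ)
    (h : (a n).src = (b n).src) :
    MeasurePreserving (swap a b n h) μ μ := by
  have := hμ.isFiniteMeasure
  have hm : Measurable (swap a b n h) := (swap a b n h).continuous.measurable
  refine ⟨hm, (measure_ext n (fun c k hk => ?_) ?_).symm⟩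
  · rw [Measure.map_apply hm (measurableSet_cyl c k), preimage_swap_cyl a b n h hk, hμ, hμ,
      swap_apply, swapFun_ge a b n h c hk]
  · rw [Measure.map_apply hm MeasurableSet.univ, Set.preimage_univ]

lemma IsWeight.measurePreserving_tailMap (hμ : IsWeight μ) (q : ℕ × ℕ × ℕ) :
    MeasurePreserving (tailMap C q) μ μ := by
  unfold tailMap
  split_ifs
  · exact hμ.measurePreserving_swap _ _ _ _
  · exact MeasurePreserving.id μ

end Chain

lemma map_eq_of_countable_pieces {Z ι : Type*} [Countable ι] [TopologicalSpace Z] [T2Space Z]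
    [MeasurableSpace Z] [BorelSpace Z] {M : Measure Z} (T : ι → Z ≃ₜ Z)
    (hT : ∀ q, MeasurePreserving (T q) M M) (g : Z ≃ₜ Z) {S : Set Z} (hS : S.Countable)
    (h0 : ∀ z, M {z} = 0) (h : ∀ z ∉ S, ∃ q, g z = T q z) : M.map g = M := by
  have hSn : ∀ S : Set Z, S.Countable → M S = 0 := fun S hS => by
    rw [← Set.biUnion_of_singleton S, measure_biUnion_null_iff hS]
    exact fun z _ => h0 z
  have hD : ∀ q, MeasurableSet {z | g z = T q z} := fun q =>
    (isClosed_eq g.continuous (T q).continuous).measurableSet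
  let s : Option ι → Set Z := fun o => o.elim (g '' S) fun q => g '' {z | g z = T q z}
  have hs : ⋃ o, s o = Set.univ := by
    refine Set.eq_univ_of_forall fun w => ?_
    obtain ⟨z, rfl⟩ := g.surjective w
    by_cases hz : z ∈ S
    · exact Set.mem_iUnion.2 ⟨none, z, hz, rfl⟩
    · obtain ⟨q, hq⟩ := h z hz
      exact Set.mem_iUnion.2 ⟨some q, z, hq, rfl⟩
  rw [Measure.ext_iff_of_iUnion_eq_univ hs]
  rintro (_ | q)
  · have h1 : M (g '' S) = 0 := hSn _ (hS.image g)
    have h2 : M.map g (g '' S) = 0 := by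
      rw [Measure.map_apply g.measurable (hS.image g).measurableSet,
        Set.preimage_image_eq _ g.injective, hSn S hS]
    exact (Measure.restrict_eq_zero.2 h2).trans (Measure.restrict_eq_zero.2 h1).symm
  · ext A hA
    have hm : MeasurableSet (g '' {z | g z = T q z}) :=
      (g.toMeasurableEquiv.measurableSet_image).2 (hD q)
    have him : g '' {z | g z = T q z} = T q '' {z | g z = T q z} := Set.image_congr fun z hz => hz
    rw [Measure.restrict_apply hA, Measure.restrict_apply hA]
    change M.map g (A ∩ g '' {z | g z = T q z}) = M (A ∩ g '' {z | g z = T q z})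
    rw [Measure.map_apply g.measurable (hA.inter hm)]
    conv_rhs => rw [← (hT q).measure_preimage (hA.inter hm).nullMeasurableSet]
    rw [Set.preimage_inter, Set.preimage_inter, Set.preimage_image_eq _ g.injective, him,
      Set.preimage_image_eq _ (T q).injective]
    congr 1
    ext z
    simp only [Set.mem_inter_iff, Set.mem_preimage, Set.mem_ofPred_eq]
    exact and_congr_left fun hz => by rw [hz]

namespace Chain

open CantorOE.Chain.Path

variable {C : Chain}

/-- The two marked tail classes. -/
def markedSet (C : Chain) : Set C.Path := {x | ∃ l, Tail x (mark C l)}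

lemma countable_markedSet (C : Chain) : (markedSet C).Countable := by
  have : markedSet C = ⋃ l, {x | Tail x (mark C l)} := by
    ext; simp [markedSet]
  rw [this]
  exact Set.countable_iUnion fun l => countable_tail_class _

lemma Path.Rel.exists_tailMap {x y : C.Path} (h : Rel x y) (hx : x ∉ markedSet C) :
    ∃ q, y = tailMap C q x := by
  rcases h with h | ⟨l, h, -⟩
  · obtain ⟨q, hq⟩ := h.exists_tailMap
    exact ⟨q, hq.symm⟩
  · exact absurd ⟨l, h⟩ hx

variable {μ : Measure C.Path}

lemma IsWeight.isInvariantMeasure (hμ : IsWeight μ) :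
    IsInvariantMeasure {q : C.Path × C.Path | Rel q.1 q.2} μ := fun h hh =>
  map_eq_of_countable_pieces (tailMap C) hμ.measurePreserving_tailMap h (countable_markedSet C)
    hμ.singleton fun z hz => (hh z).exists_tailMap hz

lemma IsWeight.isInvariantMeasure_prod (hμ : IsWeight μ) (N : ℕ) :
    IsInvariantMeasure (finProdRel {q : C.Path × C.Path | Rel q.1 q.2} N)
      (μ.prod (Measure.count : Measure (Fin N))) := by
  have := hμ.isFiniteMeasure
  intro g hg
  refine map_eq_of_countable_pieces
    (T := fun q : (ℕ × ℕ × ℕ) × Equiv.Perm (Fin N) =>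
      (tailMap C q.1).prodCongr (Homeomorph.mk q.2 (by fun_prop) (by fun_prop)))
    (S := markedSet C ×ˢ Set.univ) ?_ g ((countable_markedSet C).prod Set.countable_univ) ?_ ?_
  · rintro ⟨q, π⟩
    refine (hμ.measurePreserving_tailMap q).prod ⟨by fun_prop, ?_⟩
    ext s hs
    rw [Measure.map_apply (by fun_prop) hs]
    change Measure.count (π ⁻¹' s) = _
    rw [← Equiv.image_symm_eq_preimage]
    exact Measure.count_injective_image π.symm.injective _
  · rintro ⟨x, i⟩
    rw [← Set.singleton_prod_singleton, Measure.prod_prod, hμ.singleton, zero_mul]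
  · rintro ⟨x, i⟩ hz
    have hx : x ∉ markedSet C := fun h => hz ⟨h, trivial⟩
    obtain ⟨q, hq⟩ := Path.Rel.exists_tailMap (hg (x, i)) hx
    refine ⟨(q, Equiv.swap i (g (x, i)).2), Prod.ext hq ?_⟩
    exact (Equiv.swap_apply_left i _).symm

/-- The extensions of a cylinder by one edge. -/
lemma exists_mem_cyl (a : C.Path) (n : ℕ) {e : Edge} (he : e ∈ C.edges n) (h : e.src = (a n).src) :
    ∃ z ∈ a.cyl n, z n = e := by
  obtain ⟨x, hx⟩ := exists_src_eq (n + 1) he.2.1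
  obtain ⟨z, -, hz, -⟩ := exists_maximal_upto x n he (by rw [x.tgt_eq, hx])
  have hs : (a n).src = (z n).src := by rw [hz, h]
  exact ⟨glue a z n hs, glue_mem_cyl hs, by rw [glue_ge hs le_rfl, hz]⟩

lemma subset_closure_succ (C : Chain) (n : ℕ) {b : ℝ} (hb : b ∈ C.B n) :
    b ∈ AddSubmonoid.closure (C.B (n + 1) : Set ℝ) := by
  rw [← C.sum n b hb]
  refine sum_mem fun d hd => ?_
  rw [← nsmul_eq_mul]
  exact nsmul_mem (AddSubmonoid.subset_closure hd) _

lemma measure_cyl_eq (ν : Measure C.Path) [IsFiniteMeasure ν] (a : C.Path) (n : ℕ) (g : ℝ → ℝ)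
    (hg : ∀ z : C.Path, ν.real (z.cyl (n + 1)) = g (z (n + 1)).src) :
    ν.real (a.cyl n) = ∑ d ∈ C.B (n + 1), (C.m n (a n).src d : ℝ) * g d := by
  classical
  rw [← sum_out n (a n).src g]
  have hz : ∀ e : Edge, ∃ z : C.Path, e ∈ C.out n (a n).src → z ∈ a.cyl n ∧ z n = e := by
    intro e
    by_cases he : e ∈ C.out n (a n).src
    · have he' := (mem_out (a.src_mem n)).1 he
      obtain ⟨z, h⟩ := exists_mem_cyl a n he'.1 he'.2
      exact ⟨z, fun _ => h⟩
    · exact ⟨a, fun h => absurd h he⟩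
  choose z hz using hz
  have hU : a.cyl n = ⋃ e ∈ C.out n (a n).src, (z e).cyl (n + 1) := by
    ext w
    simp only [Set.mem_iUnion, exists_prop]
    constructor
    · intro hw
      have he : w n ∈ C.out n (a n).src :=
        (mem_out (a.src_mem n)).2 ⟨w.mem_edges n, src_eq_of_mem_cyl hw⟩
      refine ⟨w n, he, fun i hi => ?_⟩
      obtain ⟨h1, h2⟩ := hz _ he
      rcases Nat.lt_succ_iff_lt_or_eq.1 hi with hi | rfl
      · rw [hw i hi, h1 i hi]
      · exact h2.symm
    · rintro ⟨e, he, hw⟩ i hi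
      rw [hw i (by omega), (hz e he).1 i hi]
  rw [hU, measureReal_biUnion_finset]
  · refine Finset.sum_congr rfl fun e he => ?_
    rw [hg, ← (z e).tgt_eq, (hz e he).2]
  · intro e he f hf hef
    refine Set.disjoint_left.2 fun w h1 h2 => hef ?_
    rw [← (hz e he).2, ← (hz f hf).2, ← h1 n n.lt_succ_self, ← h2 n n.lt_succ_self]
  · exact fun e _ => measurableSet_cyl _ _

/-- An additive state on the vertices is the identity. -/
lemma state_eq_id {E : AddSubgroup ℝ} (hC : Exhausts C E) (h1 : (1 : ℝ) ∈ E) (hroot : C.root = 1)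
    (g : ℕ → ℝ → ℝ) (hg0 : ∀ n b, 0 ≤ g n b) (hg1 : g 0 1 = 1)
    (hg : ∀ n, ∀ b ∈ C.B n, g n b = ∑ d ∈ C.B (n + 1), (C.m n b d : ℝ) * g (n + 1) d)
    (n : ℕ) {b : ℝ} (hb : b ∈ C.B n) : g n b = b := by
  choose f hf using fun n => exists_functional (C.indep n) (g n)
  have hstep : ∀ n, ∀ b ∈ C.B n, f (n + 1) b = f n b := by
    intro n b hb
    rw [hf n b hb, hg n b hb]
    conv_lhs => rw [← C.sum n b hb]
    rw [map_sum]
    exact Finset.sum_congr rfl fun d hd => by rw [map_nat_mul, hf _ d hd]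
  have hcl : ∀ n k, ∀ b ∈ C.B n, b ∈ AddSubmonoid.closure (C.B (n + k) : Set ℝ) := by
    intro n k b hb
    induction k with
    | zero => exact AddSubmonoid.subset_closure hb
    | succ k ih =>
      refine AddSubmonoid.closure_le.2 ?_ ih
      exact fun x hx => subset_closure_succ C _ hx
  have hstep' : ∀ n, ∀ x ∈ AddSubmonoid.closure (C.B n : Set ℝ), f (n + 1) x = f n x := by
    intro n x hx
    induction hx using AddSubmonoid.closure_induction with
    | mem x hx => exact hstep n x hx
    | zero => simp
    | add x y _ _ hx hy => rw [map_add, map_add, hx, hy]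
  have hfk : ∀ n k, ∀ b ∈ C.B n, f (n + k) b = f n b := by
    intro n k b hb
    induction k with
    | zero => rfl
    | succ k ih => rw [← ih]; exact hstep' (n + k) b (hcl n k b hb)
  have hnn : ∀ n, ∀ x ∈ AddSubmonoid.closure (C.B n : Set ℝ), 0 ≤ f n x := by
    intro n x hx
    induction hx using AddSubmonoid.closure_induction with
    | mem x hx => rw [hf n x hx]; exact hg0 n x
    | zero => simp
    | add x y _ _ hx hy => rw [map_add]; exact add_nonneg hx hy
  have hone : ∀ m, f m 1 = 1 := by
    intro m
    have h0 : (1 : ℝ) ∈ C.B 0 := by rw [C.zero, hroot]; simp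
    rw [← zero_add m, hfk 0 m 1 h0, hf 0 1 h0, hg1]
  have hposE : ∀ e ∈ E, 0 < e → ∃ m ≥ n, 0 ≤ f m e := by
    intro e he he0
    obtain ⟨N, hN⟩ := hC.2 e he he0
    exact ⟨max n N, le_max_left _ _, hnn _ _ ((hN _ (le_max_right _ _)).mem_closure
      ⟨_, C.p_mem _⟩)⟩
  have hbE := hC.1 n b hb
  have hfb : ∀ m ≥ n, f m b = g n b := by
    intro m hm
    obtain ⟨k, rfl⟩ := Nat.exists_eq_add_of_le hm
    rw [hfk n k b hb, hf n b hb]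
  have hval : ∀ m ≥ n, ∀ r : ℚ, f m (r.den • b - r.num • (1 : ℝ)) = r.den * g n b - r.num := by
    intro m hm r
    rw [map_sub, map_nsmul, map_zsmul, hone, hfb m hm]
    simp
  have hmemE : ∀ r : ℚ, r.den • b - r.num • (1 : ℝ) ∈ E := fun r =>
    E.sub_mem (E.nsmul_mem hbE _) (E.zsmul_mem h1 _)
  have hden : ∀ r : ℚ, (0 : ℝ) < r.den := fun r => by exact_mod_cast r.den_pos
  have hr : ∀ r : ℚ, (r : ℝ) * r.den = r.num := fun r => by exact_mod_cast Rat.mul_den_eq_num r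
  refine le_antisymm ?_ ?_
  · by_contra! hlt
    obtain ⟨r, hr1, hr2⟩ := exists_rat_btwn hlt
    obtain ⟨m, hm, h⟩ := hposE (-(r.den • b - r.num • (1 : ℝ))) (E.neg_mem (hmemE r)) (by
      rw [nsmul_eq_mul, zsmul_eq_mul, mul_one, ← hr]; nlinarith [hden r])
    rw [map_neg, hval m hm, ← hr] at h
    nlinarith [hden r]
  · by_contra! hlt
    obtain ⟨r, hr1, hr2⟩ := exists_rat_btwn hlt
    obtain ⟨m, hm, h⟩ := hposE (r.den • b - r.num • (1 : ℝ)) (hmemE r) (by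
      rw [nsmul_eq_mul, zsmul_eq_mul, mul_one, ← hr]; nlinarith [hden r])
    rw [hval m hm, ← hr] at h
    nlinarith [hden r]

lemma IsWeight.unique (hμ : IsWeight μ) {E : AddSubgroup ℝ} (hC : Exhausts C E) (h1 : (1 : ℝ) ∈ E)
    (hroot : C.root = 1) (ν : Measure C.Path) [IsProbabilityMeasure ν]
    (hν : IsInvariantMeasure {q : C.Path × C.Path | Rel q.1 q.2} ν) : ν = μ := by
  have heq : ∀ (n : ℕ) (a b : C.Path), (a n).src = (b n).src →
      ν.real (a.cyl n) = ν.real (b.cyl n) := by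
    intro n a b h
    have h2 := hν (swap a b n h) fun x => Or.inl (tail_swap a b n h x)
    rw [Measure.real, Measure.real, ← preimage_swap_self a b n h,
      ← Measure.map_apply (swap a b n h).measurable (measurableSet_cyl a n), h2]
  have hg : ∀ n v, ∃ r : ℝ, 0 ≤ r ∧ ∀ a : C.Path, (a n).src = v → ν.real (a.cyl n) = r := by
    intro n v
    by_cases h : ∃ a : C.Path, (a n).src = v
    · obtain ⟨a, ha⟩ := h
      exact ⟨ν.real (a.cyl n), measureReal_nonneg, fun b hb => heq n b a (hb.trans ha.symm)⟩
    · exact ⟨0, le_rfl, fun a ha => absurd ⟨a, ha⟩ h⟩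
  choose g hg0 hg using hg
  have hid := state_eq_id hC h1 hroot g hg0 (by
    rw [← hg 0 1 (mark C true) (by rw [src_zero, hroot]), cyl_zero]; simp) (fun n b hb => by
    obtain ⟨a, ha⟩ := exists_src_eq n hb
    rw [← hg n b a ha, measure_cyl_eq ν a n (g (n + 1)) (fun z => hg _ _ z rfl), ha])
  have hcyl : ∀ (a : C.Path) n, ν (a.cyl n) = ENNReal.ofReal (a n).src := by
    intro a n
    rw [← hid n (a.src_mem n), ← hg n _ a rfl, ofReal_measureReal]
  refine measure_ext 0 (fun a k _ => by rw [hcyl, hμ]) ?_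
  rw [hμ.univ, hroot]; simp

lemma exists_forall_cyl_subset {V : Set C.Path} (hV : IsClopen V) : ∃ n, ∀ x ∈ V, x.cyl n ⊆ V := by
  have h : ∀ x : C.Path, ∃ n, x ∈ V → x.cyl n ⊆ V := by
    intro x
    by_cases hx : x ∈ V
    · obtain ⟨n, hn⟩ := exists_cyl_subset hV.isOpen hx
      exact ⟨n, fun _ => hn⟩
    · exact ⟨0, fun h => absurd h hx⟩
  choose n hn using h
  obtain ⟨t, ht⟩ := hV.isClosed.isCompact.elim_nhds_subcover' (fun x _ => x.cyl (n x))
    fun x _ => (isClopen_cyl x (n x)).isOpen.mem_nhds (mem_cyl_self x _)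
  refine ⟨t.sup fun x => n x, fun x hx z hz => ?_⟩
  obtain ⟨y, hy, hxy⟩ := Set.mem_iUnion₂.1 (ht hx)
  refine hn y y.2 fun i hi => ?_
  rw [hz i (lt_of_lt_of_le hi (Finset.le_sup (f := fun x : V => n x) hy)), hxy i hi]

lemma finite_range_cyl (n : ℕ) : (Set.range fun a : C.Path => a.cyl n).Finite := by
  obtain ⟨t, ht⟩ := isCompact_univ.elim_nhds_subcover (fun x : C.Path => x.cyl n)
    fun x _ => (isClopen_cyl x n).isOpen.mem_nhds (mem_cyl_self x _)
  refine (t.finite_toSet.image fun x => x.cyl n).subset ?_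
  rintro _ ⟨a, rfl⟩
  obtain ⟨y, hy, hay⟩ := Set.mem_iUnion₂.1 (ht.2 (Set.mem_univ a))
  exact ⟨y, hy, (cyl_eq hay).symm⟩

lemma IsWeight.real_clopen_mem (hμ : IsWeight μ) {E : AddSubgroup ℝ} (hE : ∀ n, ∀ b ∈ C.B n, b ∈ E)
    {V : Set C.Path} (hV : IsClopen V) : μ.real V ∈ E := by
  classical
  have := hμ.isFiniteMeasure
  obtain ⟨n, hn⟩ := exists_forall_cyl_subset hV
  have hfin : ((fun a : C.Path => a.cyl n) '' V).Finite :=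
    (finite_range_cyl n).subset (Set.image_subset_range _ _)
  have hU : V = ⋃ s ∈ hfin.toFinset, s := by
    ext z
    simp only [Set.Finite.mem_toFinset, Set.mem_iUnion, exists_prop]
    constructor
    · exact fun hz => ⟨z.cyl n, ⟨z, hz, rfl⟩, mem_cyl_self z n⟩
    · rintro ⟨_, ⟨a, ha, rfl⟩, hz⟩
      exact hn a ha hz
  rw [hU, measureReal_biUnion_finset]
  · refine sum_mem fun s hs => ?_
    obtain ⟨a, ha, rfl⟩ := hfin.mem_toFinset.1 hs
    rw [Measure.real, hμ, ENNReal.toReal_ofReal (C.pos _ _ (a.src_mem n)).le]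
    exact hE n _ (a.src_mem n)
  · intro s hs t ht hst
    obtain ⟨a, -, rfl⟩ := hfin.mem_toFinset.1 hs
    obtain ⟨b, -, rfl⟩ := hfin.mem_toFinset.1 ht
    exact Set.disjoint_left.2 fun z h1 h2 => hst ((cyl_eq h1).symm.trans (cyl_eq h2))
  · intro s hs
    obtain ⟨a, -, rfl⟩ := hfin.mem_toFinset.1 hs
    exact measurableSet_cyl a n

end Chain

lemma exists_equiv_of_card_fiber {A B Z : Type*} [Finite A] [Finite B] (f : A → Z) (g : B → Z)
    (h : ∀ z, Nat.card {a // f a = z} = Nat.card {b // g b = z}) (a : Bool → A) (b : Bool → B)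
    (ha : Function.Injective a) (hb : Function.Injective b) (hab : ∀ l, f (a l) = g (b l)) :
    ∃ e : A ≃ B, (∀ x, g (e x) = f x) ∧ ∀ l, e (a l) = b l := by
  classical
  have hswap : ∀ (e : A ≃ B) (l : Bool), (∀ x, g (e x) = f x) →
      ∀ x, g ((e.trans (Equiv.swap (e (a l)) (b l))) x) = f x := by
    intro e l he x
    rw [Equiv.trans_apply, Equiv.swap_apply_def]
    split_ifs with h1 h2
    · rw [← hab, ← he x, h1, he]
    · rw [he, hab, ← h2, he]
    · exact he x
  let e₀ : A ≃ B := Equiv.ofFiberEquiv (f := f) (g := g) fun z => (Finite.card_eq.1 (h z)).some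
  have h₀ : ∀ x, g (e₀ x) = f x := fun x => Equiv.ofFiberEquiv_map _ x
  let e₁ := e₀.trans (Equiv.swap (e₀ (a true)) (b true))
  have h₁ : e₁ (a true) = b true := Equiv.swap_apply_left _ _
  have h₁' := hswap e₀ true h₀
  refine ⟨e₁.trans (Equiv.swap (e₁ (a false)) (b false)), hswap e₁ false h₁', fun l => ?_⟩
  cases l
  · exact Equiv.swap_apply_left _ _
  · rw [Equiv.trans_apply, h₁, Equiv.swap_apply_of_ne_of_ne]
    · rw [← h₁]
      exact fun h => absurd (ha (e₁.injective h)) (by simp)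
    · exact fun h => absurd (hb h) (by simp)

namespace Chain

open CantorOE.Chain.Path

variable {C D : Chain}

/-- Two paths agree on the levels in `[a, b)`. -/
def winSetoid (C : Chain) (a b : ℕ) : Setoid C.Path where
  r x y := ∀ i, a ≤ i → i < b → x i = y i
  iseqv := ⟨fun _ _ _ _ => rfl, fun h i h1 h2 => (h i h1 h2).symm,
    fun h h' i h1 h2 => (h i h1 h2).trans (h' i h1 h2)⟩

/-- The finite path segments between levels `a` and `b`. -/
abbrev Win (C : Chain) (a b : ℕ) : Type := Quotient (winSetoid C a b)

/-- The segment of a path. -/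
def win (a b : ℕ) (x : C.Path) : Win C a b := Quotient.mk (winSetoid C a b) x

lemma win_eq {a b : ℕ} {x y : C.Path} : win a b x = win a b y ↔ ∀ i, a ≤ i → i < b → x i = y i :=
  Quotient.eq (r := winSetoid C a b)

lemma win_out {a b : ℕ} (σ : Win C a b) : win a b (Quotient.out σ) = σ := Quotient.out_eq σ

instance (a b : ℕ) : Finite (Win C a b) := by
  have : Finite (Set.range fun x : C.Path => x.cyl b) := finite_range_cyl b
  refine Finite.of_injective (β := Set.range fun x : C.Path => x.cyl b)
    (fun σ => ⟨σ.out.cyl b, σ.out, rfl⟩) fun σ τ h => ?_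
  have h2 : σ.out ∈ τ.out.cyl b := (Subtype.ext_iff.1 h).subset (mem_cyl_self σ.out b)
  rw [← win_out σ, ← win_out τ, win_eq]
  exact fun i _ hi => h2 i hi

/-- The initial vertex of a segment. -/
noncomputable def Win.src {a b : ℕ} (σ : Win C a b) : ℝ := (σ.out a).src

/-- The final vertex of a segment. -/
noncomputable def Win.tgt {a b : ℕ} (σ : Win C a b) : ℝ := (σ.out b).src

lemma src_congr {a b : ℕ} (hab : a < b) {x y : C.Path} (h : win a b x = win a b y) :
    (x a).src = (y a).src := by rw [win_eq.1 h a le_rfl hab]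

lemma tgt_congr {a b : ℕ} (hab : a < b) {x y : C.Path} (h : win a b x = win a b y) :
    (x b).src = (y b).src := by
  obtain ⟨k, rfl⟩ := Nat.exists_eq_add_of_lt hab
  rw [← x.tgt_eq, ← y.tgt_eq, win_eq.1 h (a + k) (by omega) (by omega)]

lemma src_win {a b : ℕ} (hab : a < b) (x : C.Path) : (win a b x).src = (x a).src :=
  src_congr hab (win_out _)

lemma tgt_win {a b : ℕ} (hab : a < b) (x : C.Path) : (win a b x).tgt = (x b).src :=
  tgt_congr hab (win_out _)

lemma card_win_eq_zero {a b : ℕ} {v w : ℝ} (h : ¬ (v ∈ C.B a ∧ w ∈ C.B b)) :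
    Nat.card {σ : Win C a b // (σ.src, σ.tgt) = (v, w)} = 0 := by
  have : IsEmpty {σ : Win C a b // (σ.src, σ.tgt) = (v, w)} := by
    refine ⟨fun σ => h ?_⟩
    obtain ⟨h1, h2⟩ := Prod.mk.inj σ.2
    exact ⟨h1 ▸ src_mem _ _, h2 ▸ src_mem _ _⟩
  exact Nat.card_of_isEmpty

lemma sum_card_win {a b : ℕ} (hab : a < b) {v : ℝ} (hv : v ∈ C.B a) :
    ∑ w ∈ C.B b, (Nat.card {σ : Win C a b // (σ.src, σ.tgt) = (v, w)} : ℝ) * w = v := by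
  classical
  have := Fintype.ofFinite (Win C a b)
  obtain ⟨μ, hμ⟩ := exists_measure C
  have hfin : IsFiniteMeasure μ := IsWeight.isFiniteMeasure hμ
  obtain ⟨x, hx⟩ := exists_src_eq a hv
  have hz : ∀ σ : Win C a b, ∃ z : C.Path, σ.src = v → z ∈ x.cyl a ∧ win a b z = σ := by
    intro σ
    by_cases hσ : σ.src = v
    · have h : (x a).src = (σ.out a).src := hx.trans hσ.symm
      refine ⟨glue x σ.out a h, fun _ => ⟨fun i hi => glue_lt h hi, ?_⟩⟩
      conv_rhs => rw [← win_out σ]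
      exact win_eq.2 fun i hi _ => glue_ge h hi
    · exact ⟨x, fun h => absurd h hσ⟩
  choose z hz using hz
  have hU : x.cyl a = ⋃ σ ∈ Finset.univ.filter fun σ : Win C a b => σ.src = v, (z σ).cyl b := by
    ext w
    simp only [Set.mem_iUnion, exists_prop, Finset.mem_filter, Finset.mem_univ, true_and]
    constructor
    · intro hw
      have hσ : (win a b w).src = v := by rw [src_win hab, src_eq_of_mem_cyl hw, hx]
      refine ⟨_, hσ, fun i hi => ?_⟩
      obtain ⟨h1, h2⟩ := hz _ hσ
      rcases lt_or_ge i a with hia | hia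
      · rw [hw i hia, h1 i hia]
      · exact (win_eq.1 h2 i hia hi).symm
    · rintro ⟨σ, hσ, hw⟩ i hi
      rw [hw i (hi.trans hab), (hz σ hσ).1 i hi]
  have hreal : ∀ (y : C.Path) n, μ.real (y.cyl n) = (y n).src := fun y n => by
    rw [Measure.real, hμ, ENNReal.toReal_ofReal (C.pos _ _ (y.src_mem n)).le]
  have h1 : ∑ σ ∈ Finset.univ.filter (fun σ : Win C a b => σ.src = v), σ.tgt = v := by
    have hxv : μ.real (x.cyl a) = v := by rw [hreal, hx]
    conv_rhs => rw [← hxv, hU]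
    rw [measureReal_biUnion_finset]
    · refine Finset.sum_congr rfl fun σ hσ => ?_
      rw [hreal, ← tgt_win hab (z σ), (hz σ (Finset.mem_filter.1 hσ).2).2]
    · intro σ hσ τ hτ hστ
      refine Set.disjoint_left.2 fun w h1 h2 => hστ ?_
      rw [← (hz σ (Finset.mem_filter.1 hσ).2).2, ← (hz τ (Finset.mem_filter.1 hτ).2).2, win_eq]
      exact fun i _ hi => (h1 i hi).symm.trans (h2 i hi)
    · exact fun _ _ => measurableSet_cyl _ _
  conv_rhs => rw [← h1]
  rw [← Finset.sum_fiberwise_of_maps_to (g := Win.tgt) (t := C.B b)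
    fun σ _ => src_mem _ _]
  refine Finset.sum_congr rfl fun w _ => ?_
  rw [Finset.sum_congr rfl fun σ hσ => (Finset.mem_filter.1 hσ).2, Finset.sum_const, nsmul_eq_mul,
    Nat.card_eq_fintype_card, Fintype.card_subtype, Finset.filter_filter]
  simp only [Prod.mk.injEq]

lemma exists_win_equiv {a b a' b' : ℕ} (hab : a < b) (hab' : a' < b') {c : ℝ} (hc : 0 < c)
    (ha : ∀ v, c * v ∈ D.B a' ↔ v ∈ C.B a) (hb : ∀ v, c * v ∈ D.B b' ↔ v ∈ C.B b)
    (hpa : D.p a' = c * C.p a) (hpb : D.p b' = c * C.p b) :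
    ∃ e : Win C a b ≃ Win D a' b', (∀ σ, (e σ).src = c * σ.src ∧ (e σ).tgt = c * σ.tgt) ∧
      ∀ l, e (win a b (mark C l)) = win a' b' (mark D l) := by
  classical
  have himg : D.B b' = (C.B b).image (c * ·) := by
    ext v
    rw [Finset.mem_image]
    constructor
    · intro hv
      have : c * (c⁻¹ * v) = v := by field_simp
      exact ⟨c⁻¹ * v, (hb _).1 (by rwa [this]), this⟩
    · rintro ⟨w, hw, rfl⟩
      exact (hb w).2 hw
  have hcard : ∀ v w : ℝ, Nat.card {σ : Win C a b // (σ.src, σ.tgt) = (v, w)} =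
      Nat.card {σ : Win D a' b' // (σ.src, σ.tgt) = (c * v, c * w)} := by
    intro v w
    by_cases h : v ∈ C.B a ∧ w ∈ C.B b
    · refine coeff_unique (C.indep b)
        (k := fun w => Nat.card {σ : Win C a b // (σ.src, σ.tgt) = (v, w)})
        (l := fun w => Nat.card {σ : Win D a' b' // (σ.src, σ.tgt) = (c * v, c * w)}) ?_ h.2
      rw [sum_card_win hab h.1]
      have h2 := sum_card_win hab' ((ha v).2 h.1)
      rw [himg, Finset.sum_image fun x _ y _ hxy => mul_left_cancel₀ hc.ne' hxy] at h2
      refine mul_left_cancel₀ hc.ne' (h2.symm.trans ?_)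
      rw [Finset.mul_sum]
      exact Finset.sum_congr rfl fun w _ => by ring
    · rw [card_win_eq_zero h, card_win_eq_zero (by rwa [ha, hb])]
  have hinj : ∀ (C : Chain) {a b : ℕ}, a < b → Function.Injective fun l => win a b (mark C l) := by
    intro C a b hab l l' h
    have := congrArg Edge.lab (win_eq.1 h a le_rfl hab)
    revert this
    cases l <;> cases l' <;> simp [mark_apply]
  obtain ⟨e, he, hm⟩ := exists_equiv_of_card_fiber
    (fun σ : Win C a b => (c * σ.src, c * σ.tgt)) (fun σ : Win D a' b' => (σ.src, σ.tgt))
    (fun z => by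
      have hz : z = (c * (c⁻¹ * z.1), c * (c⁻¹ * z.2)) := by
        ext <;> simp <;> field_simp
      rw [hz, ← hcard]
      refine Nat.card_congr (Equiv.subtypeEquivRight fun σ => ?_)
      simp only [Prod.mk.injEq, mul_right_inj' hc.ne'])
    (fun l => win a b (mark C l)) (fun l => win a' b' (mark D l)) (hinj C hab) (hinj D hab')
    (fun l => by
      simp only [src_win hab, tgt_win hab, src_win hab', tgt_win hab', mark_apply, hpa, hpb])
  exact ⟨e, fun σ => Prod.mk.inj (he σ), hm⟩

end Chain

lemma exists_between_strictMono {m : ℕ → ℕ} (hm : StrictMono m) (h0 : m 0 = 0) (i : ℕ) :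
    ∃ k, m k ≤ i ∧ i < m (k + 1) := by
  induction i with
  | zero => exact ⟨0, h0.le, lt_of_eq_of_lt h0.symm (hm (Nat.lt_succ_self 0))⟩
  | succ i ih =>
    obtain ⟨k, h1, h2⟩ := ih
    rcases (Nat.succ_le_of_lt h2).lt_or_eq with h | h
    · exact ⟨k, by omega, h⟩
    · exact ⟨k + 1, h.ge, by rw [← Nat.succ_eq_add_one, h]; exact hm (k + 1).lt_succ_self⟩

namespace Chain

open CantorOE.Chain.Path

variable {C D : Chain}

lemma exists_path_of_segments {m : ℕ → ℕ} (hm : StrictMono m) (h0 : m 0 = 0) (y : ℕ → C.Path)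
    (hy : ∀ k, (y k (m (k + 1))).src = (y (k + 1) (m (k + 1))).src) :
    ∃ z : C.Path, ∀ k, win (m k) (m (k + 1)) z = win (m k) (m (k + 1)) (y k) := by
  choose κ hκ using exists_between_strictMono hm h0
  have huniq : ∀ i k, m k ≤ i → i < m (k + 1) → κ i = k := by
    intro i k h1 h2
    have h3 := hm.lt_iff_lt.1 (lt_of_le_of_lt h1 (hκ i).2)
    have h4 := hm.lt_iff_lt.1 (lt_of_le_of_lt (hκ i).1 h2)
    omega
  refine ⟨⟨fun i => y (κ i) i, fun i => ⟨(y (κ i)).mem_edges i, ?_⟩⟩, fun k => win_eq.2 ?_⟩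
  · change (y (κ i) i).tgt = (y (κ (i + 1)) (i + 1)).src
    rw [(y (κ i)).tgt_eq]
    rcases (Nat.succ_le_of_lt (hκ i).2).lt_or_eq with h | h
    · rw [huniq (i + 1) (κ i) ((hκ i).1.trans i.le_succ) h]
    · have h2 : κ (i + 1) = κ i + 1 := huniq _ _ h.ge (by
        rw [← Nat.succ_eq_add_one i, h]
        exact hm (κ i + 1).lt_succ_self)
      rw [h2]
      have := hy (κ i)
      rwa [← h] at this
  · intro i h1 h2
    change y (κ i) i = y k i
    rw [huniq i k h1 h2]

lemma ext_win {m : ℕ → ℕ} (hm : StrictMono m) (h0 : m 0 = 0) {x y : C.Path}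
    (h : ∀ k, win (m k) (m (k + 1)) x = win (m k) (m (k + 1)) y) : x = y := by
  refine Path.ext fun i => ?_
  obtain ⟨k, h1, h2⟩ := exists_between_strictMono hm h0 i
  exact win_eq.1 (h k) i h1 h2

lemma tail_iff_win {m : ℕ → ℕ} (hm : StrictMono m) (h0 : m 0 = 0) {x y : C.Path} :
    Tail x y ↔ ∃ K, ∀ k ≥ K, win (m k) (m (k + 1)) x = win (m k) (m (k + 1)) y := by
  constructor
  · rintro ⟨N, hN⟩
    exact ⟨N, fun k hk => win_eq.2 fun i hi _ => hN i (hk.trans (hm.le_apply.trans hi))⟩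
  · rintro ⟨K, hK⟩
    refine ⟨m K, fun i hi => ?_⟩
    obtain ⟨k, h1, h2⟩ := exists_between_strictMono hm h0 i
    have := hm.lt_iff_lt.1 (lt_of_le_of_lt hi h2)
    exact win_eq.1 (hK k (by omega)) i h1 h2

lemma exists_path_of_winMap {n m : ℕ → ℕ} (hn : StrictMono n) (hm : StrictMono m) (h0 : m 0 = 0)
    {c : ℝ} (g : ∀ k, Win C (n k) (n (k + 1)) → Win D (m k) (m (k + 1)))
    (hg : ∀ k σ, (g k σ).src = c * σ.src ∧ (g k σ).tgt = c * σ.tgt) (x : C.Path) :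
    ∃ y : D.Path, ∀ k, win (m k) (m (k + 1)) y = g k (win (n k) (n (k + 1)) x) := by
  obtain ⟨z, hz⟩ := exists_path_of_segments hm h0
    (fun k => (g k (win (n k) (n (k + 1)) x)).out) fun k => by
      refine (hg k _).2.trans ((congrArg _ ?_).trans (hg (k + 1) _).1.symm)
      rw [tgt_win (hn k.lt_succ_self), src_win (hn (k + 1).lt_succ_self)]
  exact ⟨z, fun k => (hz k).trans (win_out _)⟩

/-- Two chains with proportional telescopings have isomorphic tail relations. -/
lemma exists_homeomorph_of_telescope {n m : ℕ → ℕ} (hn : StrictMono n) (hm : StrictMono m)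
    (hn0 : n 0 = 0) (hm0 : m 0 = 0) {c : ℝ} (hc : 0 < c)
    (hB : ∀ k v, c * v ∈ D.B (m k) ↔ v ∈ C.B (n k)) (hp : ∀ k, D.p (m k) = c * C.p (n k)) :
    ∃ F : C.Path ≃ₜ D.Path, (∀ x y, Tail (F x) (F y) ↔ Tail x y) ∧
      ∀ l, F (mark C l) = mark D l := by
  choose e he hmark using fun k => exists_win_equiv (hn k.lt_succ_self) (hm k.lt_succ_self) hc
    (hB k) (hB (k + 1)) (hp k) (hp (k + 1))
  choose F hF using exists_path_of_winMap hn hm hm0 (fun k => e k) he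
  choose G hG using exists_path_of_winMap (c := c⁻¹) hm hn hn0 (fun k => (e k).symm) fun k τ => by
    obtain ⟨σ, rfl⟩ := (e k).surjective τ
    rw [(e k).symm_apply_apply, (he k σ).1, (he k σ).2]
    constructor <;> field_simp
  have hcont : Continuous F := by
    refine continuous_mk fun i => ?_
    obtain ⟨k, h1, h2⟩ := exists_between_strictMono hm hm0 i
    refine IsLocallyConstant.continuous ((IsLocallyConstant.iff_exists_open _).2 fun x =>
      ⟨x.cyl (n (k + 1)), (isClopen_cyl _ _).isOpen, mem_cyl_self _ _, fun y hy => ?_⟩)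
    refine win_eq.1 ?_ i h1 h2
    rw [hF, hF]
    exact congrArg _ (win_eq.2 fun j _ hj => hy j hj)
  let F' : C.Path ≃ D.Path := ⟨F, G,
    fun x => ext_win hn hn0 fun k => by rw [hG, hF, (e k).symm_apply_apply],
    fun y => ext_win hm hm0 fun k => by rw [hF, hG, (e k).apply_symm_apply]⟩
  refine ⟨Continuous.homeoOfEquivCompactToT2 (f := F') hcont, fun x y => ?_, fun l => ?_⟩
  · rw [tail_iff_win hm hm0, tail_iff_win hn hn0]
    refine exists_congr fun K => forall₂_congr fun k _ => ?_
    change win _ _ (F x) = win _ _ (F y) ↔ _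
    rw [hF, hF]
    exact (e k).apply_eq_iff_eq
  · refine ext_win hm hm0 fun k => ?_
    exact (hF _ k).trans (hmark k l)

end Chain

lemma Dom.mul {e : ℝ} {T : Finset ℝ} (h : Dom e T) (c : ℝ) : Dom (c * e) (T.image (c * ·)) := by
  intro t ht
  obtain ⟨s, hs, rfl⟩ := Finset.mem_image.1 ht
  obtain ⟨y, hy, rfl⟩ := h s hs
  refine ⟨c * y, ?_, by ring⟩
  rw [Finset.coe_image]
  have := AddSubmonoid.mem_map_of_mem (AddMonoidHom.mulLeft c) hy
  rwa [AddMonoidHom.map_mclosure] at this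

lemma linearIndependent_image_mul {T : Finset ℝ} (hT : LinearIndependent ℚ (fun t : T => (t : ℝ)))
    {c : ℝ} (hc : c ≠ 0) : LinearIndependent ℚ (fun t : T.image (c * ·) => (t : ℝ)) := by
  have h := hT.map' (LinearMap.mulLeft ℚ c)
    (LinearMap.ker_eq_bot.2 fun x y h => mul_left_cancel₀ hc h)
  have hmem : ∀ t : T.image (c * ·), c⁻¹ * (t : ℝ) ∈ T := by
    rintro ⟨t, ht⟩
    obtain ⟨s, hs, rfl⟩ := Finset.mem_image.1 ht
    simpa [hc] using hs
  have h2 := h.comp (fun t : T.image (c * ·) => (⟨c⁻¹ * t, hmem t⟩ : T)) fun s t hst =>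
    Subtype.ext (mul_left_cancel₀ (inv_ne_zero hc) (Subtype.ext_iff.1 hst))
  have h3 : (fun t : T.image (c * ·) => (t : ℝ)) =
      fun t : T.image (c * ·) => c * (c⁻¹ * (t : ℝ)) :=
    funext fun t => (mul_inv_cancel_left₀ hc _).symm
  rw [h3]
  exact h2

/-- Merging two sequences of finite independent sets exhausting the same group. -/
lemma exists_interleaving (A : Bool → ℕ → Finset ℝ) (P : Bool → ℕ → ℝ) (E : AddSubgroup ℝ)
    (hA : ∀ β, A β 0 = {1}) (hP : ∀ β i, P β i ∈ A β i) (hE : ∀ β i, ∀ b ∈ A β i, 0 < b ∧ b ∈ E)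
    (hind : ∀ β i, LinearIndependent ℚ (fun t : A β i => (t : ℝ)))
    (hdom : ∀ β, ∀ e ∈ E, 0 < e → ∃ N, ∀ n ≥ N, Dom e (A β n)) :
    ∃ (j : ℕ → ℕ) (C : Chain), StrictMono j ∧ j 0 = 0 ∧ (∀ k, C.B k = A k.bodd (j k)) ∧
      ∀ k, C.p k = P k.bodd (j k) := by
  have hstep : ∀ (k i : ℕ), ∃ i', i < i' ∧ ∀ b ∈ A k.bodd i, Dom b (A (k + 1).bodd i') := by
    intro k i
    have : ∀ b : ℝ, ∃ N, b ∈ A k.bodd i → ∀ n ≥ N, Dom b (A (k + 1).bodd n) := by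
      intro b
      by_cases hb : b ∈ A k.bodd i
      · obtain ⟨N, hN⟩ := hdom (k + 1).bodd b (hE _ _ b hb).2 (hE _ _ b hb).1
        exact ⟨N, fun _ => hN⟩
      · exact ⟨0, fun h => absurd h hb⟩
    choose N hN using this
    refine ⟨max (i + 1) ((A k.bodd i).sup N), by omega, fun b hb => hN b hb _ ?_⟩
    exact (Finset.le_sup hb).trans (le_max_right _ _)
  choose next h1 h2 using hstep
  let j : ℕ → ℕ := fun k => Nat.rec 0 (fun k i => next k i) k
  obtain ⟨C, hB, hp, -⟩ := exists_chain (fun k => A k.bodd (j k)) (fun k => P k.bodd (j k)) 1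
    (hA _) (fun n b hb => (hE _ _ b hb).1) (fun n => hP _ _) (fun n => hind _ _)
    fun n b hb => h2 n (j n) b hb
  exact ⟨j, C, strictMono_nat_of_lt_succ fun k => h1 k (j k), rfl, fun k => by rw [hB],
    fun k => by rw [hp]⟩

namespace Chain

open CantorOE.Chain.Path

variable {C D : Chain}

/-- Up to scale, the tail relation of an exhausting chain depends only on the group. -/
theorem exists_homeomorph_of_exhausts {E : AddSubgroup ℝ} (hC : Exhausts C E) (hD : Exhausts D E)
    {c : ℝ} (hc : 0 < c) (hcE : ∀ e ∈ E, c * e ∈ E) (hcE' : ∀ e ∈ E, c⁻¹ * e ∈ E)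
    (hCr : C.root = 1) (hDr : D.root = c) :
    ∃ F : C.Path ≃ₜ D.Path, (∀ x y, Tail (F x) (F y) ↔ Tail x y) ∧
      ∀ l, F (mark C l) = mark D l := by
  have hmem : ∀ i v, c * v ∈ D.B i ↔ v ∈ (D.B i).image (c⁻¹ * ·) := by
    intro i v
    rw [Finset.mem_image]
    constructor
    · exact fun h => ⟨_, h, by field_simp⟩
    · rintro ⟨w, hw, rfl⟩
      rwa [mul_inv_cancel_left₀ hc.ne']
  obtain ⟨j, T, hj, hj0, hTB, hTp⟩ := exists_interleaving
    (fun β i => if β then (D.B i).image (c⁻¹ * ·) else C.B i)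
    (fun β i => if β then c⁻¹ * D.p i else C.p i) E
    (by rintro (_ | _) <;> simp [C.zero, D.zero, hCr, hDr, hc.ne'])
    (by
      rintro (_ | _) i
      · exact C.p_mem i
      · exact Finset.mem_image_of_mem _ (D.p_mem i))
    (by
      rintro (_ | _) i b hb
      · exact ⟨C.pos i b hb, hC.1 i b hb⟩
      · obtain ⟨w, hw, rfl⟩ := Finset.mem_image.1 hb
        exact ⟨mul_pos (inv_pos.2 hc) (D.pos i w hw), hcE' _ (hD.1 i w hw)⟩)
    (by
      rintro (_ | _) i
      · exact C.indep i
      · exact linearIndependent_image_mul (D.indep i) (inv_ne_zero hc.ne'))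
    (by
      rintro (_ | _) e he he0
      · exact hC.2 e he he0
      · obtain ⟨N, hN⟩ := hD.2 (c * e) (hcE e he) (mul_pos hc he0)
        refine ⟨N, fun n hn => ?_⟩
        have := (hN n hn).mul c⁻¹
        rwa [inv_mul_cancel_left₀ hc.ne'] at this)
  obtain ⟨F₁, h₁, h₁'⟩ := exists_homeomorph_of_telescope (C := T) (D := C) (n := fun k => 2 * k)
    (m := fun k => j (2 * k)) (fun a b h => by simpa using h)
    (fun a b h => hj (by simpa using h)) rfl hj0 one_pos
    (fun k v => by rw [one_mul, hTB]; simp) (fun k => by rw [one_mul, hTp]; simp)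
  let n : ℕ → ℕ := fun k => 2 * k - 1
  have hn : StrictMono n := strictMono_nat_of_lt_succ fun k => by dsimp only [n]; omega
  have hbodd : ∀ k, n (k + 1) = 2 * k + 1 := fun k => by dsimp only [n]; omega
  obtain ⟨F₂, h₂, h₂'⟩ := exists_homeomorph_of_telescope (C := T) (D := D) (n := n)
    (m := fun k => j (n k)) hn (hj.comp hn) rfl hj0 hc
    (fun k v => by
      cases k with
      | zero =>
        change c * v ∈ D.B (j 0) ↔ v ∈ T.B 0
        rw [hTB, hj0, D.zero, hDr]
        simp [C.zero, hCr, hc.ne']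
      | succ k => rw [hbodd, hTB, hmem]; simp)
    (fun k => by
      cases k with
      | zero =>
        change D.p (j 0) = c * T.p 0
        have h := D.p_mem 0
        have h' := C.p_mem 0
        rw [D.zero, hDr, Finset.mem_singleton] at h
        rw [C.zero, hCr, Finset.mem_singleton] at h'
        rw [hTp, hj0]
        simp [h, h']
      | succ k => rw [hbodd, hTp]; simp [hc.ne'])
  refine ⟨F₁.symm.trans F₂, fun x y => ?_, fun l => ?_⟩
  · rw [Homeomorph.trans_apply, Homeomorph.trans_apply, h₂, ← h₁, F₁.apply_symm_apply,
      F₁.apply_symm_apply]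
  · rw [Homeomorph.trans_apply, ← h₁' l, F₁.symm_apply_apply, h₂']

end Chain

/-- A homeomorphism of a clopen set extended by the identity. -/
lemma exists_extend_homeomorph {Y : Type*} [TopologicalSpace Y] {U : Set Y} (hU : IsClopen U)
    (k : U ≃ₜ U) : ∃ g : Y ≃ₜ Y, (∀ u : U, g u = k u) ∧ ∀ y ∉ U, g y = y := by
  classical
  have hcont : ∀ k : U ≃ₜ U, Continuous (Equiv.Perm.ofSubtype k.toEquiv : Equiv.Perm Y) := by
    intro k
    rw [← continuousOn_univ, ← Set.union_compl_self U]
    refine ContinuousOn.union_of_isOpen ?_ ?_ hU.isOpen hU.compl.isOpen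
    · rw [continuousOn_iff_continuous_domRestrict]
      refine (continuous_subtype_val.comp k.continuous).congr fun u => ?_
      exact (Equiv.Perm.ofSubtype_apply_coe k.toEquiv u).symm
    · exact continuousOn_id.congr fun y hy => Equiv.Perm.ofSubtype_apply_of_not_mem k.toEquiv hy
  refine ⟨⟨Equiv.Perm.ofSubtype k.toEquiv, hcont k, ?_⟩,
    fun u => Equiv.Perm.ofSubtype_apply_coe k.toEquiv u,
    fun y hy => Equiv.Perm.ofSubtype_apply_of_not_mem k.toEquiv hy⟩
  have h : (Equiv.Perm.ofSubtype k.toEquiv : Equiv.Perm Y).symm =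
      Equiv.Perm.ofSubtype k.symm.toEquiv := (map_inv Equiv.Perm.ofSubtype k.toEquiv).symm
  change Continuous (Equiv.Perm.ofSubtype k.toEquiv : Equiv.Perm Y).symm
  rw [h]
  exact hcont k.symm

lemma isInvariantMeasure_comap {X Y : Type*} [TopologicalSpace X] [MeasurableSpace X] [BorelSpace X]
    [TopologicalSpace Y] [MeasurableSpace Y] [BorelSpace Y] {R : Set (X × X)} {S : Set (Y × Y)}
    (hS : ∀ y, (y, y) ∈ S) {ρ : Measure Y} (hρ : IsInvariantMeasure S ρ) {U : Set Y}
    (hU : IsClopen U) (F : X ≃ₜ U) (hF : ∀ x y, (x, y) ∈ R → ((F x : Y), (F y : Y)) ∈ S) :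
    IsInvariantMeasure R (ρ.comap fun x => (F x : Y)) := by
  intro h hh
  have hemb : MeasurableEmbedding fun x => (F x : Y) :=
    (hU.isOpen.isOpenEmbedding_subtypeVal.comp F.isOpenEmbedding).measurableEmbedding
  obtain ⟨g, hg, hg'⟩ := exists_extend_homeomorph hU ((F.symm.trans h).trans F)
  have hgF : ∀ x, g (F x) = F (h x) := fun x => by rw [hg]; simp
  have hginv := hρ g fun y => by
    by_cases hy : y ∈ U
    · obtain ⟨x, hx⟩ := F.surjective ⟨y, hy⟩
      have : y = F x := by rw [hx]
      rw [this, hgF]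
      exact hF _ _ (hh x)
    · rw [hg' y hy]
      exact hS y
  ext A hA
  rw [Measure.map_apply h.measurable hA, hemb.comap_apply, hemb.comap_apply]
  conv_rhs => rw [← hginv, Measure.map_apply g.measurable (hemb.measurableSet_image.2 hA)]
  congr 1
  ext y
  constructor
  · rintro ⟨x, hx, rfl⟩
    exact ⟨h x, hx, (hgF x).symm⟩
  · rintro ⟨x, hx, hxy⟩
    have hxy : (F x : Y) = g y := hxy
    refine ⟨h.symm x, by simpa using hx, ?_⟩
    apply g.injective
    change g (F (h.symm x)) = g y
    rw [hgF, h.apply_symm_apply, hxy]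

namespace Chain

open CantorOE.Chain.Path

variable {C : Chain} {E : AddSubgroup ℝ} {μ : Measure C.Path}

lemma le_of_exhausts (hC : Exhausts C E) {H : AddSubgroup ℝ} (n₀ : ℕ)
    (h : ∀ n ≥ n₀, ∀ b ∈ C.B n, b ∈ H) : E ≤ H := by
  have hpos : ∀ e ∈ E, 0 < e → e ∈ H := by
    intro e he he0
    obtain ⟨N, hN⟩ := hC.2 e he he0
    have h1 := (hN _ (le_max_left N n₀)).mem_closure ⟨_, C.p_mem _⟩
    exact (AddSubmonoid.closure_le (S := H.toAddSubmonoid)).2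
      (fun b hb => h _ (le_max_right N n₀) b hb) h1
  intro e he
  rcases lt_trichotomy e 0 with h0 | rfl | h0
  · rw [← neg_neg e]
    exact H.neg_mem (hpos _ (E.neg_mem he) (neg_pos.2 h0))
  · exact H.zero_mem
  · exact hpos e he h0

lemma IsWeight.real_cyl (hμ : IsWeight μ) (a : C.Path) (n : ℕ) : μ.real (a.cyl n) = (a n).src := by
  rw [Measure.real, hμ, ENNReal.toReal_ofReal (C.pos _ _ (a.src_mem n)).le]

lemma IsWeight.real_prod (hμ : IsWeight μ) {N : ℕ} {W : Set (C.Path × Fin N)}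
    (hW : MeasurableSet W) :
    (μ.prod Measure.count).real W = ∑ i, μ.real {x | (x, i) ∈ W} := by
  have := hμ.isFiniteMeasure
  rw [Measure.real, Measure.prod_apply_symm hW, lintegral_count, tsum_fintype, ENNReal.toReal_sum]
  · rfl
  · exact fun _ _ => measure_ne_top _ _

lemma IsWeight.prod_real_clopen_mem (hμ : IsWeight μ) (hE : ∀ n, ∀ b ∈ C.B n, b ∈ E) {N : ℕ}
    {W : Set (C.Path × Fin N)} (hW : IsClopen W) : (μ.prod Measure.count).real W ∈ E := by
  rw [hμ.real_prod hW.isOpen.measurableSet]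
  exact sum_mem fun i _ => hμ.real_clopen_mem hE (hW.preimage (by fun_prop))

/-- Elements of the fundamental group are multipliers. -/
lemma IsWeight.multiplier_of_mem_fundGroup (hμ : IsWeight μ) (hC : Exhausts C E)
    (h1 : (1 : ℝ) ∈ E) (hroot : C.root = 1) {l : ℝ}
    (hl : l ∈ fundGroup {q : C.Path × C.Path | Rel q.1 q.2} μ) :
    0 < l ∧ (∀ e ∈ E, l * e ∈ E) ∧ ∀ e ∈ E, l⁻¹ * e ∈ E := by
  obtain ⟨N, U, hU, ⟨F, hF⟩, hlU⟩ := hl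
  have := hμ.isFiniteMeasure
  set ρ : Measure (C.Path × Fin N) := μ.prod Measure.count with hρ
  replace hlU : l = ρ.real U := hlU
  have hemb : MeasurableEmbedding fun x => (F x : C.Path × Fin N) :=
    (hU.isOpen.isOpenEmbedding_subtypeVal.comp F.isOpenEmbedding).measurableEmbedding
  set ν : Measure C.Path := ρ.comap fun x => (F x : C.Path × Fin N) with hν
  have hνA : ∀ A, ν A = ρ ((fun x => (F x : C.Path × Fin N)) '' A) := fun A => hemb.comap_apply _ _
  have hνinv : IsInvariantMeasure {q : C.Path × C.Path | Rel q.1 q.2} ν :=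
    isInvariantMeasure_comap (fun z => Or.inl (Tail.refl z.1)) (hμ.isInvariantMeasure_prod N) hU F
      fun x y hxy => (hF x y).1 hxy
  have hrange : Set.range (fun x => (F x : C.Path × Fin N)) = U := by
    rw [Set.range_comp' Subtype.val F, F.surjective.range_eq, Set.image_univ, Subtype.range_val]
  -- small clopen subsets of `U`
  obtain ⟨⟨a, i⟩, hai⟩ : U.Nonempty := ⟨F (mark C true), (F (mark C true)).2⟩
  obtain ⟨n₀, hn₀⟩ := exists_cyl_subset (U := {x | (x, i) ∈ U})
    (hU.isOpen.preimage (by fun_prop)) hai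
  have hsmall : ∀ n ≥ n₀ + 1, ∀ c ∈ C.B n, ∃ W ⊆ U, IsClopen W ∧ ρ.real W = c := by
    intro n hn c hc
    obtain ⟨x, hx⟩ := exists_src_eq n hc
    have hz : (bridge a x n₀ n).src = c := by rw [bridge_gt a x hn, hx]
    refine ⟨(bridge a x n₀).cyl n ×ˢ {i}, ?_, (isClopen_cyl _ _).prod (isClopen_discrete _), ?_⟩
    · rintro ⟨w, j⟩ ⟨hw, rfl⟩
      exact hn₀ fun k hk => (hw k (by omega)).trans (bridge_lt a x hk)
    · rw [measureReal_prod_prod, hμ.real_cyl, hz]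
      simp [Measure.real]
  have hfin : IsFiniteMeasure ρ := inferInstance
  have hl0 : 0 < l := by
    obtain ⟨W, hWU, -, hW⟩ := hsmall _ le_rfl _ (C.p_mem _)
    rw [hlU]
    exact (hW ▸ C.pos _ _ (C.p_mem _)).trans_le (measureReal_mono hWU)
  have hνuniv : ν Set.univ = ENNReal.ofReal l := by
    rw [hνA, Set.image_univ, hrange, hlU, ofReal_measureReal]
  have hl' : ENNReal.ofReal l ≠ 0 := by simpa using hl0
  have hprob : IsProbabilityMeasure ((ENNReal.ofReal l)⁻¹ • ν) := ⟨by
    rw [Measure.smul_apply, hνuniv, smul_eq_mul, ENNReal.inv_mul_cancel hl' ENNReal.ofReal_ne_top]⟩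
  have huniq := hμ.unique hC h1 hroot ((ENNReal.ofReal l)⁻¹ • ν) fun h hh => by
    rw [Measure.map_smul, hνinv h hh]
  have hval : ∀ V, ρ.real ((fun x => (F x : C.Path × Fin N)) '' V) = l * μ.real V := by
    intro V
    rw [← huniq, measureReal_ennreal_smul_apply, ENNReal.toReal_inv, ENNReal.toReal_ofReal hl0.le,
      mul_inv_cancel_left₀ hl0.ne', Measure.real, Measure.real, hνA]
  refine ⟨hl0, ?_, ?_⟩
  · refine le_of_exhausts hC (H := E.comap (AddMonoidHom.mulLeft l)) 0 fun n _ b hb => ?_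
    obtain ⟨x, hx⟩ := exists_src_eq n hb
    change l * b ∈ E
    rw [← hx, ← hμ.real_cyl, ← hval]
    refine hμ.prod_real_clopen_mem hC.1 ⟨?_, ?_⟩
    · exact ((hU.isClosed.isClosedEmbedding_subtypeVal.comp F.isClosedEmbedding).isClosedMap _
        (isClopen_cyl x n).isClosed)
    · exact ((hU.isOpen.isOpenEmbedding_subtypeVal.comp F.isOpenEmbedding).isOpenMap _
        (isClopen_cyl x n).isOpen)
  · refine le_of_exhausts hC (H := E.comap (AddMonoidHom.mulLeft l⁻¹)) (n₀ + 1) fun n hn c hc => ?_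
    obtain ⟨W, hWU, hW, rfl⟩ := hsmall n hn c hc
    change l⁻¹ * _ ∈ E
    have h2 := hval ((fun x => (F x : C.Path × Fin N)) ⁻¹' W)
    rw [Set.image_preimage_eq_of_subset (hrange.symm ▸ hWU)] at h2
    rw [h2, inv_mul_cancel_left₀ hl0.ne']
    exact hμ.real_clopen_mem hC.1 (hW.preimage (continuous_subtype_val.comp F.continuous))

end Chain

namespace Chain

open CantorOE.Chain.Path

variable {C D : Chain} {E : AddSubgroup ℝ} {μ : Measure C.Path}

lemma Path.rel_map_iff {K : C.Path → D.Path} (hT : ∀ x y, Tail (K x) (K y) ↔ Tail x y)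
    (hm : ∀ l, Tail (K (mark C l)) (mark D l)) (x y : C.Path) : Rel (K x) (K y) ↔ Rel x y := by
  have h : ∀ x l, Tail (K x) (mark D l) ↔ Tail x (mark C l) := fun x l => by
    rw [← hT]
    exact ⟨fun h => h.trans (hm l).symm, fun h => h.trans (hm l)⟩
  simp only [Rel, hT, h]

/-- Replace the levels of a chain below `n` by a single root `l`. -/
def reroot (C : Chain) (n : ℕ) {l : ℝ} (hl : 0 < l) (κ : ℝ → ℕ) (h2 : ∀ t ∈ C.B n, 2 ≤ κ t)
    (hs : ∑ t ∈ C.B n, (κ t : ℝ) * t = l) : Chain where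
  B := fun k => Nat.casesOn k {l} fun k => C.B (n + k)
  m := fun k => Nat.casesOn k (fun _ => κ) fun k => C.m (n + k)
  p := fun k => Nat.casesOn k l fun k => C.p (n + k)
  root := l
  zero := rfl
  pos := by
    rintro (_ | k) b hb
    · rwa [Finset.mem_singleton.1 hb]
    · exact C.pos _ b hb
  p_mem := by
    rintro (_ | k)
    · exact Finset.mem_singleton_self l
    · exact C.p_mem _
  indep := by
    rintro (_ | k)
    · have : LinearIndependent ℚ (fun t : ({l} : Finset ℝ) => (t : ℝ)) := by
        refine LinearIndependent.of_subsingleton (⟨l, by simp⟩ : ({l} : Finset ℝ)) hl.ne'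
      exact this
    · exact C.indep _
  two_le := by
    rintro (_ | k) b hb d hd
    · exact h2 d hd
    · exact C.two_le _ b hb d hd
  sum := by
    rintro (_ | k) b hb
    · rw [Finset.mem_singleton.1 hb]
      exact hs
    · exact C.sum _ b hb

section reroot

variable {n : ℕ} {l : ℝ} (hl : 0 < l) (κ : ℝ → ℕ) (h2 : ∀ t ∈ C.B n, 2 ≤ κ t)
  (hs : ∑ t ∈ C.B n, (κ t : ℝ) * t = l)

lemma Exhausts_reroot (hC : Exhausts C E) (hlE : l ∈ E) :
    Exhausts (C.reroot n hl κ h2 hs) E := by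
  constructor
  · rintro (_ | k) b hb
    · rwa [Finset.mem_singleton.1 hb]
    · exact hC.1 _ b hb
  · intro e he he0
    obtain ⟨N, hN⟩ := hC.2 e he he0
    refine ⟨N + 1, fun k hk => ?_⟩
    obtain ⟨k, rfl⟩ := Nat.exists_eq_add_of_le' (show 1 ≤ k by omega)
    exact hN (n + k) (by omega)

/-- Precede a path of the rerooted chain by a standard segment. -/
def unrootFun (a : ℝ → C.Path) (ha : ∀ d ∈ C.B n, (a d n).src = d)
    (y : (C.reroot n hl κ h2 hs).Path) : C.Path :=
  ⟨fun i => if i < n then a (y 1).src i else y (i - n + 1), fun i => by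
    have h0 := ha (y 1).src (y.src_mem 1)
    rcases lt_trichotomy (i + 1) n with h | h | h
    · simpa only [h, (Nat.lt_succ_self i).trans h, if_true] using (a (y 1).src).2 i
    · have h1 : i < n := by omega
      have h3 : ¬ i + 1 < n := by omega
      simp only [h1, h3, if_true, if_false, show i + 1 - n + 1 = 1 by omega]
      refine ⟨(a _).mem_edges i, ?_⟩
      rw [(a _).tgt_eq, h, h0]
    · have h1 : ¬ i < n := by omega
      have h3 : ¬ i + 1 < n := by omega
      simp only [h1, h3, if_false]
      obtain ⟨k, rfl⟩ := Nat.exists_eq_add_of_le (show n ≤ i by omega)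
      have e1 : n + k - n + 1 = k + 1 := by omega
      have e2 : n + k + 1 - n + 1 = k + 1 + 1 := by omega
      rw [e1, e2]
      exact ⟨y.mem_edges (k + 1), y.tgt_eq (k + 1)⟩⟩

variable {hl κ h2 hs} {a : ℝ → C.Path} {ha : ∀ d ∈ C.B n, (a d n).src = d}

lemma unrootFun_lt (y : (C.reroot n hl κ h2 hs).Path) {i : ℕ} (hi : i < n) :
    unrootFun hl κ h2 hs a ha y i = a (y 1).src i := if_pos hi

lemma unrootFun_add (y : (C.reroot n hl κ h2 hs).Path) (k : ℕ) :
    unrootFun hl κ h2 hs a ha y (n + k) = y (k + 1) := by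
  refine (if_neg (by omega)).trans ?_
  rw [Nat.add_sub_cancel_left]

lemma continuous_unrootFun : Continuous (unrootFun hl κ h2 hs a ha) := by
  refine continuous_mk fun i => ?_
  rcases lt_or_ge i n with hi | hi
  · simp only [unrootFun_lt _ hi]
    exact (continuous_of_discreteTopology (f := fun e : Edge => a e.src i)).comp
      (continuous_coord 1)
  · obtain ⟨k, rfl⟩ := Nat.exists_eq_add_of_le hi
    simp only [unrootFun_add]
    exact continuous_coord _

lemma tail_unrootFun_iff (y z : (C.reroot n hl κ h2 hs).Path) :
    Tail (unrootFun hl κ h2 hs a ha y) (unrootFun hl κ h2 hs a ha z) ↔ Tail y z := by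
  constructor
  · rintro ⟨N, hN⟩
    refine ⟨N + 1, fun i hi => ?_⟩
    obtain ⟨k, rfl⟩ := Nat.exists_eq_add_of_le' (show 1 ≤ i by omega)
    have := hN (n + k) (by omega)
    rwa [unrootFun_add, unrootFun_add] at this
  · rintro ⟨N, hN⟩
    refine ⟨n + N, fun i hi => ?_⟩
    obtain ⟨k, rfl⟩ := Nat.exists_eq_add_of_le (show n ≤ i by omega)
    rw [unrootFun_add, unrootFun_add]
    exact hN _ (by omega)

lemma tail_unrootFun_mark (b : Bool) :
    Tail (unrootFun hl κ h2 hs a ha (mark _ b)) (mark C b) := by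
  refine ⟨n, fun i hi => ?_⟩
  obtain ⟨k, rfl⟩ := Nat.exists_eq_add_of_le hi
  rw [unrootFun_add]
  rfl

lemma lab_lt (y : (C.reroot n hl κ h2 hs).Path) : (y 0).lab < (C.B n).sup κ :=
  lt_of_lt_of_le (y.mem_edges 0).2.2 (Finset.le_sup (f := κ) (y.mem_edges 0).2.1)

variable (hl κ h2 hs a ha) in
/-- The embedding of the rerooted path space in the stabilisation of the original one. -/
def unroot (y : (C.reroot n hl κ h2 hs).Path) : C.Path × Fin ((C.B n).sup κ) :=
  (unrootFun hl κ h2 hs a ha y, ⟨(y 0).lab, lab_lt y⟩)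

lemma continuous_unroot : Continuous (unroot hl κ h2 hs a ha) := by
  refine continuous_unrootFun.prodMk ?_
  refine (IsLocallyConstant.iff_exists_open _).2 (fun y => ⟨y.cyl 1, (isClopen_cyl y 1).isOpen,
    mem_cyl_self y 1, fun z hz => ?_⟩) |>.continuous
  exact Fin.ext (congrArg Edge.lab (hz 0 one_pos))

lemma unroot_injective : Function.Injective (unroot hl κ h2 hs a ha) := by
  intro y z h
  obtain ⟨h3, h4⟩ := Prod.mk.inj h
  have hsucc : ∀ k, y (k + 1) = z (k + 1) := fun k => by
    rw [← unrootFun_add (a := a) (ha := ha), ← unrootFun_add (a := a) (ha := ha), h3]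
  refine Path.ext fun k => ?_
  cases k with
  | zero =>
    refine Edge.ext ?_ ?_ (Fin.mk.inj h4)
    · rw [y.src_zero, z.src_zero]
    · rw [y.tgt_eq, z.tgt_eq, hsucc]
  | succ k => exact hsucc k

lemma image_unroot_cyl (z : (C.reroot n hl κ h2 hs).Path) :
    unroot hl κ h2 hs a ha '' z.cyl 1 =
      (unroot hl κ h2 hs a ha z).1.cyl n ×ˢ {(unroot hl κ h2 hs a ha z).2} := by
  have hz : (unrootFun hl κ h2 hs a ha z n).src = (z 1).src := by
    have := unrootFun_add (a := a) (ha := ha) z 0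
    rw [← this]
    rfl
  ext ⟨w, i⟩
  constructor
  · rintro ⟨y, hy, hyw⟩
    obtain ⟨rfl, rfl⟩ := Prod.mk.inj hyw
    have h0 : y 0 = z 0 := hy 0 one_pos
    refine ⟨fun i hi => ?_, Fin.ext (congrArg Edge.lab h0)⟩
    change unrootFun hl κ h2 hs a ha y i = unrootFun hl κ h2 hs a ha z i
    rw [unrootFun_lt _ hi, unrootFun_lt _ hi, src_eq_of_mem_cyl hy]
  · rintro ⟨hw, hi⟩
    have hw : w ∈ (unrootFun hl κ h2 hs a ha z).cyl n := hw
    have hwn : (w n).src = (z 1).src := (src_eq_of_mem_cyl hw).trans hz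
    obtain ⟨y, hy0, hysucc⟩ : ∃ y : (C.reroot n hl κ h2 hs).Path,
        y 0 = z 0 ∧ ∀ k, y (k + 1) = w (n + k) := by
      refine ⟨⟨fun k => Nat.casesOn k (z 0) fun k => w (n + k), ?_⟩, rfl, fun _ => rfl⟩
      rintro (_ | k)
      · exact ⟨z.mem_edges 0, (z.tgt_eq 0).trans hwn.symm⟩
      · exact ⟨w.mem_edges (n + k), w.tgt_eq (n + k)⟩
    refine ⟨y, ?_, ?_⟩
    · intro k hk
      obtain rfl : k = 0 := by omega
      exact hy0
    · refine Prod.ext (Path.ext fun k => ?_)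
        ((Fin.ext (congrArg Edge.lab hy0)).trans (show i = _ from hi).symm)
      change unrootFun hl κ h2 hs a ha y k = w k
      rcases lt_or_ge k n with hk | hk
      · rw [unrootFun_lt _ hk, hw k hk, unrootFun_lt _ hk, hysucc 0]
        change a (w n).src k = _
        rw [hwn]
      · obtain ⟨j, rfl⟩ := Nat.exists_eq_add_of_le hk
        rw [unrootFun_add, hysucc]

lemma isOpen_range_unroot : IsOpen (Set.range (unroot hl κ h2 hs a ha)) := by
  rw [isOpen_iff_mem_nhds]
  rintro _ ⟨z, rfl⟩
  refine Filter.mem_of_superset ?_ (Set.image_subset_range _ (z.cyl 1))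
  rw [image_unroot_cyl]
  exact ((isClopen_cyl _ n).isOpen.prod (isOpen_discrete _)).mem_nhds ⟨mem_cyl_self _ _, rfl⟩

lemma IsWeight.real_range_unroot (hμ : IsWeight μ) :
    (μ.prod Measure.count).real (Set.range (unroot hl κ h2 hs a ha)) = l := by
  have := hμ.isFiniteMeasure
  have hemb : MeasurableEmbedding (unroot hl κ h2 hs a ha) :=
    (continuous_unroot.isClosedEmbedding unroot_injective).measurableEmbedding
  set ρ : Measure (C.Path × Fin ((C.B n).sup κ)) := μ.prod Measure.count
  have hν : ∀ A, (ρ.comap (unroot hl κ h2 hs a ha)).real A =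
      ρ.real (unroot hl κ h2 hs a ha '' A) := fun A => by
    rw [Measure.real, hemb.comap_apply, Measure.real]
  have hfin : IsFiniteMeasure (ρ.comap (unroot hl κ h2 hs a ha)) :=
    ⟨by rw [hemb.comap_apply]; exact measure_lt_top _ _⟩
  have h := measure_cyl_eq (ρ.comap (unroot hl κ h2 hs a ha)) (mark _ true) 0 id fun z => by
    rw [hν, image_unroot_cyl, measureReal_prod_prod, hμ.real_cyl]
    have h3 := unrootFun_add (a := a) (ha := ha) z 0
    change (unrootFun hl κ h2 hs a ha z (n + 0)).src * _ = (z 1).src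
    rw [h3]
    simp [Measure.real]
  rw [cyl_zero, hν, Set.image_univ] at h
  rw [h]
  exact hs

end reroot

/-- Multipliers belong to the fundamental group. -/
lemma IsWeight.mem_fundGroup_of_multiplier (hμ : IsWeight μ) (hC : Exhausts C E)
    (h1 : (1 : ℝ) ∈ E) (hroot : C.root = 1) {l : ℝ} (hl : 0 < l) (hlE : ∀ e ∈ E, l * e ∈ E)
    (hlE' : ∀ e ∈ E, l⁻¹ * e ∈ E) : l ∈ fundGroup {q : C.Path × C.Path | Rel q.1 q.2} μ := by
  have hl1 : l ∈ E := by simpa using hlE 1 h1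
  obtain ⟨n, hn⟩ := hC.2 l hl1 hl
  obtain ⟨κ, h2, hs⟩ := (hn n le_rfl).exists_coeff (C.indep n) ⟨_, C.p_mem n⟩
  obtain ⟨G, hG, hGm⟩ := exists_homeomorph_of_exhausts hC (Exhausts_reroot hl κ h2 hs hC hl1) hl
    hlE hlE' hroot rfl
  have hex : ∀ d, ∃ x : C.Path, d ∈ C.B n → (x n).src = d := by
    intro d
    by_cases hd : d ∈ C.B n
    · obtain ⟨x, hx⟩ := exists_src_eq n hd
      exact ⟨x, fun _ => hx⟩
    · exact ⟨mark C true, fun h => absurd h hd⟩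
  choose a ha using hex
  have hemb := (continuous_unroot (hl := hl) (h2 := h2) (hs := hs) (ha := ha)).isClosedEmbedding
    unroot_injective
  refine ⟨_, Set.range (unroot hl κ h2 hs a ha), ⟨hemb.isClosed_range, isOpen_range_unroot⟩,
    ⟨G.trans hemb.isEmbedding.toHomeomorph, fun x y => ?_⟩, hμ.real_range_unroot.symm⟩
  refine (Path.rel_map_iff (K := fun x => unrootFun hl κ h2 hs a ha (G x)) ?_ ?_ x y).symm
  · intro x y
    rw [tail_unrootFun_iff, hG]
  · intro b
    rw [hGm]
    exact tail_unrootFun_mark b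

end Chain

/-- Every countable dense additive subgroup `E ∋ 1` of `ℝ` is the group of clopen values of a
uniquely ergodic Cantor minimal system whose fundamental group is the group of positive
multipliers of `E`. -/
theorem exists_system (E : AddSubgroup ℝ) (hE : ∀ ε > 0, ∃ e ∈ E, 0 < e ∧ e < ε)
    (hc : (E : Set ℝ).Countable) (h1 : (1 : ℝ) ∈ E) :
    ∃ (X : Type) (_ : TopologicalSpace X) (_ : MeasurableSpace X),
      BorelSpace X ∧ CompactSpace X ∧ TopologicalSpace.MetrizableSpace X ∧
        TotallyDisconnectedSpace X ∧ Nonempty X ∧ Perfect (Set.univ : Set X) ∧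
      ∃ φ : X ≃ₜ X, IsFreeZ φ ∧ IsMinimalRel (orbitRelZ φ) ∧
        ∃ μ : Measure X, IsProbabilityMeasure μ ∧ IsInvariantMeasure (orbitRelZ φ) μ ∧
          (∀ ν : Measure X, IsProbabilityMeasure ν → IsInvariantMeasure (orbitRelZ φ) ν →
            ν = μ) ∧
          fundGroup (orbitRelZ φ) μ =
            {l : ℝ | 0 < l ∧ (∀ e ∈ E, l * e ∈ E) ∧ ∀ e ∈ E, l⁻¹ * e ∈ E} := by
  obtain ⟨C, hroot, hC⟩ := exists_exhausting_chain E hE hc h1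
  obtain ⟨φ, hfree, hmin, hrel⟩ := Chain.exists_vershik C
  obtain ⟨μ, hμ⟩ : ∃ μ : Measure C.Path, Chain.IsWeight μ := Chain.exists_measure C
  refine ⟨C.Path, inferInstance, inferInstance, inferInstance, inferInstance, inferInstance,
    inferInstance, inferInstance, Chain.perfect_path, φ, hfree, hmin, μ, ?_, ?_⟩
  · exact ⟨by rw [hμ.univ, hroot, ENNReal.ofReal_one]⟩
  rw [hrel]
  refine ⟨hμ.isInvariantMeasure, fun ν _ hν => hμ.unique hC h1 hroot ν hν, ?_⟩
  ext l
  exact ⟨hμ.multiplier_of_mem_fundGroup hC h1 hroot,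
    fun h => hμ.mem_fundGroup_of_multiplier hC h1 hroot h.1 h.2.1 h.2.2⟩

lemma exists_small_mem_of_not_int (R : Subring ℝ) {r : ℝ} (hr : r ∈ R)
    (hz : ∀ n : ℤ, r ≠ n) : ∀ ε > 0, ∃ e ∈ R, 0 < e ∧ e < ε := by
  intro ε hε
  have h0 : 0 < Int.fract r :=
    (Int.fract_nonneg r).lt_of_ne' fun h => hz ⌊r⌋ (by linarith [Int.self_sub_floor r])
  obtain ⟨n, hn⟩ := exists_pow_lt_of_lt_one hε (Int.fract_lt_one r)
  exact ⟨_, R.pow_mem (R.sub_mem hr (intCast_mem R ⌊r⌋)) n, pow_pos h0 n, hn⟩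

/-- The group `ℤ + ℤα`. -/
def intSpan (α : ℝ) : AddSubgroup ℝ where
  carrier := {x | ∃ a b : ℤ, x = a + b * α}
  zero_mem' := ⟨0, 0, by simp⟩
  add_mem' := by
    rintro _ _ ⟨a, b, rfl⟩ ⟨c, d, rfl⟩
    exact ⟨a + c, b + d, by push_cast; ring⟩
  neg_mem' := by
    rintro _ ⟨a, b, rfl⟩
    exact ⟨-a, -b, by push_cast; ring⟩

lemma countable_intSpan (α : ℝ) : (intSpan α : Set ℝ).Countable :=
  (Set.countable_range fun p : ℤ × ℤ => (p.1 + p.2 * α : ℝ)).mono <| by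
    rintro _ ⟨a, b, rfl⟩
    exact ⟨(a, b), rfl⟩

lemma exists_small_mem_intSpan {α : ℝ} (hα : Irrational α) :
    ∀ ε > 0, ∃ e ∈ intSpan α, 0 < e ∧ e < ε := by
  intro ε hε
  obtain ⟨n, hn⟩ := exists_nat_gt ε⁻¹
  have hn0 : 0 < n := by
    have := (inv_pos.2 hε).trans hn
    exact_mod_cast this
  obtain ⟨j, k, hk, -, h⟩ := Real.exists_int_int_abs_mul_sub_le α hn0
  have hne : (k : ℝ) * α - j ≠ 0 := fun h0 =>
    (hα.intCast_mul hk.ne').ne_int j (sub_eq_zero.1 h0)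
  refine ⟨|k * α - j|, ?_, abs_pos.2 hne, h.trans_lt ?_⟩
  · have hmem : (k : ℝ) * α - j ∈ intSpan α := ⟨-j, k, by push_cast; ring⟩
    rcases abs_choice ((k : ℝ) * α - j) with h | h <;> rw [h]
    exacts [hmem, neg_mem hmem]
  · rw [div_lt_iff₀ (by positivity)]
    have := (inv_lt_iff_one_lt_mul₀ hε).1 hn
    nlinarith

lemma exists_int_of_mul_mem_intSpan {α : ℝ} (hα : Transcendental ℤ α) {l : ℝ}
    (h : ∀ e ∈ intSpan α, l * e ∈ intSpan α) : ∃ n : ℤ, l = n := by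
  obtain ⟨a, b, hab⟩ := h 1 ⟨1, 0, by simp⟩
  obtain ⟨c, d, hcd⟩ := h α ⟨0, 1, by simp⟩
  rw [mul_one] at hab
  have hp : Polynomial.aeval α (Polynomial.C b * Polynomial.X ^ 2 +
      Polynomial.C (a - d) * Polynomial.X + Polynomial.C (-c) : Polynomial ℤ) = 0 := by
    simp only [map_add, map_mul, map_pow, Polynomial.aeval_C, Polynomial.aeval_X,
      algebraMap_int_eq, Int.coe_castRingHom, Int.cast_sub, Int.cast_neg]
    rw [hab] at hcd
    linear_combination hcd
  have hb := congrArg (Polynomial.coeff · 2) (transcendental_iff.1 hα _ hp)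
  simp only [Polynomial.coeff_add, Polynomial.coeff_C_mul, Polynomial.coeff_X_pow,
    Polynomial.coeff_X, Polynomial.coeff_C, Polynomial.coeff_zero] at hb
  norm_num at hb
  exact ⟨a, by rw [hab, hb, Int.cast_zero, zero_mul, add_zero]⟩

lemma exists_irrational_transcendental : ∃ α : ℝ, Irrational α ∧ Transcendental ℤ α :=
  have h := liouville_liouvilleNumber (le_refl 2)
  ⟨_, h.irrational, h.transcendental⟩

lemma eq_one_of_int {l : ℝ} (hl : 0 < l) (h : ∃ n : ℤ, l = n) (h' : ∃ n : ℤ, l⁻¹ = n) : l = 1 := by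
  obtain ⟨m, hm⟩ := h
  obtain ⟨n, hn⟩ := h'
  have hmn : m * n = 1 := by
    have : (m : ℝ) * n = 1 := by rw [← hm, ← hn, mul_inv_cancel₀ hl.ne']
    exact_mod_cast this
  have hm0 : 0 < m := by
    rw [hm] at hl
    exact_mod_cast hl
  rw [hm, Int.eq_one_of_mul_eq_one_right hm0.le hmn, Int.cast_one]

/-- The positive units of a countable subring of `ℝ` are the positive multipliers of some
countable dense subgroup of `ℝ` containing `1`. -/
lemma exists_addSubgroup_multipliers (R : Subring ℝ) (hR : Countable R) :
    ∃ E : AddSubgroup ℝ, (∀ ε > 0, ∃ e ∈ E, 0 < e ∧ e < ε) ∧ (E : Set ℝ).Countable ∧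
      (1 : ℝ) ∈ E ∧ {l : ℝ | 0 < l ∧ (∀ e ∈ E, l * e ∈ E) ∧ ∀ e ∈ E, l⁻¹ * e ∈ E} =
        {r : ℝ | 0 < r ∧ r ∈ R ∧ r⁻¹ ∈ R} := by
  by_cases hz : ∀ r ∈ R, ∃ n : ℤ, r = n
  · obtain ⟨α, hαi, hα⟩ := exists_irrational_transcendental
    refine ⟨intSpan α, exists_small_mem_intSpan hαi, countable_intSpan α,
      ⟨1, 0, by simp⟩, ?_⟩
    ext l
    constructor
    · rintro ⟨h0, h, h'⟩
      obtain rfl := eq_one_of_int h0 (exists_int_of_mul_mem_intSpan hα h)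
        (exists_int_of_mul_mem_intSpan hα h')
      exact ⟨h0, R.one_mem, by rw [inv_one]; exact R.one_mem⟩
    · rintro ⟨h0, h, h'⟩
      obtain rfl := eq_one_of_int h0 (hz _ h) (hz _ h')
      exact ⟨h0, fun e he => by rwa [one_mul], fun e he => by rwa [inv_one, one_mul]⟩
  · push Not at hz
    obtain ⟨r, hr, hrz⟩ := hz
    refine ⟨R.toAddSubgroup, exists_small_mem_of_not_int R hr hrz, hR, R.one_mem, ?_⟩
    ext l
    constructor
    · rintro ⟨h0, h, h'⟩
      have h1 := h 1 R.one_mem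
      have h2 := h' 1 R.one_mem
      rw [mul_one] at h1 h2
      exact ⟨h0, h1, h2⟩
    · rintro ⟨h0, h, h'⟩
      exact ⟨h0, fun e he => R.mul_mem h he, fun e he => R.mul_mem h' he⟩

end CantorOE

/-- Every countable unital subring `R ⊆ ℝ` arises: there is a uniquely
ergodic Cantor minimal `ℤ`-system whose fundamental group is `R₊^×`. -/
theorem statement10 (R : Subring ℝ) (hR : Countable ↥R) :
    ∃ (X : Type) (_ : TopologicalSpace X) (_ : MeasurableSpace X),
      BorelSpace X ∧ CompactSpace X ∧ TopologicalSpace.MetrizableSpace X ∧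
        TotallyDisconnectedSpace X ∧ Nonempty X ∧ Perfect (Set.univ : Set X) ∧
      ∃ φ : X ≃ₜ X, IsFreeZ φ ∧ IsMinimalRel (orbitRelZ φ) ∧
        ∃ μ : Measure X, IsProbabilityMeasure μ ∧ IsInvariantMeasure (orbitRelZ φ) μ ∧
          (∀ ν : Measure X, IsProbabilityMeasure ν → IsInvariantMeasure (orbitRelZ φ) ν →
            ν = μ) ∧
          fundGroup (orbitRelZ φ) μ = {r : ℝ | 0 < r ∧ r ∈ R ∧ r⁻¹ ∈ R} := by
  obtain ⟨E, hE, hc, h1, hER⟩ := CantorOE.exists_addSubgroup_multipliers R hR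
  rw [← hER]
  exact CantorOE.exists_system E hE hc h1
end

section
/- Let p and q be distinct primes and let ℤ² act freely on ℤ_p × ℤ_q by (n,m)·(x,y) = (x + n, y + m). Then the resulting system R_{ℤ²,φ} is a uniquely ergodic Cantor minimal ℤ²-system, the additive subgroup of ℝ generated by the measures of clopen sets (for the unique invariant probability measure, the product of the normalized Haar measures) equals ℤ[1/p, 1/q], and F(R_{ℤ²,φ}) = {p^n q^m : n, m ∈ ℤ}. -/
open MeasureTheory
open scoped ENNReal

/-- The orbit relation of the translation action `(n,m)·(x,y) = (x+n, y+m)` of `ℤ²` on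
`ℤ_p × ℤ_q`. -/
def prodPadicTranslationRel (p q : ℕ) [Fact p.Prime] [Fact q.Prime] :
    Set ((ℤ_[p] × ℤ_[q]) × (ℤ_[p] × ℤ_[q])) :=
  {z | ∃ n m : ℤ, z.2 = (z.1.1 + (n : ℤ_[p]), z.1.2 + (m : ℤ_[q]))}

section PadicResidues

variable {p : ℕ} [Fact p.Prime]

theorem PadicInt.toZModPow_eq_iff_dvd_sub (k : ℕ) (x y : ℤ_[p]) :
    PadicInt.toZModPow k x = PadicInt.toZModPow k y ↔ (p : ℤ_[p]) ^ k ∣ x - y := by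
  rw [← sub_eq_zero, ← map_sub, ← RingHom.mem_ker, PadicInt.ker_toZModPow,
    Ideal.mem_span_singleton]

theorem PadicInt.toZModPow_eq_iff_dist_le (k : ℕ) (x y : ℤ_[p]) :
    PadicInt.toZModPow k x = PadicInt.toZModPow k y ↔ dist x y ≤ (p : ℝ) ^ (-k : ℤ) := by
  rw [PadicInt.toZModPow_eq_iff_dvd_sub, dist_eq_norm, PadicInt.norm_le_pow_iff_mem_span_pow,
    Ideal.mem_span_singleton]

theorem PadicInt.isOpen_preimage_toZModPow (k : ℕ) (S : Set (ZMod (p ^ k))) :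
    IsOpen (PadicInt.toZModPow (p := p) k ⁻¹' S) := by
  rw [Metric.isOpen_iff]
  intro x hx
  have hp : (0 : ℝ) < p := by exact_mod_cast (Fact.out : p.Prime).pos
  refine ⟨(p : ℝ) ^ (-k : ℤ), zpow_pos hp _, fun y hy => ?_⟩
  have : PadicInt.toZModPow k y = PadicInt.toZModPow k x :=
    (PadicInt.toZModPow_eq_iff_dist_le k y x).2 (Metric.mem_ball.1 hy).le
  simpa [this] using hx

/-- Multiplying by `p ^ a` and adding a natural number does not change the relation of
differing by an integer. -/
theorem PadicInt.exists_int_pow_mul_add_iff (a : ℕ) (x y : ℤ_[p]) (i j : ℕ) :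
    (∃ n : ℤ, (p : ℤ_[p]) ^ a * y + j = (p : ℤ_[p]) ^ a * x + i + n) ↔
      ∃ n : ℤ, y = x + n := by
  have hp : (p : ℤ_[p]) ^ a ≠ 0 :=
    pow_ne_zero _ (by exact_mod_cast (Fact.out : p.Prime).ne_zero)
  constructor
  · rintro ⟨n, hn⟩
    have h : (p : ℤ_[p]) ^ a * (y - x) = ((i + n - j : ℤ) : ℤ_[p]) := by
      push_cast
      linear_combination hn
    obtain ⟨m, hm⟩ := (PadicInt.pow_p_dvd_int_iff a _).1 ⟨_, h.symm⟩
    refine ⟨m, ?_⟩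
    rw [hm] at h
    push_cast at h
    linear_combination mul_left_cancel₀ hp h
  · rintro ⟨n, rfl⟩
    refine ⟨p ^ a * n + j - i, ?_⟩
    push_cast
    ring

/-- Every `p`-adic integer is uniquely of the form `p ^ a * x + i` with `i < p ^ a`. -/
theorem PadicInt.bijective_pow_mul_add (a : ℕ) :
    Function.Bijective fun v : ℤ_[p] × Fin (p ^ a) => (p : ℤ_[p]) ^ a * v.1 + (v.2 : ℕ) := by
  have hp : (p : ℤ_[p]) ^ a ≠ 0 :=
    pow_ne_zero _ (by exact_mod_cast (Fact.out : p.Prime).ne_zero)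
  constructor
  · rintro ⟨x, i⟩ ⟨y, j⟩ h
    simp only at h
    have hij : ((i : ℕ) : ZMod (p ^ a)) = ((j : ℕ) : ZMod (p ^ a)) := by
      have := (PadicInt.toZModPow_eq_iff_dvd_sub a ((i : ℕ) : ℤ_[p]) ((j : ℕ) : ℤ_[p])).2
        ⟨y - x, by linear_combination h⟩
      simpa using this
    have hij' : i = j := by
      rw [ZMod.natCast_eq_natCast_iff] at hij
      exact Fin.ext (Nat.ModEq.eq_of_lt_of_lt hij i.2 j.2)
    subst hij'
    exact Prod.ext (mul_left_cancel₀ hp (add_right_cancel h)) rfl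
  · intro z
    obtain ⟨x, hx⟩ := Ideal.mem_span_singleton.1 (PadicInt.appr_spec a z)
    exact ⟨(x, ⟨z.appr a, z.appr_lt a⟩), by simp only; linear_combination -hx⟩

end PadicResidues

section ProdResidues

variable {p q : ℕ} [Fact p.Prime] [Fact q.Prime]

/-- The residue map `ℤ_p × ℤ_q → ℤ/p^k × ℤ/q^l`. -/
noncomputable def prodResidue (p q : ℕ) [Fact p.Prime] [Fact q.Prime] (k l : ℕ) :
    ℤ_[p] × ℤ_[q] →+* ZMod (p ^ k) × ZMod (q ^ l) :=
  (PadicInt.toZModPow k).prodMap (PadicInt.toZModPow l)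

theorem isOpen_preimage_prodResidue (k l : ℕ) (S : Set (ZMod (p ^ k) × ZMod (q ^ l))) :
    IsOpen (prodResidue p q k l ⁻¹' S) := by
  have : prodResidue p q k l ⁻¹' S = ⋃ s ∈ S,
      (PadicInt.toZModPow (p := p) k ⁻¹' {s.1}) ×ˢ (PadicInt.toZModPow (p := q) l ⁻¹' {s.2}) := by
    ext z
    simp only [prodResidue, Set.mem_preimage, Set.mem_iUnion, Set.mem_prod,
      Set.mem_singleton_iff, exists_prop]
    constructor
    · exact fun h => ⟨_, h, rfl, rfl⟩
    · rintro ⟨s, hs, h1, h2⟩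
      have : ((PadicInt.toZModPow k).prodMap (PadicInt.toZModPow l)) z = s := Prod.ext h1 h2
      rwa [this]
  rw [this]
  exact isOpen_biUnion fun s _ => (PadicInt.isOpen_preimage_toZModPow k _).prod
    (PadicInt.isOpen_preimage_toZModPow l _)

theorem isClopen_preimage_prodResidue (k l : ℕ) (S : Set (ZMod (p ^ k) × ZMod (q ^ l))) :
    IsClopen (prodResidue p q k l ⁻¹' S) :=
  ⟨⟨isOpen_preimage_prodResidue k l Sᶜ⟩, isOpen_preimage_prodResidue k l S⟩

theorem exists_prodResidue_eq_imp_dist_lt {ε : ℝ} (hε : 0 < ε) :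
    ∃ k : ℕ, ∀ x y : ℤ_[p] × ℤ_[q],
      prodResidue p q k k x = prodResidue p q k k y → dist x y < ε := by
  obtain ⟨k, hk⟩ := exists_pow_lt_of_lt_one hε (by norm_num : (1 / 2 : ℝ) < 1)
  have key : ∀ r : ℕ, r.Prime → (r : ℝ) ^ (-k : ℤ) < ε := by
    intro r hr
    refine lt_of_le_of_lt ?_ hk
    have h2 : (2 : ℝ) ≤ r := by exact_mod_cast hr.two_le
    rw [zpow_neg, zpow_natCast, one_div, inv_pow]
    gcongr
  refine ⟨k, fun x y h => ?_⟩
  rw [Prod.dist_eq, max_lt_iff]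
  exact ⟨((PadicInt.toZModPow_eq_iff_dist_le k _ _).1 (congrArg Prod.fst h)).trans_lt
      (key p Fact.out),
    ((PadicInt.toZModPow_eq_iff_dist_le k _ _).1 (congrArg Prod.snd h)).trans_lt
      (key q Fact.out)⟩

/-- Open neighbourhoods of a point contain a residue class. -/
theorem exists_prodResidue_class_subset {V : Set (ℤ_[p] × ℤ_[q])} (hV : IsOpen V)
    {x : ℤ_[p] × ℤ_[q]} (hx : x ∈ V) :
    ∃ k : ℕ, prodResidue p q k k ⁻¹' {prodResidue p q k k x} ⊆ V := by
  obtain ⟨ε, hε, h⟩ := Metric.isOpen_iff.1 hV x hx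
  obtain ⟨k, hk⟩ := exists_prodResidue_eq_imp_dist_lt (p := p) (q := q) hε
  exact ⟨k, fun y hy => h (hk y x hy)⟩

/-- A clopen subset of `ℤ_p × ℤ_q` is a finite union of residue classes. -/
theorem IsClopen.exists_eq_preimage_prodResidue {V : Set (ℤ_[p] × ℤ_[q])} (hV : IsClopen V) :
    ∃ (k : ℕ) (S : Finset (ZMod (p ^ k) × ZMod (q ^ k))), V = prodResidue p q k k ⁻¹' S := by
  obtain ⟨N, hN, -, hNV⟩ :=
    lebesgue_number_of_compact_open hV.1.isCompact hV.2 subset_rfl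
  obtain ⟨ε, hε, h⟩ := Metric.mem_uniformity_dist.1 hN
  obtain ⟨k, hk⟩ := exists_prodResidue_eq_imp_dist_lt (p := p) (q := q) hε
  refine ⟨k, (Set.toFinite (prodResidue p q k k '' V)).toFinset, ?_⟩
  rw [Set.Finite.coe_toFinset]
  refine subset_antisymm (Set.subset_preimage_image _ _) ?_
  rintro y ⟨x, hx, hxy⟩
  exact hNV x hx (h (hk x y hxy))

theorem prodResidue_intCast (k l : ℕ) (n m : ℤ) :
    prodResidue p q k l ((n : ℤ_[p]), (m : ℤ_[q])) = ((n : ZMod (p ^ k)), (m : ZMod (q ^ l))) :=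
  Prod.ext (map_intCast (PadicInt.toZModPow k) n) (map_intCast (PadicInt.toZModPow l) m)

variable [MeasurableSpace (ℤ_[p] × ℤ_[q])] [BorelSpace (ℤ_[p] × ℤ_[q])]

theorem measurableSet_preimage_prodResidue (k l : ℕ) (S : Set (ZMod (p ^ k) × ZMod (q ^ l))) :
    MeasurableSet (prodResidue p q k l ⁻¹' S) :=
  (isOpen_preimage_prodResidue k l S).measurableSet

section Invariant

variable {ν : Measure (ℤ_[p] × ℤ_[q])}

theorem measure_preimage_prodResidue_singleton
    (hν : ∀ n m : ℤ, Measure.map (fun z => z + ((n : ℤ_[p]), (m : ℤ_[q]))) ν = ν) (k l : ℕ)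
    (s : ZMod (p ^ k) × ZMod (q ^ l)) :
    ν (prodResidue p q k l ⁻¹' {s}) = ν (prodResidue p q k l ⁻¹' {0}) := by
  obtain ⟨n, hn⟩ := ZMod.intCast_surjective s.1
  obtain ⟨m, hm⟩ := ZMod.intCast_surjective s.2
  rw [← hν n m, Measure.map_apply (by fun_prop) (measurableSet_preimage_prodResidue k l _), hν]
  congr 1
  ext z
  simp only [Set.mem_preimage, Set.mem_singleton_iff, map_add, prodResidue_intCast, hn, hm]
  simp

theorem measure_preimage_prodResidue_finset
    (hν : ∀ n m : ℤ, Measure.map (fun z => z + ((n : ℤ_[p]), (m : ℤ_[q]))) ν = ν) (k l : ℕ)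
    (S : Finset (ZMod (p ^ k) × ZMod (q ^ l))) :
    ν (prodResidue p q k l ⁻¹' S) = S.card * ν (prodResidue p q k l ⁻¹' {0}) := by
  rw [← sum_measure_preimage_singleton S fun y _ => measurableSet_preimage_prodResidue k l {y}]
  simp [measure_preimage_prodResidue_singleton hν]

/-- Residue classes have equal measure for a measure invariant under integer translations. -/
theorem measureReal_preimage_prodResidue
    (hν : ∀ n m : ℤ, Measure.map (fun z => z + ((n : ℤ_[p]), (m : ℤ_[q]))) ν = ν) (k l : ℕ)
    (S : Finset (ZMod (p ^ k) × ZMod (q ^ l))) :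
    (ν (prodResidue p q k l ⁻¹' S)).toReal =
      S.card * (ν Set.univ).toReal * ((p : ℝ) ^ k * (q : ℝ) ^ l)⁻¹ := by
  have : NeZero (p ^ k) := ⟨pow_ne_zero _ (Fact.out : p.Prime).ne_zero⟩
  have : NeZero (q ^ l) := ⟨pow_ne_zero _ (Fact.out : q.Prime).ne_zero⟩
  have hp : (p : ℝ) ≠ 0 := by exact_mod_cast (Fact.out : p.Prime).ne_zero
  have hq : (q : ℝ) ≠ 0 := by exact_mod_cast (Fact.out : q.Prime).ne_zero
  have hu := measure_preimage_prodResidue_finset hν k l Finset.univ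
  rw [Finset.coe_univ, Set.preimage_univ, Finset.card_univ, Fintype.card_prod, ZMod.card,
    ZMod.card] at hu
  rw [hu, measure_preimage_prodResidue_finset hν k l S]
  simp only [ENNReal.toReal_mul, ENNReal.toReal_natCast]
  push_cast
  field_simp

end Invariant

end ProdResidues

section PiecewiseInvariance

/-- A measure preserved by countably many homeomorphisms `T i` restricts to a measure preserved by
every homeomorphism that agrees with some `T i` at each point. -/
theorem MeasureTheory.Measure.map_comap_eq_of_forall_exists_eq {α β ι : Type*}
    [TopologicalSpace α] [T2Space α] [MeasurableSpace α] [BorelSpace α]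
    [TopologicalSpace β] [MeasurableSpace β] [BorelSpace β] [Countable ι]
    {m : Measure α} (T : ι → α ≃ₜ α) (hT : ∀ i, MeasurePreserving (T i) m m)
    {e : β → α} (he : Topology.IsClosedEmbedding e) (h : β ≃ₜ β)
    (hh : ∀ b, ∃ i, e (h b) = T i (e b)) :
    Measure.map h (m.comap e) = m.comap e := by
  have hem := he.measurableEmbedding
  let A : ι → Set β := fun i => {b | e (h b) = T i (e b)}
  have hA : ∀ i, MeasurableSet (A i) := fun i =>
    (isClosed_eq (he.continuous.comp h.continuous)
      ((T i).continuous.comp he.continuous)).measurableSet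
  have hcov : ⋃ i, h '' A i = Set.univ := by
    rw [← Set.image_iUnion, Set.eq_univ_of_forall (s := ⋃ i, A i) fun b => Set.mem_iUnion.2 (hh b),
      Set.image_univ, h.surjective.range_eq]
  rw [Measure.ext_iff_of_iUnion_eq_univ hcov]
  intro i
  ext S hS
  have hhA : MeasurableSet (h '' A i) :=
    h.toMeasurableEquiv.measurableEmbedding.measurableSet_image.2 (hA i)
  rw [Measure.restrict_apply hS, Measure.restrict_apply hS,
    Measure.map_apply h.continuous.measurable (hS.inter hhA), hem.comap_apply, hem.comap_apply]
  refine Eq.trans ?_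
    ((hT i).measure_preimage_emb (T i).toMeasurableEquiv.measurableEmbedding _)
  congr 1
  ext a
  simp only [Set.mem_image, Set.mem_preimage, Set.mem_inter_iff]
  constructor
  · rintro ⟨b, ⟨hb, c, hc, hcb⟩, rfl⟩
    obtain rfl : c = b := h.injective hcb
    exact ⟨h c, ⟨hb, c, hc, rfl⟩, hc⟩
  · rintro ⟨_, ⟨hb, c, hc, rfl⟩, hca⟩
    refine ⟨c, ⟨hb, c, hc, rfl⟩, (T i).injective ?_⟩
    rw [← hca]
    exact hc.symm

end PiecewiseInvariance

section TranslationRelation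

variable {p q : ℕ} [Fact p.Prime] [Fact q.Prime]

theorem mem_prodPadicTranslationRel {x y : ℤ_[p] × ℤ_[q]} :
    (x, y) ∈ prodPadicTranslationRel p q ↔
      (∃ n : ℤ, y.1 = x.1 + n) ∧ ∃ m : ℤ, y.2 = x.2 + m := by
  simp only [prodPadicTranslationRel, Set.mem_ofPred_eq, Prod.ext_iff, exists_and_left,
    exists_and_right]

theorem add_intCast_ne_self (n m : ℤ) (h : ¬(n = 0 ∧ m = 0)) (z : ℤ_[p] × ℤ_[q]) :
    (z.1 + (n : ℤ_[p]), z.2 + (m : ℤ_[q])) ≠ z := by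
  intro hz
  have h1 := congrArg Prod.fst hz
  have h2 := congrArg Prod.snd hz
  simp only [add_eq_left, Int.cast_eq_zero] at h1 h2
  exact h ⟨h1, h2⟩

theorem isMinimalRel_prodPadicTranslationRel : IsMinimalRel (prodPadicTranslationRel p q) := by
  intro x
  have hd : DenseRange fun nm : ℤ × ℤ =>
      x + Prod.map (Int.cast : ℤ → ℤ_[p]) (Int.cast : ℤ → ℤ_[q]) nm :=
    (Homeomorph.addLeft x).surjective.denseRange.comp
      (PadicInt.denseRange_intCast.prodMap PadicInt.denseRange_intCast)
      (Homeomorph.addLeft x).continuous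
  refine hd.mono ?_
  rintro _ ⟨⟨n, m⟩, rfl⟩
  exact ⟨n, m, rfl⟩

variable [MeasurableSpace (ℤ_[p] × ℤ_[q])]

theorem IsInvariantMeasure.map_add_intCast {ν : Measure (ℤ_[p] × ℤ_[q])}
    (hν : IsInvariantMeasure (prodPadicTranslationRel p q) ν) (n m : ℤ) :
    Measure.map (fun z => z + ((n : ℤ_[p]), (m : ℤ_[q]))) ν = ν :=
  hν (Homeomorph.addRight ((n : ℤ_[p]), (m : ℤ_[q]))) fun _ => ⟨n, m, rfl⟩

variable [BorelSpace (ℤ_[p] × ℤ_[q])]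

/-- A measure invariant under integer translations is invariant under the translation relation. -/
theorem isInvariantMeasure_of_map_add_intCast {ν : Measure (ℤ_[p] × ℤ_[q])}
    (hν : ∀ n m : ℤ, Measure.map (fun z => z + ((n : ℤ_[p]), (m : ℤ_[q]))) ν = ν) :
    IsInvariantMeasure (prodPadicTranslationRel p q) ν := by
  intro h hh
  have := Measure.map_comap_eq_of_forall_exists_eq (m := ν)
    (fun nm : ℤ × ℤ => Homeomorph.addRight ((nm.1 : ℤ_[p]), (nm.2 : ℤ_[q])))
    (fun nm => ⟨(Homeomorph.continuous _).measurable, hν nm.1 nm.2⟩)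
    (e := id) Topology.IsClosedEmbedding.id h
    (fun b => by
      obtain ⟨n, m, hnm⟩ := hh b
      exact ⟨(n, m), hnm⟩)
  rwa [show Measure.comap id ν = ν from Measure.comap_id ν] at this

/-- The translation relation has at most one invariant probability measure. -/
theorem eq_of_isInvariantMeasure {μ ν : Measure (ℤ_[p] × ℤ_[q])} [IsProbabilityMeasure μ]
    [IsProbabilityMeasure ν] (hμ : IsInvariantMeasure (prodPadicTranslationRel p q) μ)
    (hν : IsInvariantMeasure (prodPadicTranslationRel p q) ν) : ν = μ := by
  have hbasis : TopologicalSpace.IsTopologicalBasis {V : Set (ℤ_[p] × ℤ_[q]) | IsClopen V} := by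
    refine TopologicalSpace.isTopologicalBasis_of_isOpen_of_nhds (fun V hV => hV.2) ?_
    intro x V hx hV
    obtain ⟨k, hk⟩ := exists_prodResidue_class_subset hV hx
    exact ⟨prodResidue p q k k ⁻¹' {prodResidue p q k k x},
      isClopen_preimage_prodResidue k k _, rfl, hk⟩
  refine ext_of_generate_finite _
    ((BorelSpace.measurable_eq).trans hbasis.borel_eq_generateFrom)
    (fun s hs t ht _ => hs.inter ht) (fun V hV => ?_) (by simp)
  obtain ⟨k, S, rfl⟩ := hV.exists_eq_preimage_prodResidue
  rw [← ENNReal.toReal_eq_toReal_iff' (measure_ne_top _ _) (measure_ne_top _ _),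
    measureReal_preimage_prodResidue hμ.map_add_intCast,
    measureReal_preimage_prodResidue hν.map_add_intCast]
  simp

/-- The values of an invariant probability measure on clopen sets. -/
theorem clopenValueGroup_eq_closure {μ : Measure (ℤ_[p] × ℤ_[q])} [IsProbabilityMeasure μ]
    (hμ : IsInvariantMeasure (prodPadicTranslationRel p q) μ) :
    clopenValueGroup μ = AddSubgroup.closure
        (Set.range fun nm : ℕ × ℕ => ((p : ℝ) ^ nm.1 * (q : ℝ) ^ nm.2)⁻¹) := by
  refine le_antisymm ((AddSubgroup.closure_le _).2 ?_) (AddSubgroup.closure_mono ?_)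
  · rintro _ ⟨V, hV, rfl⟩
    obtain ⟨k, S, rfl⟩ := hV.exists_eq_preimage_prodResidue
    rw [measureReal_preimage_prodResidue hμ.map_add_intCast, measure_univ, ENNReal.toReal_one,
      mul_one, ← nsmul_eq_mul]
    exact nsmul_mem (AddSubgroup.subset_closure (Set.mem_range_self (k, k))) _
  · rintro _ ⟨⟨k, l⟩, rfl⟩
    refine ⟨prodResidue p q k l ⁻¹' (({0} : Finset (ZMod (p ^ k) × ZMod (q ^ l))) :
      Set (ZMod (p ^ k) × ZMod (q ^ l))), isClopen_preimage_prodResidue k l _, ?_⟩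
    rw [measureReal_preimage_prodResidue hμ.map_add_intCast]
    simp

/-- The value `p ^ a q ^ b / (p ^ c q ^ d)` is realised by the clopen set
`(p ^ c ℤ_p × q ^ d ℤ_q) × {1, …, p ^ a q ^ b}`. -/
theorem zpow_mul_zpow_mem_fundGroup {μ : Measure (ℤ_[p] × ℤ_[q])} [IsProbabilityMeasure μ]
    (hμ : IsInvariantMeasure (prodPadicTranslationRel p q) μ) (a b c d : ℕ) :
    ((p : ℝ) ^ a * (q : ℝ) ^ b) * ((p : ℝ) ^ c * (q : ℝ) ^ d)⁻¹ ∈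
      fundGroup (prodPadicTranslationRel p q) μ := by
  have hp : (p : ℤ_[p]) ≠ 0 := by exact_mod_cast (Fact.out : p.Prime).ne_zero
  have hq : (q : ℤ_[q]) ≠ 0 := by exact_mod_cast (Fact.out : q.Prime).ne_zero
  let f : (ℤ_[p] × Fin (p ^ a)) × (ℤ_[q] × Fin (q ^ b)) → ℤ_[p] × ℤ_[q] :=
    Prod.map (fun v => (p : ℤ_[p]) ^ a * v.1 + (v.2 : ℕ))
      (fun v => (q : ℤ_[q]) ^ b * v.1 + (v.2 : ℕ))
  have hf : Continuous f := by
    have (r : ℕ) [Fact r.Prime] (k : ℕ) : Continuous fun v : ℤ_[r] × Fin (r ^ k) =>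
        (r : ℤ_[r]) ^ k * v.1 + ((v.2 : ℕ) : ℤ_[r]) :=
      (continuous_const.mul continuous_fst).add
        ((continuous_of_discreteTopology (f := fun i : Fin (r ^ k) => ((i : ℕ) : ℤ_[r]))).comp
          continuous_snd)
    exact (this p a).prodMap (this q b)
  have hfb : Function.Bijective f :=
    (PadicInt.bijective_pow_mul_add a).prodMap (PadicInt.bijective_pow_mul_add b)
  let Φ := Continuous.homeoOfEquivCompactToT2 (f := Equiv.ofBijective f hfb) hf
  let g : (ℤ_[p] × Fin (p ^ a)) × (ℤ_[q] × Fin (q ^ b)) → (ℤ_[p] × ℤ_[q]) × Fin (p ^ a * q ^ b) :=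
    fun v => (((p : ℤ_[p]) ^ c * v.1.1, (q : ℤ_[q]) ^ d * v.2.1), finProdFinEquiv (v.1.2, v.2.2))
  have hg : Continuous g := by
    refine .prodMk (by fun_prop) ?_
    exact (continuous_of_discreteTopology (f := finProdFinEquiv)).comp (by fun_prop)
  have hgi : Function.Injective g := by
    rintro ⟨⟨x, i⟩, y, j⟩ ⟨⟨x', i'⟩, y', j'⟩ h
    simpa [g, hp, hq, and_assoc, and_left_comm] using h
  have hrange : Set.range g = (prodResidue p q c d ⁻¹'
      (({0} : Finset (ZMod (p ^ c) × ZMod (q ^ d))) : Set (ZMod (p ^ c) × ZMod (q ^ d)))) ×ˢ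
        Set.univ := by
    ext ⟨z, t⟩
    have key : z ∈ prodResidue p q c d ⁻¹'
        (({0} : Finset (ZMod (p ^ c) × ZMod (q ^ d))) : Set (ZMod (p ^ c) × ZMod (q ^ d))) ↔
        (p : ℤ_[p]) ^ c ∣ z.1 ∧ (q : ℤ_[q]) ^ d ∣ z.2 := by
      rw [Finset.coe_singleton, Set.mem_preimage, Set.mem_singleton_iff, Prod.ext_iff]
      refine and_congr ?_ ?_
      · simpa [prodResidue] using PadicInt.toZModPow_eq_iff_dvd_sub c z.1 0
      · simpa [prodResidue] using PadicInt.toZModPow_eq_iff_dvd_sub d z.2 0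
    rw [Set.mem_prod, key]
    constructor
    · rintro ⟨v, hv⟩
      obtain ⟨rfl, -⟩ := Prod.ext_iff.1 hv
      exact ⟨⟨⟨_, rfl⟩, ⟨_, rfl⟩⟩, trivial⟩
    · rintro ⟨⟨⟨x, hx⟩, ⟨y, hy⟩⟩, -⟩
      refine ⟨((x, (finProdFinEquiv.symm t).1), (y, (finProdFinEquiv.symm t).2)), ?_⟩
      exact Prod.ext (Prod.ext hx.symm hy.symm) (finProdFinEquiv.apply_symm_apply t)
  refine ⟨p ^ a * q ^ b, Set.range g, ?_, ?_, ?_⟩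
  · rw [hrange]
    exact (isClopen_preimage_prodResidue c d _).prod isClopen_univ
  · refine ⟨Φ.symm.trans (hg.isClosedEmbedding hgi).isEmbedding.toHomeomorph, fun x y => ?_⟩
    obtain ⟨v, rfl⟩ := Φ.surjective x
    obtain ⟨w, rfl⟩ := Φ.surjective y
    simp only [Homeomorph.trans_apply, Homeomorph.symm_apply_apply]
    have h1 := PadicInt.exists_int_pow_mul_add_iff a v.1.1 w.1.1 v.1.2 w.1.2
    have h2 := PadicInt.exists_int_pow_mul_add_iff b v.2.1 w.2.1 v.2.2 w.2.2
    have h3 := PadicInt.exists_int_pow_mul_add_iff c v.1.1 w.1.1 0 0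
    have h4 := PadicInt.exists_int_pow_mul_add_iff d v.2.1 w.2.1 0 0
    simp only [Nat.cast_zero, add_zero] at h3 h4
    calc (Φ v, Φ w) ∈ prodPadicTranslationRel p q
        ↔ _ := mem_prodPadicTranslationRel.trans (and_congr h1 h2)
      _ ↔ _ := (mem_prodPadicTranslationRel.trans (and_congr h3 h4)).symm
  · rw [hrange, Measure.prod_prod, ENNReal.toReal_mul,
      measureReal_preimage_prodResidue hμ.map_add_intCast, Measure.count_univ]
    simp
    ring

/-- If `e` embeds the translation relation into `R^n`, then the pulled back measure is invariant. -/
theorem isInvariantMeasure_comap {μ : Measure (ℤ_[p] × ℤ_[q])} [IsProbabilityMeasure μ]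
    (hμ : IsInvariantMeasure (prodPadicTranslationRel p q) μ) {n : ℕ}
    {e : ℤ_[p] × ℤ_[q] → (ℤ_[p] × ℤ_[q]) × Fin n} (he : Topology.IsClosedEmbedding e)
    (hR : ∀ x y, (x, y) ∈ prodPadicTranslationRel p q →
      (e x, e y) ∈ finProdRel (prodPadicTranslationRel p q) n) :
    IsInvariantMeasure (prodPadicTranslationRel p q) ((μ.prod Measure.count).comap e) := by
  intro h hh
  have hc (σ : Equiv.Perm (Fin n)) :
      MeasurePreserving σ (Measure.count : Measure (Fin n)) Measure.count := by
    refine ⟨measurable_from_top, ?_⟩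
    ext s hs
    rw [Measure.map_apply measurable_from_top hs, ← Equiv.image_symm_eq_preimage,
      Measure.count_injective_image σ.symm.injective]
  refine Measure.map_comap_eq_of_forall_exists_eq
    (fun t : (ℤ × ℤ) × Equiv.Perm (Fin n) =>
      (Homeomorph.addRight ((t.1.1 : ℤ_[p]), (t.1.2 : ℤ_[q]))).prodCongr
        t.2.toHomeomorphOfDiscrete)
    (fun t => MeasurePreserving.prod
      ⟨(Homeomorph.continuous _).measurable, hμ.map_add_intCast t.1.1 t.1.2⟩ (hc t.2)) he h
    (fun b => ?_)
  obtain ⟨k, l, hkl⟩ := hR _ _ (hh b)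
  exact ⟨((k, l), Equiv.swap (e b).2 (e (h b)).2),
    Prod.ext hkl (Equiv.swap_apply_left _ _).symm⟩

/-- The measure of a clopen subset of `X × {1, …, n}` is a natural number over a power of `pq`. -/
theorem exists_measure_mul_pow_eq_natCast {μ : Measure (ℤ_[p] × ℤ_[q])} [IsProbabilityMeasure μ]
    (hμ : IsInvariantMeasure (prodPadicTranslationRel p q) μ) {n : ℕ}
    {U : Set ((ℤ_[p] × ℤ_[q]) × Fin n)} (hU : IsClopen U) :
    ∃ N k : ℕ, ((μ.prod Measure.count) U).toReal * ((p : ℝ) * q) ^ k = N := by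
  have hp : (p : ℝ) ≠ 0 := by exact_mod_cast (Fact.out : p.Prime).ne_zero
  have hq : (q : ℝ) ≠ 0 := by exact_mod_cast (Fact.out : q.Prime).ne_zero
  rw [Measure.prod_apply_symm hU.2.measurableSet, lintegral_count, tsum_fintype,
    ENNReal.toReal_sum fun i _ => measure_ne_top _ _]
  refine Finset.sum_induction _ (fun r : ℝ => ∃ N k : ℕ, r * ((p : ℝ) * q) ^ k = N) ?_ ?_ ?_
  · rintro r s ⟨N, k, h⟩ ⟨M, l, h'⟩
    refine ⟨N * (p * q) ^ l + M * (p * q) ^ k, k + l, ?_⟩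
    push_cast
    rw [← h, ← h']
    ring
  · exact ⟨0, 0, by simp⟩
  · intro i _
    obtain ⟨k, S, hS⟩ := (hU.preimage
      (Continuous.prodMk_left i : Continuous fun x : ℤ_[p] × ℤ_[q] =>
        (x, i))).exists_eq_preimage_prodResidue
    refine ⟨S.card, k, ?_⟩
    rw [hS, measureReal_preimage_prodResidue hμ.map_add_intCast, measure_univ, mul_pow]
    simp only [ENNReal.toReal_one]
    field_simp

theorem fundGroup_subset {μ : Measure (ℤ_[p] × ℤ_[q])} [IsProbabilityMeasure μ]
    (hμ : IsInvariantMeasure (prodPadicTranslationRel p q) μ) :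
    fundGroup (prodPadicTranslationRel p q) μ ⊆
      {x : ℝ | ∃ n m : ℤ, x = (p : ℝ) ^ n * (q : ℝ) ^ m} := by
  rintro r ⟨n, U, hU, ⟨F, hF⟩, rfl⟩
  have hpp : p.Prime := Fact.out
  have hqp : q.Prime := Fact.out
  have hp : (p : ℝ) ≠ 0 := by exact_mod_cast hpp.ne_zero
  have hq : (q : ℝ) ≠ 0 := by exact_mod_cast hqp.ne_zero
  let e : ℤ_[p] × ℤ_[q] → (ℤ_[p] × ℤ_[q]) × Fin n := Subtype.val ∘ F
  have he : Topology.IsClosedEmbedding e :=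
    hU.1.isClosedEmbedding_subtypeVal.comp F.isClosedEmbedding
  have hrange : Set.range e = U := by
    rw [F.surjective.range_comp, Subtype.range_coe]
  have hν := isInvariantMeasure_comap hμ he fun x y h => (hF x y).1 h
  have huniv : (μ.prod Measure.count).comap e Set.univ = (μ.prod Measure.count) U := by
    rw [he.measurableEmbedding.comap_apply, Set.image_univ, hrange]
  obtain ⟨k, hk⟩ := exists_prodResidue_class_subset (x := (e 0).1)
    (hU.2.preimage (Continuous.prodMk_left (e 0).2)) (F 0).2
  set C := prodResidue p q k k ⁻¹' {prodResidue p q k k (e 0).1} with hC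
  have hW : IsClopen (C ×ˢ ({(e 0).2} : Set (Fin n))) :=
    (isClopen_preimage_prodResidue k k _).prod (isClopen_discrete _)
  have hWU : C ×ˢ ({(e 0).2} : Set (Fin n)) ⊆ U := by
    rintro ⟨z, i⟩ ⟨hz, hi⟩
    obtain rfl : i = (e 0).2 := hi
    exact hk hz
  have hWval : ((μ.prod Measure.count) (C ×ˢ ({(e 0).2} : Set (Fin n)))).toReal =
      ((p : ℝ) ^ k * (q : ℝ) ^ k)⁻¹ := by
    rw [Measure.prod_prod, Measure.count_singleton, mul_one, hC, ← Finset.coe_singleton,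
      measureReal_preimage_prodResidue hμ.map_add_intCast]
    simp
  obtain ⟨l, S, hS⟩ := (hW.preimage he.continuous).exists_eq_preimage_prodResidue
  have hV := measureReal_preimage_prodResidue hν.map_add_intCast l l S
  rw [← hS, he.measurableEmbedding.comap_apply, Set.image_preimage_eq_of_subset (by rwa [hrange]),
    hWval, huniv] at hV
  obtain ⟨M, j, hM⟩ := exists_measure_mul_pow_eq_natCast hμ hU
  set r := ((μ.prod Measure.count) U).toReal
  have hdvd : M ∣ p ^ (l + j) * q ^ (l + j) := by
    refine ⟨S.card * (p ^ k * q ^ k), ?_⟩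
    have : (p : ℝ) ^ (l + j) * (q : ℝ) ^ (l + j) =
        M * (S.card * ((p : ℝ) ^ k * (q : ℝ) ^ k)) := by
      rw [← hM]
      field_simp at hV
      linear_combination (p : ℝ) ^ j * (q : ℝ) ^ j * hV
    exact_mod_cast this
  obtain ⟨M₁, M₂, h₁, h₂, rfl⟩ := Nat.dvd_mul.1 hdvd
  obtain ⟨a, -, rfl⟩ := (Nat.dvd_prime_pow hpp).1 h₁
  obtain ⟨b, -, rfl⟩ := (Nat.dvd_prime_pow hqp).1 h₂
  refine ⟨a - j, b - j, ?_⟩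
  rw [zpow_sub₀ hp, zpow_sub₀ hq]
  simp only [zpow_natCast]
  push_cast at hM
  field_simp
  linear_combination hM

theorem fundGroup_eq {μ : Measure (ℤ_[p] × ℤ_[q])} [IsProbabilityMeasure μ]
    (hμ : IsInvariantMeasure (prodPadicTranslationRel p q) μ) :
    fundGroup (prodPadicTranslationRel p q) μ =
      {x : ℝ | ∃ n m : ℤ, x = (p : ℝ) ^ n * (q : ℝ) ^ m} := by
  refine (fundGroup_subset hμ).antisymm ?_
  rintro _ ⟨n, m, rfl⟩
  have hp : (p : ℝ) ≠ 0 := by exact_mod_cast (Fact.out : p.Prime).ne_zero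
  have hq : (q : ℝ) ≠ 0 := by exact_mod_cast (Fact.out : q.Prime).ne_zero
  obtain ⟨a, c, rfl⟩ : ∃ a c : ℕ, n = a - c := ⟨n.toNat, (-n).toNat, by omega⟩
  obtain ⟨b, d, rfl⟩ : ∃ b d : ℕ, m = b - d := ⟨m.toNat, (-m).toNat, by omega⟩
  convert zpow_mul_zpow_mem_fundGroup hμ a b c d using 1
  rw [zpow_sub₀ hp, zpow_sub₀ hq]
  simp only [zpow_natCast]
  field_simp

end TranslationRelation

/-- For distinct primes `p, q`, the translation `ℤ²`-action on `ℤ_p × ℤ_q`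
is a free, uniquely ergodic Cantor minimal `ℤ²`-system; the subgroup of `ℝ` generated by the
measures of clopen sets is `ℤ[1/p, 1/q]`, and `F(R) = {p^n q^m : n, m ∈ ℤ}`. -/
theorem statement18 (p q : ℕ) [Fact p.Prime] [Fact q.Prime] (hpq : p ≠ q)
    [MeasurableSpace (ℤ_[p] × ℤ_[q])] [BorelSpace (ℤ_[p] × ℤ_[q])] :
    (∀ n m : ℤ, ¬(n = 0 ∧ m = 0) → ∀ z : ℤ_[p] × ℤ_[q],
      (z.1 + (n : ℤ_[p]), z.2 + (m : ℤ_[q])) ≠ z) ∧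
    IsMinimalRel (prodPadicTranslationRel p q) ∧
    ∃ μ : Measure (ℤ_[p] × ℤ_[q]), IsProbabilityMeasure μ ∧
      IsInvariantMeasure (prodPadicTranslationRel p q) μ ∧
      (∀ ν : Measure (ℤ_[p] × ℤ_[q]), IsProbabilityMeasure ν →
        IsInvariantMeasure (prodPadicTranslationRel p q) ν → ν = μ) ∧
      (∀ a : ℤ_[p] × ℤ_[q], Measure.map (fun z => a + z) μ = μ) ∧
      clopenValueGroup μ = AddSubgroup.closure
        (Set.range fun nm : ℕ × ℕ => ((p : ℝ) ^ nm.1 * (q : ℝ) ^ nm.2)⁻¹) ∧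
      fundGroup (prodPadicTranslationRel p q) μ =
        {x : ℝ | ∃ n m : ℤ, x = (p : ℝ) ^ n * (q : ℝ) ^ m} := by
  have hinv : ∀ a : ℤ_[p] × ℤ_[q], Measure.map (fun z => a + z) (Measure.addHaarMeasure ⊤) =
      Measure.addHaarMeasure (⊤ : TopologicalSpace.PositiveCompacts (ℤ_[p] × ℤ_[q])) :=
    fun a => map_add_left_eq_self _ a
  have hprob : IsProbabilityMeasure
      (Measure.addHaarMeasure (⊤ : TopologicalSpace.PositiveCompacts (ℤ_[p] × ℤ_[q]))) :=
    ⟨by simpa using Measure.addHaarMeasure_self (K₀ :=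
      (⊤ : TopologicalSpace.PositiveCompacts (ℤ_[p] × ℤ_[q])))⟩
  have hμ := isInvariantMeasure_of_map_add_intCast (p := p) (q := q) fun n m => by
    simpa only [add_comm] using hinv ((n : ℤ_[p]), (m : ℤ_[q]))
  exact ⟨add_intCast_ne_self, isMinimalRel_prodPadicTranslationRel, _, hprob, hμ,
    fun ν _ hν => eq_of_isInvariantMeasure hμ hν, hinv, clopenValueGroup_eq_closure hμ,
    fundGroup_eq hμ⟩
end
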